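/- Suppose that 1 < c < 82/79. Then for every sufficiently large positive integer N the equation N = [p^c] + [m^c] has a solution in a prime number p and a square-free positive integer m (i.e. there exists N₀ such that for all integers N ≥ N₀ there exist a prime p and a square-free m ∈ ℕ with [p^c] + [m^c] = N). -/

import Mathlib

namespace PrimeSquarefree

open Finset

/-- The additive character `x ↦ exp (2 π i x)`. -/
noncomputable def ee (x : ℝ) : ℂ := Complex.exp (2 * Real.pi * x * Complex.I)

lemma ee_add (x y : ℝ) : ee (x + y) = ee x * ee y := by
  unfold ee; rw [← Complex.exp_add]; push_cast; ring_nf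

lemma ee_zero : ee 0 = 1 := by simp [ee]

lemma norm_ee (x : ℝ) : ‖ee x‖ = 1 := by
  have : (2 * Real.pi * x * Complex.I : ℂ) = ((2 * Real.pi * x : ℝ) : ℂ) * Complex.I := by
    push_cast; ring
  rw [ee, this, Complex.norm_exp_ofReal_mul_I]

lemma ee_neg (x : ℝ) : ee (-x) = (starRingEnd ℂ) (ee x) := by
  unfold ee
  rw [← Complex.exp_conj]
  simp [Complex.conj_ofNat]

lemma ee_int (k : ℤ) : ee k = 1 := by
  unfold ee
  rw [Complex.exp_eq_one_iff]
  exact ⟨k, by push_cast; ring⟩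

lemma ee_add_int (x : ℝ) (k : ℤ) : ee (x + k) = ee x := by
  rw [ee_add, ee_int, mul_one]

lemma ee_sub (x y : ℝ) : ee (x - y) = ee x * (starRingEnd ℂ) (ee y) := by
  rw [sub_eq_add_neg, ee_add, ee_neg]

/-- Summation by parts. -/
lemma sum_Ico_mul_sub (w E : ℕ → ℂ) {a b : ℕ} (hab : a ≤ b) :
    ∑ n ∈ Ico a (b + 1), w n * (E (n + 1) - E n)
      = w b * E (b + 1) - w a * E a - ∑ n ∈ Ico a b, (w (n + 1) - w n) * E (n + 1) := by
  induction b, hab using Nat.le_induction with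
  | base => simp; ring
  | succ b hb ih =>
    rw [sum_Ico_succ_top (by omega), ih, sum_Ico_succ_top (by omega)]
    ring

lemma norm_sum_Ico_mul_sub_le (w E : ℕ → ℂ) {a b : ℕ} (hab : a ≤ b) {M : ℝ}
    (hE : ∀ n, a ≤ n → n ≤ b + 1 → ‖E n‖ ≤ M) :
    ‖∑ n ∈ Ico a (b + 1), w n * (E (n + 1) - E n)‖
      ≤ (‖w b‖ + ‖w a‖ + ∑ n ∈ Ico a b, ‖w (n + 1) - w n‖) * M := by
  rw [sum_Ico_mul_sub w E hab]
  have h1 : ‖w b * E (b + 1)‖ ≤ ‖w b‖ * M := by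
    rw [norm_mul]; gcongr; exact hE _ (by omega) le_rfl
  have h2 : ‖w a * E a‖ ≤ ‖w a‖ * M := by
    rw [norm_mul]; gcongr; exact hE _ le_rfl (by omega)
  have h3 : ‖∑ n ∈ Ico a b, (w (n + 1) - w n) * E (n + 1)‖
      ≤ (∑ n ∈ Ico a b, ‖w (n + 1) - w n‖) * M := by
    rw [sum_mul]
    refine norm_sum_le_of_le _ fun n hn => ?_
    rw [mem_Ico] at hn
    rw [norm_mul]; gcongr; exact hE _ (by omega) (by omega)
  calc _ ≤ ‖w b * E (b + 1)‖ + ‖w a * E a‖ + ‖∑ n ∈ Ico a b, (w (n + 1) - w n) * E (n + 1)‖ :=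
        (norm_sub_le _ _).trans (by gcongr; exact norm_sub_le _ _)
    _ ≤ _ := by rw [add_mul, add_mul]; gcongr

/-- Partial summation with monotone nonnegative weights. -/
lemma norm_sum_mul_le_of_monotone (w : ℕ → ℝ) (z : ℕ → ℂ) {a b : ℕ} {M W : ℝ}
    (hM : 0 ≤ M) (hW : 0 ≤ W)
    (hw0 : ∀ n ∈ Ico a b, 0 ≤ w n) (hwW : ∀ n ∈ Ico a b, w n ≤ W)
    (hw : ∀ n, a ≤ n → n + 1 < b → w n ≤ w (n + 1))
    (hz : ∀ m, m ≤ b → ‖∑ n ∈ Ico a m, z n‖ ≤ M) :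
    ‖∑ n ∈ Ico a b, (w n : ℂ) * z n‖ ≤ 3 * W * M := by
  rcases Nat.lt_or_ge a b with hab | hab
  · obtain ⟨b, rfl⟩ : ∃ k, b = k + 1 := ⟨b - 1, by omega⟩
    have hab' : a ≤ b := by omega
    have key := norm_sum_Ico_mul_sub_le (fun n => (w n : ℂ)) (fun m => ∑ n ∈ Ico a m, z n)
      hab' (M := M) (fun n _ h2 => hz n h2)
    have e1 : ∑ n ∈ Ico a (b + 1), (w n : ℂ) * (∑ i ∈ Ico a (n + 1), z i - ∑ i ∈ Ico a n, z i)
        = ∑ n ∈ Ico a (b + 1), (w n : ℂ) * z n := by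
      refine sum_congr rfl fun n hn => ?_
      rw [mem_Ico] at hn
      rw [sum_Ico_succ_top hn.1]; ring
    rw [e1] at key
    refine key.trans ?_
    have e2 : ∑ n ∈ Ico a b, ‖((w (n + 1) : ℝ) : ℂ) - (w n : ℂ)‖ = w b - w a := by
      rw [← sum_Ico_sub (f := w) hab']
      refine sum_congr rfl fun n hn => ?_
      rw [mem_Ico] at hn
      rw [← Complex.ofReal_sub, Complex.norm_real, Real.norm_eq_abs, abs_of_nonneg]
      linarith [hw n hn.1 (by omega)]
    have hb := hw0 b (by simp; omega)
    have ha := hw0 a (by simp; omega)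
    have hbW := hwW b (by simp; omega)
    have haW := hwW a (by simp; omega)
    gcongr
    rw [e2, Complex.norm_real, Complex.norm_real, Real.norm_eq_abs, Real.norm_eq_abs,
      abs_of_nonneg hb, abs_of_nonneg ha]
    linarith
  · rw [Ico_eq_empty (by omega)]; simp; positivity

lemma ee_sub_one_inv {x : ℝ} (hx : Real.sin (Real.pi * x) ≠ 0) :
    (-1 / 2 + Complex.I / 2 * (Real.tan (Real.pi * x - Real.pi / 2) : ℝ)) * (ee x - 1) = 1 := by
  have h1 : Real.tan (Real.pi * x - Real.pi / 2)
      = - Real.cos (Real.pi * x) / Real.sin (Real.pi * x) := by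
    rw [Real.tan_eq_sin_div_cos, Real.sin_sub_pi_div_two, Real.cos_sub_pi_div_two]
  have h2 : ee x = (Real.cos (Real.pi * x) + Real.sin (Real.pi * x) * Complex.I) ^ 2 := by
    unfold ee
    rw [Complex.ofReal_cos, Complex.ofReal_sin, ← Complex.exp_mul_I, ← Complex.exp_nat_mul]
    push_cast; ring_nf
  have h3 : ((Real.sin (Real.pi * x) : ℝ) : ℂ) ≠ 0 := by exact_mod_cast hx
  have h4 : ((Real.sin (Real.pi * x) : ℝ) : ℂ) ^ 2 + ((Real.cos (Real.pi * x) : ℝ) : ℂ) ^ 2 = 1 := by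
    exact_mod_cast Real.sin_sq_add_cos_sq _
  rw [h1, h2]
  push_cast at h3 h4 ⊢
  set s := Complex.sin (Real.pi * x)
  set c := Complex.cos (Real.pi * x)
  have hI := Complex.I_sq
  have e1 : (c + s * Complex.I) ^ 2 - 1 = 2 * Complex.I * s * (c + Complex.I * s) := by
    linear_combination h4 - s ^ 2 * hI
  have e2 : -1 / 2 + Complex.I / 2 * (-c / s) = -Complex.I * (c - Complex.I * s) / (2 * s) := by
    field_simp
    linear_combination (-s) * hI
  rw [e1, e2]
  field_simp
  linear_combination (-c ^ 2 + Complex.I ^ 2 * s ^ 2 - s ^ 2) * hI + h4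

/-- The Kusmin–Landau inequality for a phase whose first difference `g` is monotone. -/
lemma kusmin_landau (f : ℕ → ℝ) {a b : ℕ} (ν : ℤ) {δ : ℝ} (hδ : 0 < δ)
    (hlo : ∀ n ∈ Ico a b, ν + δ ≤ f (n + 1) - f n)
    (hhi : ∀ n ∈ Ico a b, f (n + 1) - f n ≤ ν + 1 - δ)
    (hmono : ∀ n, a ≤ n → n + 1 < b → f (n + 1) - f n ≤ f (n + 2) - f (n + 1)) :
    ‖∑ n ∈ Ico a b, ee (f n)‖ ≤ 2 / δ := by
  rcases Nat.lt_or_ge a b with hab | hab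
  swap
  · rw [Ico_eq_empty (by omega)]; simp; positivity
  obtain ⟨b, rfl⟩ : ∃ k, b = k + 1 := ⟨b - 1, by omega⟩
  have hab' : a ≤ b := by omega
  have hδ2 : δ ≤ 1 / 2 := by
    have h1 := hlo a (by simp; omega)
    have h2 := hhi a (by simp; omega)
    linarith
  set x : ℕ → ℝ := fun n => f (n + 1) - f n - ν with hx
  have hx1 : ∀ n ∈ Ico a (b + 1), δ ≤ x n := fun n hn => by simp only [hx]; linarith [hlo n hn]
  have hx2 : ∀ n ∈ Ico a (b + 1), x n ≤ 1 - δ := fun n hn => by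
    simp only [hx]; linarith [hhi n hn]
  set t : ℕ → ℝ := fun n => Real.tan (Real.pi * x n - Real.pi / 2) with ht
  have hpi := Real.pi_gt_three
  have htan : Real.tan (Real.pi / 2 - Real.pi * δ) ≤ 1 / (2 * δ) := by
    rw [Real.tan_pi_div_two_sub]
    rcases hδ2.lt_or_eq with h | h
    · have h1 := Real.lt_tan (x := Real.pi * δ) (by positivity) (by nlinarith)
      rw [← one_div]
      apply one_div_le_one_div_of_le (by positivity)
      nlinarith
    · rw [h, mul_one_div, Real.tan_pi_div_two]; norm_num
  have hIoo : ∀ y : ℝ, δ ≤ y → y ≤ 1 - δ →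
      Real.pi * y - Real.pi / 2 ∈ Set.Ioo (-(Real.pi / 2)) (Real.pi / 2) := fun y h1 h2 => by
    constructor <;> nlinarith
  have tmono : ∀ y z : ℝ, δ ≤ y → y ≤ z → z ≤ 1 - δ →
      Real.tan (Real.pi * y - Real.pi / 2) ≤ Real.tan (Real.pi * z - Real.pi / 2) :=
    fun y z h1 h2 h3 => Real.strictMonoOn_tan.monotoneOn (hIoo y h1 (h2.trans h3))
      (hIoo z (h1.trans h2) h3) (by nlinarith)
  have habs : ∀ n ∈ Ico a (b + 1), |t n| ≤ 1 / (2 * δ) := by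
    intro n hn
    rw [abs_le]
    constructor
    · have := tmono δ (x n) le_rfl (hx1 n hn) (hx2 n hn)
      have e : Real.tan (Real.pi * δ - Real.pi / 2) = - Real.tan (Real.pi / 2 - Real.pi * δ) := by
        rw [← Real.tan_neg]; ring_nf
      simp only [ht]
      linarith
    · have := tmono (x n) (1 - δ) (hx1 n hn) (hx2 n hn) le_rfl
      have e : Real.pi * (1 - δ) - Real.pi / 2 = Real.pi / 2 - Real.pi * δ := by ring
      rw [e] at this
      simp only [ht]
      linarith
  set w : ℕ → ℂ := fun n => -1 / 2 + Complex.I / 2 * (t n : ℝ) with hw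
  have hwE : ∀ n ∈ Ico a (b + 1), w n * (ee (f (n + 1)) - ee (f n)) = ee (f n) := by
    intro n hn
    have hs : Real.sin (Real.pi * x n) ≠ 0 := by
      apply ne_of_gt
      have h1 := hx1 n hn
      have h2 := hx2 n hn
      apply Real.sin_pos_of_pos_of_lt_pi <;> nlinarith
    have h1 := ee_sub_one_inv hs
    have h2 : ee (f (n + 1)) = ee (f n) * ee (x n) := by
      rw [← ee_add, ← ee_add_int _ (-ν)]
      congr 1; simp only [hx]; push_cast; ring
    rw [h2]
    simp only [hw, ht]
    linear_combination (ee (f n)) * h1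
  have hwn : ∀ n ∈ Ico a (b + 1), ‖w n‖ ≤ 1 / (2 * δ) := by
    intro n hn
    have h1 : ‖w n‖ ≤ 1 / 2 + 1 / 2 * |t n| := by
      refine (norm_add_le _ _).trans ?_
      rw [norm_mul, Complex.norm_real, Real.norm_eq_abs]
      norm_num
    have h2 := habs n hn
    have h3 : 1 ≤ 1 / (2 * δ) := by rw [le_div_iff₀ (by positivity)]; linarith
    linarith
  have key := norm_sum_Ico_mul_sub_le w (fun n => ee (f n)) hab' (M := 1)
    (fun n _ _ => (norm_ee _).le)
  rw [sum_congr rfl hwE] at key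
  have e2 : ∑ n ∈ Ico a b, ‖w (n + 1) - w n‖ = 1 / 2 * (t b - t a) := by
    rw [← sum_Ico_sub (f := t) hab', mul_sum]
    refine sum_congr rfl fun n hn => ?_
    rw [mem_Ico] at hn
    have h0 : t n ≤ t (n + 1) := by
      apply tmono _ _ (hx1 n (by simp; omega)) _ (hx2 (n + 1) (by simp; omega))
      have := hmono n hn.1 (by omega)
      simp only [hx]; linarith
    have e : w (n + 1) - w n = ((1 / 2 * (t (n + 1) - t n) : ℝ) : ℂ) * Complex.I := by
      simp only [hw]; push_cast; ring
    rw [e, norm_mul, Complex.norm_I, mul_one, Complex.norm_real, Real.norm_eq_abs, abs_of_nonneg]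
    linarith
  have hb := habs b (by simp; omega)
  have ha := habs a (by simp; omega)
  have hb' := hwn b (by simp; omega)
  have ha' := hwn a (by simp; omega)
  rw [abs_le] at ha hb
  rw [e2] at key
  have e3 : 2 / δ = 4 * (1 / (2 * δ)) := by field_simp; norm_num
  rw [e3]
  linarith

lemma exists_cut (g : ℕ → ℝ) {a b : ℕ} (hab : a ≤ b)
    (hmono : ∀ n, a ≤ n → n + 1 < b → g n ≤ g (n + 1)) (τ : ℝ) :
    ∃ k, a ≤ k ∧ k ≤ b ∧ (∀ n, a ≤ n → n < k → g n < τ) ∧ (∀ n, k ≤ n → n < b → τ ≤ g n) := by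
  induction b, hab using Nat.le_induction with
  | base => exact ⟨a, le_rfl, le_rfl, fun n h1 h2 => by omega, fun n h1 h2 => by omega⟩
  | succ b hb ih =>
    obtain ⟨k, h1, h2, h3, h4⟩ := ih fun n h1 h2 => hmono n h1 (by omega)
    rcases lt_or_ge (g b) τ with h | h
    · refine ⟨b + 1, by omega, le_rfl, fun n hn1 hn2 => ?_, fun n hn1 hn2 => by omega⟩
      have : ∀ m, m ≤ b → a ≤ m → g m ≤ g b := by
        intro m hm ha
        have hq : ∀ q, m ≤ q → q ≤ b → g m ≤ g q := by
          intro q hq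
          induction q, hq using Nat.le_induction with
          | base => exact fun _ => le_rfl
          | succ q hq ih =>
            exact fun hqb => (ih (by omega)).trans (hmono q (by omega) (by omega))
        exact hq b hm le_rfl
      exact (this n (by omega) hn1).trans_lt h
    · refine ⟨k, h1, by omega, h3, fun n hn1 hn2 => ?_⟩
      rcases Nat.lt_or_ge n b with h5 | h5
      · exact h4 n hn1 h5
      · obtain rfl : n = b := by omega
        exact h

lemma le_of_gap (g : ℕ → ℝ) {a b : ℕ} {lam : ℝ}
    (hgap : ∀ n, a ≤ n → n + 1 < b → g n + lam ≤ g (n + 1)) {p q : ℕ} (hp : a ≤ p) (hpq : p ≤ q)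
    (hq : q < b) : g p + lam * (q - p : ℕ) ≤ g q := by
  induction q, hpq using Nat.le_induction with
  | base => simp
  | succ q h ih =>
    have h1 := ih (by omega)
    have h2 := hgap q (by omega) (by omega)
    have h3 : q + 1 - p = (q - p) + 1 := by omega
    rw [h3]; push_cast; linarith

lemma norm_sum_ee_le_card (f : ℕ → ℝ) (s : Finset ℕ) : ‖∑ n ∈ s, ee (f n)‖ ≤ #s :=
  (norm_sum_le _ _).trans (by simp [norm_ee])

lemma norm_sum_ee_le_of_short (f g : ℕ → ℝ) {a b : ℕ} {lam τ δ : ℝ} (hlam : 0 < lam) (hδ : 0 ≤ δ)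
    (hgap : ∀ n, a ≤ n → n + 1 < b → g n + lam ≤ g (n + 1)) {p q : ℕ} (hp : a ≤ p)
    (hq : q ≤ b) (h1 : ∀ n ∈ Ico p q, τ ≤ g n) (h2 : ∀ n ∈ Ico p q, g n < τ + δ) :
    ‖∑ n ∈ Ico p q, ee (f n)‖ ≤ δ / lam + 1 := by
  refine (norm_sum_ee_le_card _ _).trans ?_
  rw [Nat.card_Ico]
  rcases Nat.lt_or_ge p q with h | h
  · obtain ⟨q, rfl⟩ : ∃ k, q = k + 1 := ⟨q - 1, by omega⟩
    have h3 := le_of_gap g hgap (q := q) hp (by omega) (by omega)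
    have h4 := h1 p (by simp; omega)
    have h5 := h2 q (by simp; omega)
    have h6 : ((q - p : ℕ) : ℝ) ≤ δ / lam := by
      rw [le_div_iff₀ hlam]; linarith
    have h7 : q + 1 - p = (q - p) + 1 := by omega
    rw [h7]; push_cast; linarith
  · rw [Nat.sub_eq_zero_of_le h]; simp; positivity

lemma norm_fiber_le (f : ℕ → ℝ) {a b : ℕ} {lam : ℝ} (hlam : 0 < lam) (hlam1 : lam ≤ 1)
    (hab : a ≤ b)
    (hgap : ∀ n, a ≤ n → n + 1 < b →
      f (n + 1) - f n + lam ≤ f (n + 2) - f (n + 1)) (ν : ℤ) :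
    ‖∑ n ∈ Ico a b with ⌊f (n + 1) - f n⌋ = ν, ee (f n)‖ ≤ 7 / √lam := by
  have hs : 0 < √lam := Real.sqrt_pos.2 hlam
  have hs1 : √lam ≤ 1 := Real.sqrt_le_one.2 hlam1
  have hsq : √lam * √lam = lam := Real.mul_self_sqrt hlam.le
  set g : ℕ → ℝ := fun n => f (n + 1) - f n with hg
  have hmono : ∀ n, a ≤ n → n + 1 < b → g n ≤ g (n + 1) := fun n h1 h2 => by
    have := hgap n h1 h2; simp only [hg]; linarith
  set δ := √lam / 2 with hδ
  obtain ⟨k0, a0, b0, l0, u0⟩ := exists_cut g hab hmono ν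
  obtain ⟨k1, a1, b1, l1, u1⟩ := exists_cut g hab hmono (ν + δ)
  obtain ⟨k2, a2, b2, l2, u2⟩ := exists_cut g hab hmono (ν + 1 - δ)
  obtain ⟨k3, a3, b3, l3, u3⟩ := exists_cut g hab hmono (ν + 1)
  have hle : ∀ k k' : ℕ, ∀ τ τ' : ℝ, τ ≤ τ' → a ≤ k' → k ≤ b → (∀ n, a ≤ n → n < k → g n < τ) →
      (∀ n, k' ≤ n → n < b → τ' ≤ g n) → k ≤ k' := by
    intro k k' τ τ' h h0 hk h1 h2
    by_contra hc
    have h3 := h1 k' h0 (by omega)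
    have h4 := h2 k' le_rfl (by omega)
    linarith
  have k01 : k0 ≤ k1 := hle k0 k1 _ _ (by simp; positivity) a1 b0 l0 u1
  have k12 : k1 ≤ k2 := hle k1 k2 _ _ (by linarith) a2 b1 l1 u2
  have k23 : k2 ≤ k3 := hle k2 k3 _ _ (by simp; positivity) a3 b2 l2 u3
  have hfib : (Ico a b).filter (fun n => ⌊g n⌋ = ν) = Ico k0 k3 := by
    ext n
    simp only [mem_filter, mem_Ico, Int.floor_eq_iff]
    constructor
    · rintro ⟨⟨h1, h2⟩, h3, h4⟩
      constructor
      · by_contra hc; linarith [l0 n h1 (by omega)]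
      · by_contra hc; linarith [u3 n (by omega) h2]
    · rintro ⟨h1, h2⟩
      exact ⟨⟨by omega, by omega⟩, u0 n h1 (by omega), l3 n (by omega) h2⟩
  rw [hfib, ← sum_Ico_consecutive _ (k01.trans k12) k23, ← sum_Ico_consecutive _ k01 k12]
  have hgap' : ∀ n, a ≤ n → n + 1 < b → g n + lam ≤ g (n + 1) := hgap
  have s1 : ‖∑ n ∈ Ico k0 k1, ee (f n)‖ ≤ δ / lam + 1 :=
    norm_sum_ee_le_of_short f g (τ := ν) hlam (by positivity) hgap' a0 b1
      (fun n hn => by rw [mem_Ico] at hn; exact u0 n hn.1 (by omega))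
      (fun n hn => by rw [mem_Ico] at hn; exact l1 n (by omega) hn.2)
  have s3 : ‖∑ n ∈ Ico k2 k3, ee (f n)‖ ≤ δ / lam + 1 :=
    norm_sum_ee_le_of_short f g (τ := ν + 1 - δ) hlam (by positivity) hgap' a2 b3
      (fun n hn => by rw [mem_Ico] at hn; exact u2 n hn.1 (by omega))
      (fun n hn => by rw [mem_Ico] at hn; linarith [l3 n (by omega) hn.2])
  have s2 : ‖∑ n ∈ Ico k1 k2, ee (f n)‖ ≤ 2 / δ :=
    kusmin_landau f ν (by positivity)
      (fun n hn => by rw [mem_Ico] at hn; exact u1 n hn.1 (by omega))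
      (fun n hn => by rw [mem_Ico] at hn; exact (l2 n (by omega) hn.2).le)
      (fun n h1 h2 => hmono n (by omega) (by omega))
  have e1 : δ / lam = 1 / 2 * (1 / √lam) := by
    rw [hδ]; field_simp; nlinarith
  have e2 : 2 / δ = 4 * (1 / √lam) := by rw [hδ]; field_simp; norm_num
  have e3 : 1 ≤ 1 / √lam := by rw [le_div_iff₀ hs]; linarith
  have e4 : 7 / √lam = 7 * (1 / √lam) := by ring
  rw [e4]
  refine (norm_add_le _ _).trans ((add_le_add (norm_add_le _ _) le_rfl).trans ?_)
  linarith

/-- Van der Corput's second derivative test, in terms of second differences. -/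
lemma van_der_corput (f : ℕ → ℝ) {a b : ℕ} {lam L : ℝ} (hlam : 0 < lam) (hlam1 : lam ≤ 1)
    (hgap : ∀ n, a ≤ n → n + 1 < b →
      f (n + 1) - f n + lam ≤ f (n + 2) - f (n + 1))
    (hL0 : 0 ≤ L)
    (hL : ∀ n m, a ≤ n → n ≤ m → m < b → f (m + 1) - f m - (f (n + 1) - f n) ≤ L) :
    ‖∑ n ∈ Ico a b, ee (f n)‖ ≤ 7 * (L + 2) / √lam := by
  have hs : 0 < √lam := Real.sqrt_pos.2 hlam
  rcases Nat.lt_or_ge a b with hab | hab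
  swap
  · rw [Ico_eq_empty (by omega)]; simp; positivity
  have hmono : ∀ n m, a ≤ n → n ≤ m → m < b → f (n + 1) - f n ≤ f (m + 1) - f m := by
    intro n m h1 h2
    induction m, h2 using Nat.le_induction with
    | base => exact fun _ => le_rfl
    | succ m h2 ih =>
      intro h3
      have h4 := ih (by omega)
      have h5 := hgap m (by omega) h3
      linarith
  set u := ⌊f (a + 1) - f a⌋ with hu
  set v := ⌊f (b - 1 + 1) - f (b - 1)⌋ with hv
  have hmaps : ∀ n ∈ Ico a b, ⌊f (n + 1) - f n⌋ ∈ Icc u v := by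
    intro n hn
    rw [mem_Ico] at hn
    rw [mem_Icc]
    exact ⟨Int.floor_le_floor (hmono a n le_rfl hn.1 hn.2),
      Int.floor_le_floor (hmono n (b - 1) hn.1 (by omega) (by omega))⟩
  rw [← sum_fiberwise_of_maps_to hmaps]
  refine (norm_sum_le_of_le _ fun ν _ => norm_fiber_le f hlam hlam1 hab.le hgap ν).trans ?_
  have huv : (v : ℝ) - u ≤ L + 1 := by
    have h1 := hL a (b - 1) le_rfl (by omega) (by omega)
    have h2 := Int.floor_le (f (b - 1 + 1) - f (b - 1))
    have h3 := Int.lt_floor_add_one (f (a + 1) - f a)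
    rw [← hu] at h3
    rw [← hv] at h2
    linarith
  have hcard : (#(Icc u v) : ℝ) ≤ L + 2 := by
    rw [Int.card_Icc]
    rcases le_or_gt 0 (v + 1 - u) with h | h
    · have : (((v + 1 - u).toNat : ℤ) : ℝ) = ((v + 1 - u : ℤ) : ℝ) := by
        rw [Int.toNat_of_nonneg h]
      rw [Int.cast_natCast] at this
      rw [this]; push_cast; linarith
    · rw [Int.toNat_of_nonpos h.le]; simp; linarith
  rw [sum_const, nsmul_eq_mul]
  calc (#(Icc u v) : ℝ) * (7 / √lam) ≤ (L + 2) * (7 / √lam) := by gcongr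
    _ = _ := by ring

lemma rpow_mvt (p : ℝ) {x y : ℝ} (hx : 0 < x) (hxy : x < y) :
    ∃ ξ ∈ Set.Ioo x y, y ^ p - x ^ p = p * ξ ^ (p - 1) * (y - x) := by
  obtain ⟨ξ, hξ, h⟩ := exists_hasDerivAt_eq_slope (fun t : ℝ => t ^ p)
    (fun t => p * t ^ (p - 1)) hxy
    (fun t ht => (Real.continuousAt_rpow_const _ _
      (Or.inl (by linarith [ht.1] : (0:ℝ) < t).ne')).continuousWithinAt)
    (fun t ht => Real.hasDerivAt_rpow_const (Or.inl (by linarith [ht.1] : (0:ℝ) < t).ne'))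
  refine ⟨ξ, hξ, ?_⟩
  have : y - x ≠ 0 := by linarith
  rw [h]; field_simp

lemma second_diff_rpow_ge {c : ℝ} (hc : 1 < c) (hc2 : c < 2) {x : ℝ} (hx : 0 < x) :
    c * (c - 1) * (x + 2) ^ (c - 2) ≤ (x + 2) ^ c - (x + 1) ^ c - ((x + 1) ^ c - x ^ c) := by
  obtain ⟨ξ, hξ, h⟩ := exists_hasDerivAt_eq_slope (fun t : ℝ => (t + 1) ^ c - t ^ c)
    (fun t => (c * (t + 1) ^ (c - 1)) - c * t ^ (c - 1)) (show x < x + 1 by linarith)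
    (by
      intro t ht
      apply ContinuousAt.continuousWithinAt
      have ht0 : 0 < t := by linarith [ht.1]
      apply ContinuousAt.sub
      · exact ContinuousAt.rpow_const (by fun_prop) (Or.inl (by positivity))
      · exact ContinuousAt.rpow_const (by fun_prop) (Or.inl (by positivity)))
    (by
      intro t ht
      have ht0 : 0 < t := by linarith [ht.1]
      apply HasDerivAt.sub
      · have := ((hasDerivAt_id t).add_const 1).rpow_const (p := c)
          (Or.inl (by simp only [id]; positivity))
        simpa using this
      · exact Real.hasDerivAt_rpow_const (Or.inl ht0.ne'))
  have hξ0 : 0 < ξ := by linarith [hξ.1]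
  obtain ⟨η, hη, h2⟩ := rpow_mvt (c - 1) hξ0 (show ξ < ξ + 1 by linarith)
  have h3 : (x + 2) ^ (c - 2) ≤ η ^ (c - 1 - 1) := by
    rw [show c - 1 - 1 = c - 2 by ring]
    apply Real.rpow_le_rpow_of_nonpos (by linarith [hη.1]) (by linarith [hη.2, hξ.2]) (by linarith)
  have h4 : x + 1 + 1 = x + 2 := by ring
  rw [h4] at h
  have h5 : (x + 2) ^ c - (x + 1) ^ c - ((x + 1) ^ c - x ^ c)
      = c * (c - 1) * η ^ (c - 1 - 1) := by
    have : x + 1 - x = 1 := by ring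
    rw [this, div_one] at h
    rw [← h]
    have e : ξ + 1 - ξ = 1 := by ring
    rw [e, mul_one] at h2
    rw [← mul_sub, h2]; ring
  rw [h5]
  have : 0 ≤ c * (c - 1) := by nlinarith
  gcongr

/-- The exponential sum bound for `Y n ^ c` coming from the second derivative test. -/
lemma exists_norm_sum_ee_rpow_le {c : ℝ} (hc : 1 < c) (hc2 : c < 2) {κ : ℝ} (hκ : 1 ≤ κ) :
    ∃ C : ℝ, 0 < C ∧ ∀ (B Y : ℝ) (a b : ℕ), 1 ≤ B → Y ≠ 0 →
      (∀ n ∈ Ico a b, B ≤ (n : ℝ) ∧ (n : ℝ) ≤ κ * B) →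
      ‖∑ n ∈ Ico a b, ee (Y * (n : ℝ) ^ c)‖
        ≤ C * (√(|Y| * B ^ c) + B / √(|Y| * B ^ c)) := by
  have hcc : 0 < c * (c - 1) := by nlinarith
  set c2 := c * (c - 1) * (κ + 1) ^ (c - 2) with hc2def
  have hc20 : 0 < c2 := by positivity
  set c3 := c * (κ + 1) ^ (c - 1) with hc3def
  have hc30 : 0 < c3 := by positivity
  set C := 7 * (c3 + 2) / √c2 + (κ + 1) * √c2 with hC
  have hC0 : 0 < C := by positivity
  have hpos : ∀ (B Y : ℝ) (a b : ℕ), 1 ≤ B → 0 < Y →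
      (∀ n ∈ Ico a b, B ≤ (n : ℝ) ∧ (n : ℝ) ≤ κ * B) →
      ‖∑ n ∈ Ico a b, ee (Y * (n : ℝ) ^ c)‖
        ≤ C * (√(Y * B ^ c) + B / √(Y * B ^ c)) := by
    intro B Y a b hB hY hn
    have hB0 : 0 < B := by linarith
    set Z := Y * B ^ c with hZ
    have hZ0 : 0 < Z := by positivity
    have hsZ : 0 < √Z := Real.sqrt_pos.2 hZ0
    rcases Nat.lt_or_ge a b with hab | hab
    swap
    · rw [Ico_eq_empty (by omega)]; simp; positivity
    have haB : B ≤ a := (hn a (by simp; omega)).1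
    have hbB : (b : ℝ) ≤ κ * B + 1 := by
      have := (hn (b - 1) (by simp; omega)).2
      rw [Nat.cast_sub (by omega)] at this
      push_cast at this; linarith
    set lam := c2 * Z / B ^ 2 with hlam
    have hlam0 : 0 < lam := by positivity
    have hsl : √lam = √c2 * √Z / B := by
      rw [hlam, Real.sqrt_div (by positivity), Real.sqrt_mul hc20.le, Real.sqrt_sq hB0.le]
    rcases le_or_gt lam 1 with h1 | h1
    · have hv := van_der_corput (fun n => Y * (n : ℝ) ^ c) (a := a) (b := b) (L := c3 * Z / B)
        hlam0 h1 ?_ (by positivity) ?_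
      · refine hv.trans ?_
        rw [hsl]
        have e : 7 * (c3 * Z / B + 2) / (√c2 * √Z / B)
            = 7 * c3 / √c2 * √Z + 14 / √c2 * (B / √Z) := by
          have : √Z * √Z = Z := Real.mul_self_sqrt hZ0.le
          field_simp
          have h2 : √Z ^ 2 = Z := by rw [sq, this]
          rw [h2]; ring
        rw [e]
        have hC1 : 7 * c3 / √c2 ≤ C := by
          rw [hC]
          have : 7 * c3 / √c2 ≤ 7 * (c3 + 2) / √c2 := by gcongr; linarith
          have : 0 ≤ (κ + 1) * √c2 := by positivity
          linarith
        have hC2 : 14 / √c2 ≤ C := by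
          rw [hC]
          have : 14 / √c2 ≤ 7 * (c3 + 2) / √c2 := by gcongr; linarith
          have : 0 ≤ (κ + 1) * √c2 := by positivity
          linarith
        rw [mul_add]
        gcongr
      · intro n h2 h3
        have hn0 : (0:ℝ) < n := by
          have : (a:ℝ) ≤ n := by exact_mod_cast h2
          linarith
        have h4 := second_diff_rpow_ge hc hc2 hn0
        have h5 : (n : ℝ) + 2 ≤ (κ + 1) * B := by
          have : (n : ℝ) + 2 ≤ b := by exact_mod_cast h3
          nlinarith
        have h6 : ((κ + 1) * B) ^ (c - 2) ≤ ((n : ℝ) + 2) ^ (c - 2) :=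
          Real.rpow_le_rpow_of_nonpos (by linarith) h5 (by linarith)
        have h7 : lam ≤ Y * (c * (c - 1) * ((n : ℝ) + 2) ^ (c - 2)) := by
          calc lam = Y * (c * (c - 1) * ((κ + 1) * B) ^ (c - 2)) := by
                rw [Real.mul_rpow (by linarith) hB0.le, hlam, hZ, hc2def, Real.rpow_sub hB0 c 2,
                  Real.rpow_two]
                ring
            _ ≤ _ := by gcongr
        push_cast
        have h8 := mul_le_mul_of_nonneg_left h4 hY.le
        linarith
      · intro n m h2 h3 h4
        have hn0 : (0:ℝ) < n := by
          have : (a:ℝ) ≤ n := by exact_mod_cast h2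
          linarith
        have hm0 : (0:ℝ) < m := by
          have : (n:ℝ) ≤ m := by exact_mod_cast h3
          linarith
        push_cast
        obtain ⟨ξ, hξ, h5⟩ := rpow_mvt c hm0 (show (m:ℝ) < m + 1 by linarith)
        have h6 : (n : ℝ) ^ c ≤ ((n : ℝ) + 1) ^ c := by gcongr; linarith
        have h7 : ξ ≤ (κ + 1) * B := by
          have : (m : ℝ) + 1 ≤ b := by exact_mod_cast h4
          have := hξ.2
          nlinarith
        have h8 : ξ ^ (c - 1) ≤ ((κ + 1) * B) ^ (c - 1) := by
          have : 0 < ξ := by linarith [hξ.1]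
          gcongr
        have h9 : Y * (c * ((κ + 1) * B) ^ (c - 1)) = c3 * Z / B := by
          rw [Real.mul_rpow (by linarith) hB0.le, hZ, hc3def, Real.rpow_sub_one hB0.ne']
          ring
        rw [← h9]
        have e : (m:ℝ) + 1 - m = 1 := by ring
        rw [e, mul_one] at h5
        have h10 : Y * (c * ξ ^ (c - 1)) ≤ Y * (c * ((κ + 1) * B) ^ (c - 1)) := by gcongr
        have h11 : Y * (n : ℝ) ^ c ≤ Y * ((n : ℝ) + 1) ^ c := by gcongr
        rw [← h5] at h10
        linarith
    · have hcard := norm_sum_ee_le_card (fun n => Y * (n : ℝ) ^ c) (Ico a b)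
      rw [Nat.card_Ico] at hcard
      have h2 : ((b - a : ℕ) : ℝ) ≤ (κ + 1) * B := by
        rw [Nat.cast_sub hab.le]; nlinarith
      have h3 : B ≤ √c2 * √Z := by
        have h4 : 1 < √lam := by rw [Real.lt_sqrt (by norm_num)]; simpa using h1
        rw [hsl, lt_div_iff₀ hB0] at h4
        linarith
      calc _ ≤ (κ + 1) * B := hcard.trans h2
        _ ≤ (κ + 1) * (√c2 * √Z) := by gcongr
        _ = (κ + 1) * √c2 * √Z := by ring
        _ ≤ C * √Z := by
          gcongr
          rw [hC]
          have : 0 ≤ 7 * (c3 + 2) / √c2 := by positivity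
          linarith
        _ ≤ _ := by
          have : 0 ≤ B / √Z := by positivity
          gcongr; linarith
  refine ⟨C, hC0, fun B Y a b hB hY hn => ?_⟩
  rcases lt_or_gt_of_ne hY with h | h
  · have h1 := hpos B (-Y) a b hB (by linarith) hn
    rw [abs_of_neg h]
    refine le_trans (le_of_eq ?_) h1
    rw [← Complex.norm_conj, map_sum]
    congr 1
    refine sum_congr rfl fun n _ => ?_
    rw [← ee_neg]; ring_nf
  · have h1 := hpos B Y a b hB h hn
    rwa [abs_of_pos h]

lemma exists_eq_Ico_of_convex (s : Finset ℕ)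
    (h : ∀ x ∈ s, ∀ z ∈ s, ∀ y, x ≤ y → y ≤ z → y ∈ s) : ∃ p q, s = Ico p q := by
  rcases s.eq_empty_or_nonempty with rfl | hs
  · exact ⟨0, 0, by simp⟩
  · refine ⟨s.min' hs, s.max' hs + 1, ?_⟩
    ext y
    rw [mem_Ico]
    constructor
    · exact fun hy => ⟨s.min'_le y hy, Nat.lt_succ_of_le (s.le_max' y hy)⟩
    · exact fun hy => h _ (s.min'_mem hs) _ (s.max'_mem hs) y hy.1 (by omega)

lemma sum_shift (z : ℕ → ℂ) {a0 a1 Q : ℕ} (hQ : Q ≤ a0) (hz : ∀ a, a ∉ Ico a0 a1 → z a = 0) :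
    (Q : ℂ) * ∑ a ∈ Ico a0 a1, z a = ∑ t ∈ Ico (a0 - Q) a1, ∑ j ∈ range Q, z (t + j) := by
  rw [sum_comm]
  have : ∀ j ∈ range Q, ∑ t ∈ Ico (a0 - Q) a1, z (t + j) = ∑ a ∈ Ico a0 a1, z a := by
    intro j hj
    rw [mem_range] at hj
    rw [sum_Ico_add' z]
    symm
    apply sum_subset
    · apply Ico_subset_Ico <;> omega
    · exact fun a _ h => hz a h
  rw [sum_congr rfl this]; simp

lemma sum_range_dist_le (E : ℕ → ℝ) (hE : ∀ q, 0 ≤ E q) {j Q : ℕ} (hj : j < Q) :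
    ∑ j' ∈ range Q, E (Nat.dist j j') ≤ 2 * ∑ q ∈ range Q, E q := by
  rw [range_eq_Ico, ← sum_Ico_consecutive _ (Nat.zero_le j) hj.le, two_mul]
  apply add_le_add
  · have e : ∑ j' ∈ Ico 0 j, E (Nat.dist j j') = ∑ q ∈ Ico 1 (j + 1), E q := by
      rw [← range_eq_Ico, ← sum_range_reflect, sum_Ico_eq_sum_range]
      apply sum_congr (by simp)
      intro i hi
      rw [mem_range] at hi
      congr 1
      rw [Nat.dist_eq_sub_of_le_right (by omega)]; omega
    rw [e]
    exact sum_le_sum_of_subset_of_nonneg (Ico_subset_Ico (by omega) (by omega))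
      fun _ _ _ => hE _
  · have e : ∑ j' ∈ Ico j Q, E (Nat.dist j j') = ∑ q ∈ Ico 0 (Q - j), E q := by
      rw [sum_Ico_eq_sum_range, range_eq_Ico]
      apply sum_congr rfl
      intro i hi
      congr 1
      rw [Nat.dist_eq_sub_of_le (by omega)]; omega
    rw [e]
    exact sum_le_sum_of_subset_of_nonneg (Ico_subset_Ico (by omega) (by omega))
      fun _ _ _ => hE _

/-- Weighted correlation sums are controlled by the mass and the row sums of the kernel. -/
lemma sum_corr_le (u E : ℕ → ℝ) (hE : ∀ q, 0 ≤ E q) (s : Finset ℕ) {Q : ℕ} {W : ℝ}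
    (hW : ∀ j < Q, ∑ t ∈ s, u (t + j) ^ 2 ≤ W) :
    ∑ t ∈ s, ∑ j ∈ range Q, ∑ j' ∈ range Q, u (t + j) * u (t + j') * E (Nat.dist j j')
      ≤ Q * W * (2 * ∑ q ∈ range Q, E q) := by
  set G := 2 * ∑ q ∈ range Q, E q
  have hG : 0 ≤ G := mul_nonneg (by norm_num) (sum_nonneg fun _ _ => hE _)
  have h1 : ∀ t ∈ s, ∑ j ∈ range Q, ∑ j' ∈ range Q, u (t + j) * u (t + j') * E (Nat.dist j j')
      ≤ ∑ j ∈ range Q, u (t + j) ^ 2 * G := by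
    intro t _
    have h2 : ∑ j ∈ range Q, ∑ j' ∈ range Q, u (t + j) * u (t + j') * E (Nat.dist j j')
        ≤ ∑ j ∈ range Q, ∑ j' ∈ range Q,
          (u (t + j) ^ 2 * E (Nat.dist j j') / 2 + u (t + j') ^ 2 * E (Nat.dist j' j) / 2) := by
      refine sum_le_sum fun j _ => sum_le_sum fun j' _ => ?_
      rw [Nat.dist_comm j' j]
      nlinarith [mul_nonneg (sq_nonneg (u (t + j) - u (t + j'))) (hE (Nat.dist j j'))]
    refine h2.trans ?_
    simp_rw [sum_add_distrib]
    rw [sum_comm (s := range Q) (t := range Q) (f := fun j j' =>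
      u (t + j') ^ 2 * E (Nat.dist j' j) / 2), ← sum_add_distrib]
    refine sum_le_sum fun j hj => ?_
    rw [← sum_add_distrib]
    have e : ∀ j' ∈ range Q, u (t + j) ^ 2 * E (Nat.dist j j') / 2
        + u (t + j) ^ 2 * E (Nat.dist j j') / 2 = u (t + j) ^ 2 * E (Nat.dist j j') :=
      fun _ _ => by ring
    rw [sum_congr rfl e, ← mul_sum]
    exact mul_le_mul_of_nonneg_left (sum_range_dist_le E hE (mem_range.1 hj)) (sq_nonneg _)
  refine (sum_le_sum h1).trans ?_
  rw [sum_comm]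
  have h3 : ∀ j ∈ range Q, ∑ t ∈ s, u (t + j) ^ 2 * G ≤ W * G := by
    intro j hj
    rw [← sum_mul]
    exact mul_le_mul_of_nonneg_right (hW j (mem_range.1 hj)) hG
  refine (sum_le_sum h3).trans ?_
  simp [mul_assoc]

lemma sum_one_div_sqrt_succ_le (Q : ℕ) :
    ∑ q ∈ range (Q + 1), 1 / √(q : ℝ) ≤ 2 * √(Q : ℝ) := by
  induction Q with
  | zero => simp
  | succ Q ih =>
    rw [sum_range_succ]
    push_cast
    have h1 : 0 < √((Q:ℝ) + 1) := Real.sqrt_pos.2 (by positivity)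
    have h2 : √(Q:ℝ) * √(Q:ℝ) = Q := Real.mul_self_sqrt (by positivity)
    have h3 : √((Q:ℝ) + 1) * √((Q:ℝ) + 1) = Q + 1 := Real.mul_self_sqrt (by positivity)
    have h4 : 1 / √((Q:ℝ) + 1) ≤ 2 * √((Q:ℝ) + 1) - 2 * √(Q:ℝ) := by
      rw [div_le_iff₀ h1]
      nlinarith [sq_nonneg (√((Q:ℝ) + 1) - √(Q:ℝ))]
    linarith

lemma sum_one_div_sqrt_le (Q : ℕ) : ∑ q ∈ range Q, 1 / √(q : ℝ) ≤ 2 * √(Q : ℝ) := by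
  cases Q with
  | zero => simp
  | succ Q =>
    refine (sum_one_div_sqrt_succ_le Q).trans ?_
    gcongr; simp

lemma norm_sq_sum_mul_le (s : Finset ℕ) (f g : ℕ → ℂ) :
    ‖∑ i ∈ s, f i * g i‖ ^ 2 ≤ (∑ i ∈ s, ‖f i‖ ^ 2) * ∑ i ∈ s, ‖g i‖ ^ 2 := by
  have h1 : ‖∑ i ∈ s, f i * g i‖ ≤ ∑ i ∈ s, ‖f i‖ * ‖g i‖ :=
    norm_sum_le_of_le _ fun i _ => (norm_mul _ _).le
  exact (pow_le_pow_left₀ (norm_nonneg _) h1 2).trans (sum_mul_sq_le_sq_mul_sq _ _ _)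

lemma rpow_diff_bounds {c : ℝ} (hc : 1 < c) (hc2 : c < 2) {A : ℝ} (hA : 1 ≤ A) {a a' : ℕ}
    (ha : A ≤ a) (ha2 : (a : ℝ) ≤ 2 * A) (ha' : A ≤ a') (ha2' : (a' : ℝ) ≤ 2 * A) (hne : a ≠ a') :
    A ^ (c - 1) * (Nat.dist a a' : ℕ) ≤ |(a : ℝ) ^ c - (a' : ℝ) ^ c| ∧
      |(a : ℝ) ^ c - (a' : ℝ) ^ c| ≤ 4 * A ^ (c - 1) * (Nat.dist a a' : ℕ) := by
  wlog h : a' < a generalizing a a'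
  · have := this ha' ha2' ha ha2 hne.symm (by omega)
    rwa [Nat.dist_comm, abs_sub_comm]
  have h' : (a' : ℝ) < a := by exact_mod_cast h
  have ha0 : (0:ℝ) < a' := by linarith
  obtain ⟨ξ, hξ, e⟩ := rpow_mvt c ha0 h'
  have hd : ((Nat.dist a a' : ℕ) : ℝ) = a - a' := by
    rw [Nat.dist_eq_sub_of_le_right h.le, Nat.cast_sub h.le]
  have hd0 : (0:ℝ) < a - a' := by linarith
  have hξ1 : A < ξ := by linarith [hξ.1]
  have l1 : A ^ (c - 1) ≤ ξ ^ (c - 1) := by gcongr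
  have l2 : ξ ^ (c - 1) ≤ 2 * A ^ (c - 1) := by
    calc ξ ^ (c - 1) ≤ (2 * A) ^ (c - 1) := by
          have := hξ.2
          have : 0 < ξ := by linarith
          gcongr
          linarith
      _ = 2 ^ (c - 1) * A ^ (c - 1) := Real.mul_rpow (by norm_num) (by linarith)
      _ ≤ 2 ^ (1:ℝ) * A ^ (c - 1) := by
          gcongr
          · norm_num
          · linarith
      _ = _ := by rw [Real.rpow_one]
  have hA0 : 0 < A ^ (c - 1) := by positivity
  have hξ0 : 0 < ξ := by linarith
  rw [hd, e, abs_of_nonneg (by positivity)]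
  constructor
  · gcongr
    nlinarith
  · apply mul_le_mul_of_nonneg_right _ hd0.le
    nlinarith

lemma exists_correlation_le {c : ℝ} (hc : 1 < c) (hc2 : c < 2) :
    ∃ C : ℝ, 0 < C ∧ ∀ (H X A : ℝ) (n0 n1 M a a' : ℕ), X ≠ 0 → 1 ≤ A → 8 * A ≤ H →
      H / 4 ≤ n0 → (n1 : ℝ) ≤ H + 1 → A ≤ a → (a : ℝ) ≤ 2 * A → A ≤ a' → (a' : ℝ) ≤ 2 * A →
      ‖∑ b ∈ range M with (n0 ≤ a * b ∧ a * b < n1) ∧ (n0 ≤ a' * b ∧ a' * b < n1),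
        ee (X * ((a * b : ℕ) : ℝ) ^ c - X * ((a' * b : ℕ) : ℝ) ^ c)‖
      ≤ if Nat.dist a a' = 0 then H / A else
        C * (√(|X| * H ^ c / A) * √(Nat.dist a a' : ℕ)
          + H / A / √(|X| * H ^ c / A) * (1 / √(Nat.dist a a' : ℕ))) := by
  obtain ⟨C, hC, hsum⟩ := exists_norm_sum_ee_rpow_le hc hc2 (κ := 8) (by norm_num)
  refine ⟨64 * C, by positivity, ?_⟩
  intro H X A n0 n1 M a a' hX hA hAH hn0 hn1 ha ha2 ha' ha2'
  have hA0 : 0 < A := by linarith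
  have hH0 : 0 < H := by linarith
  set s := (range M).filter
    (fun b => (n0 ≤ a * b ∧ a * b < n1) ∧ (n0 ≤ a' * b ∧ a' * b < n1)) with hs
  have hsB : ∀ b ∈ s, H / (8 * A) ≤ (b : ℝ) ∧ (b : ℝ) ≤ 8 * (H / (8 * A)) := by
    intro b hb
    simp only [hs, mem_filter, mem_range] at hb
    obtain ⟨_, ⟨h1, h2⟩, _⟩ := hb
    have h1' : (n0 : ℝ) ≤ a * b := by exact_mod_cast h1
    have h2' : (a : ℝ) * b + 1 ≤ n1 := by exact_mod_cast h2
    have hb0 : (0:ℝ) ≤ b := by positivity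
    constructor
    · rw [div_le_iff₀ (by positivity)]; nlinarith
    · rw [show 8 * (H / (8 * A)) = H / A by field_simp, le_div_iff₀ hA0]; nlinarith
  split_ifs with h0
  · refine (norm_sum_le_of_le (f := fun b => ee (X * ((a * b : ℕ) : ℝ) ^ c - X * ((a' * b : ℕ) : ℝ) ^ c))
      (n := fun _ => (1:ℝ)) _ fun b _ => (norm_ee _).le).trans ?_
    have hsub : s ⊆ Ioc 0 ⌊H / A⌋₊ := by
      intro b hb
      have h1 := hsB b hb
      rw [mem_Ioc]
      constructor
      · have : 0 < H / (8 * A) := by positivity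
        have : (0:ℝ) < b := by linarith
        exact_mod_cast this
      · apply Nat.le_floor
        rw [show 8 * (H / (8 * A)) = H / A by field_simp] at h1
        exact h1.2
    have := card_le_card hsub
    rw [Nat.card_Ioc] at this
    rw [sum_const, nsmul_eq_mul, mul_one]
    calc (#s : ℝ) ≤ (⌊H / A⌋₊ : ℝ) := by exact_mod_cast this
      _ ≤ H / A := Nat.floor_le (by positivity)
  · have hne : a ≠ a' := by rintro rfl; simp at h0
    obtain ⟨l, u⟩ := rpow_diff_bounds hc hc2 hA ha ha2 ha' ha2' hne
    set q : ℝ := ((Nat.dist a a' : ℕ) : ℝ) with hq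
    have hq0 : 0 < q := by rw [hq]; exact_mod_cast Nat.pos_of_ne_zero h0
    set Y := X * ((a : ℝ) ^ c - (a' : ℝ) ^ c) with hY
    have hYabs : |Y| = |X| * |(a : ℝ) ^ c - (a' : ℝ) ^ c| := abs_mul _ _
    have hX0 : 0 < |X| := abs_pos.2 hX
    have hA1 : 0 < A ^ (c - 1) := by positivity
    have hY0 : Y ≠ 0 := by
      rw [← abs_pos, hYabs]
      have : 0 < A ^ (c - 1) * q := by positivity
      have : 0 < |(a : ℝ) ^ c - (a' : ℝ) ^ c| := by linarith
      positivity
    obtain ⟨p, p', hp⟩ := exists_eq_Ico_of_convex s (by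
      intro x hx z hz y hxy hyz
      simp only [hs, mem_filter, mem_range] at hx hz ⊢
      refine ⟨by omega, ⟨?_, ?_⟩, ?_, ?_⟩
      · exact hx.2.1.1.trans (Nat.mul_le_mul_left _ hxy)
      · exact (Nat.mul_le_mul_left _ hyz).trans_lt hz.2.1.2
      · exact hx.2.2.1.trans (Nat.mul_le_mul_left _ hxy)
      · exact (Nat.mul_le_mul_left _ hyz).trans_lt hz.2.2.2)
    have key := hsum (H / (8 * A)) Y p p' (by rw [le_div_iff₀ (by positivity)]; linarith) hY0
      (by rw [← hp]; exact hsB)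
    have e : ∑ b ∈ s, ee (X * ((a * b : ℕ) : ℝ) ^ c - X * ((a' * b : ℕ) : ℝ) ^ c)
        = ∑ n ∈ Ico p p', ee (Y * (n : ℝ) ^ c) := by
      rw [hp]
      refine sum_congr rfl fun b _ => ?_
      push_cast
      rw [Real.mul_rpow (by positivity) (by positivity),
        Real.mul_rpow (by positivity) (by positivity), hY]
      ring_nf
    rw [e]
    refine key.trans ?_
    set F := |X| * H ^ c / A with hF
    have hF0 : 0 < F := by positivity
    have hB : A ^ (c - 1) * (H / (8 * A)) ^ c = H ^ c / A / 8 ^ c := by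
      rw [Real.div_rpow hH0.le (by positivity), Real.mul_rpow (by norm_num) hA0.le,
        Real.rpow_sub_one hA0.ne']
      field_simp
    have h8 : (8:ℝ) ^ c ≤ 64 := by
      calc (8:ℝ) ^ c ≤ 8 ^ (2:ℝ) := Real.rpow_le_rpow_of_exponent_le (by norm_num) hc2.le
        _ = 64 := by norm_num
    have h81 : (1:ℝ) ≤ 8 ^ c := Real.one_le_rpow (by norm_num) (by linarith)
    have z1 : |Y| * (H / (8 * A)) ^ c ≤ 64 ^ 2 * (F * q) := by
      calc |Y| * (H / (8 * A)) ^ c ≤ |X| * (4 * A ^ (c - 1) * q) * (H / (8 * A)) ^ c := by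
            rw [hYabs]; gcongr
        _ = 4 * |X| * q * (H ^ c / A / 8 ^ c) := by rw [← hB]; ring
        _ = 4 * (F * q) / 8 ^ c := by rw [hF]; ring
        _ ≤ 4 * (F * q) := div_le_self (by positivity) h81
        _ ≤ _ := by have : 0 < F * q := by positivity
                    linarith
    have z2 : (F * q) / 8 ^ 2 ≤ |Y| * (H / (8 * A)) ^ c := by
      calc (F * q) / 8 ^ 2 ≤ F * q / 8 ^ c := by gcongr; linarith
        _ = |X| * (A ^ (c - 1) * q) * (H / (8 * A)) ^ c := by
            rw [hF]
            linear_combination (-|X| * q) * hB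
        _ ≤ _ := by rw [hYabs]; gcongr
    have s1 : √(|Y| * (H / (8 * A)) ^ c) ≤ 64 * (√F * √q) := by
      rw [← Real.sqrt_mul hF0.le, ← Real.sqrt_sq (show (0:ℝ) ≤ 64 by norm_num), ← Real.sqrt_mul (by norm_num)]
      exact Real.sqrt_le_sqrt z1
    have s2 : √F * √q / 8 ≤ √(|Y| * (H / (8 * A)) ^ c) := by
      calc √F * √q / 8 = √(F * q / 8 ^ 2) := by
            rw [Real.sqrt_div (show 0 ≤ F * q by positivity) (8 ^ 2), Real.sqrt_sq (by norm_num),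
              Real.sqrt_mul hF0.le]
        _ ≤ _ := Real.sqrt_le_sqrt z2
    have hsF : 0 < √F := Real.sqrt_pos.2 hF0
    have hsq : 0 < √q := Real.sqrt_pos.2 hq0
    have s3 : H / (8 * A) / √(|Y| * (H / (8 * A)) ^ c) ≤ H / (8 * A) / (√F * √q / 8) := by
      gcongr
    have e3 : H / (8 * A) / (√F * √q / 8) = H / A / √F * (1 / √q) := by field_simp
    rw [e3] at s3
    have : 0 ≤ H / A / √F * (1 / √q) := by positivity
    calc _ ≤ C * (64 * (√F * √q) + H / A / √F * (1 / √q)) := by gcongr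
      _ ≤ _ := by nlinarith

/-- The bilinear estimate, by Cauchy–Schwarz and differencing of length `Q`. -/
lemma exists_bilinear_le {c : ℝ} (hc : 1 < c) (hc2 : c < 2) :
    ∃ C : ℝ, 0 < C ∧ ∀ (H X A : ℝ) (n0 n1 a0 a1 M Q : ℕ) (x y : ℕ → ℂ),
      X ≠ 0 → 1 ≤ A → 8 * A ≤ H → H / 4 ≤ n0 → (n1 : ℝ) ≤ H + 1 →
      (∀ a ∈ Ico a0 a1, A ≤ (a : ℝ) ∧ (a : ℝ) ≤ 2 * A) → 1 ≤ Q → (Q : ℝ) ≤ A →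
      ‖∑ a ∈ Ico a0 a1, ∑ b ∈ range M,
        if n0 ≤ a * b ∧ a * b < n1 then x a * y b * ee (X * ((a * b : ℕ) : ℝ) ^ c) else 0‖ ^ 2
      ≤ C * (∑ a ∈ Ico a0 a1, ‖x a‖ ^ 2) * (∑ b ∈ range M, ‖y b‖ ^ 2) *
        (H / Q + √(A * (|X| * H ^ c) * Q) + H * √(A / ((|X| * H ^ c) * Q))) := by
  obtain ⟨C, hC, hcor⟩ := exists_correlation_le hc hc2
  refine ⟨6 * (1 + 2 * C), by positivity, ?_⟩
  intro H X A n0 n1 a0 a1 M Q x y hX hA hAH hn0 hn1 ha hQ1 hQA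
  have hA0 : 0 < A := by linarith
  have hH0 : 0 < H := by linarith
  have hX0 : 0 < |X| := abs_pos.2 hX
  have hQ0 : (0:ℝ) < Q := by exact_mod_cast hQ1
  rcases Nat.lt_or_ge a0 a1 with h01 | h01
  swap
  · rw [Ico_eq_empty (by omega)]; simp
  set F := |X| * H ^ c with hF
  have hF0 : 0 < F := by positivity
  have hQa0 : Q ≤ a0 := by
    have := (ha a0 (by simp; omega)).1
    exact_mod_cast hQA.trans this
  set z : ℕ → ℕ → ℂ := fun b a => if a ∈ Ico a0 a1 then
    (if n0 ≤ a * b ∧ a * b < n1 then x a * ee (X * ((a * b : ℕ) : ℝ) ^ c) else 0) else 0 with hz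
  set W := ∑ a ∈ Ico a0 a1, ‖x a‖ ^ 2 with hW
  set V := ∑ b ∈ range M, ‖y b‖ ^ 2 with hV
  have hW0 : 0 ≤ W := sum_nonneg fun _ _ => by positivity
  have hV0 : 0 ≤ V := sum_nonneg fun _ _ => by positivity
  set E : ℕ → ℝ := fun q => if q = 0 then H / A else
        C * (√(F / A) * √(q : ℕ) + H / A / √(F / A) * (1 / √(q : ℕ))) with hE
  have hE0 : ∀ q, 0 ≤ E q := by
    intro q; simp only [hE]; split_ifs <;> positivity
  set u : ℕ → ℝ := fun a => if a ∈ Ico a0 a1 then ‖x a‖ else 0 with hu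
  have step1 : ∑ a ∈ Ico a0 a1, ∑ b ∈ range M,
        (if n0 ≤ a * b ∧ a * b < n1 then x a * y b * ee (X * ((a * b : ℕ) : ℝ) ^ c) else 0)
      = ∑ b ∈ range M, y b * ∑ a ∈ Ico a0 a1, z b a := by
    rw [sum_comm]
    refine sum_congr rfl fun b _ => ?_
    rw [mul_sum]
    refine sum_congr rfl fun a haa => ?_
    simp only [hz, haa, if_true]
    split_ifs <;> ring
  rw [step1]
  refine (norm_sq_sum_mul_le _ _ _).trans ?_
  rw [← hV]
  set T := ∑ b ∈ range M, ‖∑ a ∈ Ico a0 a1, z b a‖ ^ 2 with hT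
  have hcard : ((#(Ico (a0 - Q) a1) : ℕ) : ℝ) ≤ 3 * A := by
    rw [Nat.card_Ico]
    have h1 := (ha a0 (by simp; omega)).1
    have h2 := (ha (a1 - 1) (by simp; omega)).2
    rw [Nat.cast_sub (by omega)] at h2
    rw [Nat.cast_sub (by omega), Nat.cast_sub hQa0]
    push_cast at h2
    linarith
  have step2 : (Q : ℝ) ^ 2 * T ≤ 3 * A * (Q * W * (2 * ∑ q ∈ range Q, E q)) := by
    have h1 : ∀ b ∈ range M, (Q : ℝ) ^ 2 * ‖∑ a ∈ Ico a0 a1, z b a‖ ^ 2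
        ≤ 3 * A * ∑ t ∈ Ico (a0 - Q) a1, ‖∑ j ∈ range Q, z b (t + j)‖ ^ 2 := by
      intro b _
      have h2 := sum_shift (z b) (a1 := a1) hQa0 (fun a h => by simp only [hz, h, if_false])
      have h3 : (Q : ℝ) ^ 2 * ‖∑ a ∈ Ico a0 a1, z b a‖ ^ 2
          = ‖∑ t ∈ Ico (a0 - Q) a1, (1:ℂ) * ∑ j ∈ range Q, z b (t + j)‖ ^ 2 := by
        simp_rw [one_mul]
        rw [← h2, norm_mul, mul_pow, Complex.norm_natCast]
      rw [h3]
      refine (norm_sq_sum_mul_le _ _ _).trans ?_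
      apply mul_le_mul_of_nonneg_right _ (sum_nonneg fun _ _ => by positivity)
      simpa using hcard
    rw [hT, mul_sum]
    refine (sum_le_sum h1).trans ?_
    rw [← mul_sum, sum_comm]
    apply mul_le_mul_of_nonneg_left _ (by positivity)
    refine le_trans (sum_le_sum fun t _ => ?_) (sum_corr_le u E hE0 (Ico (a0 - Q) a1) ?_)
    · have h4 : ((∑ b ∈ range M, ‖∑ j ∈ range Q, z b (t + j)‖ ^ 2 : ℝ) : ℂ)
          = ∑ j ∈ range Q, ∑ j' ∈ range Q, ∑ b ∈ range M,
            z b (t + j) * (starRingEnd ℂ) (z b (t + j')) := by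
        push_cast
        rw [sum_congr rfl fun j _ => sum_comm, sum_comm]
        refine sum_congr rfl fun b _ => ?_
        rw [← Complex.mul_conj', map_sum, sum_mul_sum]
      have h5 : ∑ b ∈ range M, ‖∑ j ∈ range Q, z b (t + j)‖ ^ 2
          = ‖((∑ b ∈ range M, ‖∑ j ∈ range Q, z b (t + j)‖ ^ 2 : ℝ) : ℂ)‖ := by
        rw [Complex.norm_real, Real.norm_eq_abs, abs_of_nonneg (sum_nonneg fun _ _ => by positivity)]
      rw [h5, h4]
      refine norm_sum_le_of_le _ fun j _ => norm_sum_le_of_le _ fun j' _ => ?_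
      set a := t + j with haj
      set a' := t + j' with haj'
      have hd : Nat.dist j j' = Nat.dist a a' := (Nat.dist_add_add_left t j j').symm
      by_cases h6 : a ∈ Ico a0 a1
      swap
      · simp only [hz, hu, if_neg h6]; simp
      by_cases h7 : a' ∈ Ico a0 a1
      swap
      · simp only [hz, hu, if_neg h7]; simp
      have h8 := hcor H X A n0 n1 M a a' hX hA hAH hn0 hn1 (ha a h6).1 (ha a h6).2
        (ha a' h7).1 (ha a' h7).2
      have h9 : ∑ b ∈ range M, z b a * (starRingEnd ℂ) (z b a')
          = x a * (starRingEnd ℂ) (x a') *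
          ∑ b ∈ range M with (n0 ≤ a * b ∧ a * b < n1) ∧ (n0 ≤ a' * b ∧ a' * b < n1),
            ee (X * ((a * b : ℕ) : ℝ) ^ c - X * ((a' * b : ℕ) : ℝ) ^ c) := by
        rw [sum_filter, mul_sum]
        refine sum_congr rfl fun b _ => ?_
        simp only [hz, h6, h7, if_true]
        by_cases h10 : n0 ≤ a * b ∧ a * b < n1
        · by_cases h11 : n0 ≤ a' * b ∧ a' * b < n1
          · rw [if_pos h10, if_pos h11, if_pos ⟨h10, h11⟩, ee_sub, map_mul]; ring
          · rw [if_neg h11, if_neg (fun h : (n0 ≤ a * b ∧ a * b < n1) ∧ _ => h11 h.2)]; simp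
        · rw [if_neg h10, if_neg (fun h : (n0 ≤ a * b ∧ a * b < n1) ∧ _ => h10 h.1)]; simp
      rw [h9, norm_mul, norm_mul, Complex.norm_conj, hd]
      simp only [hu, h6, h7, if_true]
      exact mul_le_mul_of_nonneg_left h8 (by positivity)
    · intro j hj
      have e1 : ∀ t, u t ^ 2 = if t ∈ Ico a0 a1 then ‖x t‖ ^ 2 else 0 := by
        intro t; simp only [hu]; split_ifs <;> simp
      rw [sum_Ico_add' (fun t => u t ^ 2), hW]
      simp_rw [e1]
      rw [← sum_filter]
      exact sum_le_sum_of_subset_of_nonneg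
        (fun t ht => (mem_filter.1 ht).2) fun _ _ _ => by positivity
  have step3 : ∑ q ∈ range Q, E q ≤ H / A + C * (Q * √(F / A) * √Q)
      + C * (H / A / √(F / A)) * (2 * √Q) := by
    have h1 : ∀ q ∈ range Q, E q ≤ (if q = 0 then H / A else 0) + C * (√(F / A) * √Q)
        + C * (H / A / √(F / A)) * (1 / √(q : ℕ)) := by
      intro q hq
      rw [mem_range] at hq
      simp only [hE]
      split_ifs with h
      · have : 0 ≤ C * (√(F / A) * √Q) + C * (H / A / √(F / A)) * (1 / √(q : ℕ)) := by positivity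
        linarith
      · have : √(q : ℝ) ≤ √(Q : ℝ) := by gcongr
        have : C * (√(F / A) * √(q : ℝ)) ≤ C * (√(F / A) * √Q) := by gcongr
        linarith
    refine (sum_le_sum h1).trans ?_
    rw [sum_add_distrib, sum_add_distrib, ← mul_sum (range Q) (fun q : ℕ => 1 / √(q : ℝ)),
      sum_const, card_range, nsmul_eq_mul, sum_ite_eq' (range Q) 0 (fun _ => H / A), if_pos (mem_range.2 hQ1)]
    have h2 : C * (H / A / √(F / A)) * ∑ q ∈ range Q, 1 / √(q : ℝ)
        ≤ C * (H / A / √(F / A)) * (2 * √Q) := by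
      gcongr
      exact sum_one_div_sqrt_le Q
    linarith
  have hsA : √A * √A = A := Real.mul_self_sqrt hA0.le
  have hsQ : √(Q:ℝ) * √(Q:ℝ) = Q := Real.mul_self_sqrt hQ0.le
  have hsA0 : 0 < √A := Real.sqrt_pos.2 hA0
  have hsF0 : 0 < √F := Real.sqrt_pos.2 hF0
  have hsQ0 : 0 < √(Q:ℝ) := Real.sqrt_pos.2 hQ0
  rw [Real.sqrt_mul (by positivity), Real.sqrt_mul hA0.le, Real.sqrt_div hA0.le, Real.sqrt_mul hF0.le]
  rw [Real.sqrt_div hF0.le] at step3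
  set sA := √A
  set sF := √F
  set sQ := √(Q:ℝ)
  have hTb : T ≤ 6 * (A / Q) * W * (H / A + C * (Q * (sF / sA) * sQ)
      + C * (H / A / (sF / sA)) * (2 * sQ)) := by
    have h1 : (Q : ℝ) ^ 2 * T ≤ 3 * A * (Q * W * (2 * (H / A + C * (Q * (sF / sA) * sQ)
      + C * (H / A / (sF / sA)) * (2 * sQ)))) := step2.trans (by gcongr)
    rw [← mul_le_mul_iff_right₀ (show (0:ℝ) < Q ^ 2 by positivity)]
    refine h1.trans (le_of_eq ?_)
    field_simp
    try ring
  have hid : 6 * (A / Q) * W * (H / A + C * (Q * (sF / sA) * sQ)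
      + C * (H / A / (sF / sA)) * (2 * sQ))
      = 6 * W * (H / Q + C * (sA * sF * sQ) + 2 * C * (H * (sA / (sF * sQ)))) := by
    rw [← hsA, ← hsQ]
    field_simp
  rw [hid] at hTb
  have p1 : 0 ≤ H / (Q:ℝ) := by positivity
  have p2 : 0 ≤ sA * sF * sQ := by positivity
  have p3 : 0 ≤ H * (sA / (sF * sQ)) := by positivity
  calc V * T ≤ V * (6 * W * (H / Q + C * (sA * sF * sQ) + 2 * C * (H * (sA / (sF * sQ))))) := by
        gcongr
    _ ≤ V * (6 * W * ((1 + 2 * C) * (H / Q + sA * sF * sQ + H * (sA / (sF * sQ))))) := by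
        gcongr
        nlinarith [mul_nonneg hC.le p1, mul_nonneg hC.le p2, mul_nonneg hC.le p3]
    _ = _ := by ring

open ArithmeticFunction

lemma sum_convolution (f g : ArithmeticFunction ℝ) (E : ℕ → ℂ) {n0 n1 : ℕ} (h0 : 1 ≤ n0) :
    ∑ n ∈ Ico n0 n1, (((f * g) n : ℝ) : ℂ) * E n
      = ∑ a ∈ range n1, ∑ b ∈ range n1,
        if n0 ≤ a * b ∧ a * b < n1 then (f a : ℂ) * (g b : ℂ) * E (a * b) else 0 := by
  have h1 : ∀ a b : ℕ, (if n0 ≤ a * b ∧ a * b < n1 then (f a : ℂ) * (g b : ℂ) * E (a * b) else 0)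
      = ∑ n ∈ Ico n0 n1, if a * b = n then (f a : ℂ) * (g b : ℂ) * E n else 0 := by
    intro a b
    rw [sum_ite_eq]
    simp
  simp_rw [h1]
  rw [sum_congr rfl fun a _ => sum_comm, sum_comm]
  refine sum_congr rfl fun n hn => ?_
  rw [mem_Ico] at hn
  rw [← sum_product', ← sum_filter, ArithmeticFunction.mul_apply]
  push_cast
  rw [sum_mul]
  refine sum_congr ?_ fun _ _ => rfl
  ext ⟨a, b⟩
  simp only [Nat.mem_divisorsAntidiagonal, mem_filter, mem_product, mem_range]
  constructor
  · rintro ⟨h, h2⟩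
    have ha : a ≤ n := Nat.le_of_dvd (by omega) ⟨b, h.symm⟩
    have hb : b ≤ n := Nat.le_of_dvd (by omega) ⟨a, by rw [← h, mul_comm]⟩
    exact ⟨⟨by omega, by omega⟩, h⟩
  · rintro ⟨_, h⟩
    exact ⟨h, by omega⟩

/-- The part of an arithmetic function supported on `[0, u]`. -/
noncomputable def lowPart (u : ℝ) (f : ArithmeticFunction ℝ) : ArithmeticFunction ℝ :=
  ⟨fun n => if (n : ℝ) ≤ u then f n else 0, by simp⟩

/-- The part of an arithmetic function supported on `(u, ∞)`. -/
noncomputable def highPart (u : ℝ) (f : ArithmeticFunction ℝ) : ArithmeticFunction ℝ :=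
  ⟨fun n => if (n : ℝ) ≤ u then 0 else f n, by simp⟩

lemma lowPart_apply (u : ℝ) (f : ArithmeticFunction ℝ) (n : ℕ) :
    lowPart u f n = if (n : ℝ) ≤ u then f n else 0 := rfl

lemma highPart_apply (u : ℝ) (f : ArithmeticFunction ℝ) (n : ℕ) :
    highPart u f n = if (n : ℝ) ≤ u then 0 else f n := rfl

lemma lowPart_add_highPart (u : ℝ) (f : ArithmeticFunction ℝ) :
    lowPart u f + highPart u f = f := by
  ext n
  rw [ArithmeticFunction.add_apply, lowPart_apply, highPart_apply]
  split_ifs <;> simp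

/-- Vaughan's identity. -/
lemma vaughan_identity (u : ℝ) :
    vonMangoldt = lowPart u vonMangoldt + lowPart u (moebius : ArithmeticFunction ℝ) * log
      - lowPart u (moebius : ArithmeticFunction ℝ) * lowPart u vonMangoldt * zeta
      + highPart u (moebius : ArithmeticFunction ℝ) * (highPart u vonMangoldt * zeta) := by
  have h1 := lowPart_add_highPart u vonMangoldt
  have h2 := lowPart_add_highPart u (moebius : ArithmeticFunction ℝ)
  have h3 : (vonMangoldt * (zeta : ArithmeticFunction ℝ)) = log := vonMangoldt_mul_zeta
  have h4 : ((moebius : ArithmeticFunction ℝ) * (zeta : ArithmeticFunction ℝ)) = 1 :=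
    coe_moebius_mul_coe_zeta
  set L1 := lowPart u vonMangoldt
  set L2 := highPart u vonMangoldt
  set m1 := lowPart u (moebius : ArithmeticFunction ℝ)
  set m2 := highPart u (moebius : ArithmeticFunction ℝ)
  rw [← h1] at h3
  rw [← h2] at h4
  rw [← h3]
  nth_rewrite 1 [← h1]
  linear_combination (-L2) * h4

lemma abs_moebius_le (n : ℕ) : |(moebius : ArithmeticFunction ℝ) n| ≤ 1 := by
  rw [ArithmeticFunction.intCoe_apply]
  exact_mod_cast abs_moebius_le_one

lemma abs_mul_apply_le_log (f g : ArithmeticFunction ℝ) (hf : ∀ n, |f n| ≤ 1)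
    (hg : ∀ n, |g n| ≤ vonMangoldt n) (n : ℕ) : |(f * g) n| ≤ Real.log n := by
  rw [ArithmeticFunction.mul_apply]
  refine (abs_sum_le_sum_abs _ _).trans ?_
  have h : Real.log n = ((zeta : ArithmeticFunction ℝ) * vonMangoldt) n := by
    rw [mul_comm, vonMangoldt_mul_zeta, log_apply]
  rw [h, ArithmeticFunction.mul_apply]
  refine sum_le_sum fun x hx => ?_
  rw [abs_mul]
  have hx0 := (Nat.ne_zero_of_mem_divisorsAntidiagonal hx).1
  rw [natCoe_apply, zeta_apply_ne hx0]
  have := abs_nonneg (f x.1)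
  push_cast
  gcongr
  · exact hf _
  · exact hg _

lemma mul_apply_eq_zero_of_forall (f g : ArithmeticFunction ℝ) {n : ℕ}
    (h : ∀ d e, d * e = n → n ≠ 0 → f d = 0 ∨ g e = 0) : (f * g) n = 0 := by
  rw [ArithmeticFunction.mul_apply]
  refine sum_eq_zero fun x hx => ?_
  rw [Nat.mem_divisorsAntidiagonal] at hx
  rcases h x.1 x.2 hx.1 hx.2 with h | h <;> simp [h]

lemma norm_sum_dyadic_le (g : ℕ → ℂ) {u : ℝ} (hu : 0 ≤ u) {R : ℝ} (K : ℕ)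
    (h : ∀ k < K, ‖∑ a ∈ Ico (⌊2 ^ k * u⌋₊ + 1) (⌊2 ^ (k + 1) * u⌋₊ + 1), g a‖ ≤ R) :
    ‖∑ a ∈ Ico (⌊u⌋₊ + 1) (⌊2 ^ K * u⌋₊ + 1), g a‖ ≤ K * R := by
  induction K with
  | zero => simp
  | succ K ih =>
    have h1 : ⌊u⌋₊ ≤ ⌊2 ^ K * u⌋₊ := by
      apply Nat.floor_le_floor
      have : (1:ℝ) ≤ 2 ^ K := one_le_pow₀ (by norm_num)
      nlinarith
    have h2 : ⌊2 ^ K * u⌋₊ ≤ ⌊2 ^ (K + 1) * u⌋₊ := by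
      apply Nat.floor_le_floor
      have : (2:ℝ) ^ K ≤ 2 ^ (K + 1) := pow_le_pow_right₀ (by norm_num) (by omega)
      gcongr
    rw [← sum_Ico_consecutive _ (show ⌊u⌋₊ + 1 ≤ ⌊2 ^ K * u⌋₊ + 1 by omega)
      (show ⌊2 ^ K * u⌋₊ + 1 ≤ ⌊2 ^ (K + 1) * u⌋₊ + 1 by omega)]
    refine (norm_add_le _ _).trans ?_
    have h3 := ih fun k hk => h k (by omega)
    have h4 := h K (by omega)
    push_cast
    linarith

lemma exists_dyadic_length {u R : ℝ} (hu : 1 ≤ u) (huR : u ≤ R) :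
    ∃ K : ℕ, R ≤ 2 ^ K * u ∧ (∀ k < K, 2 ^ k * u ≤ R) ∧ (K : ℝ) ≤ 2 * Real.log R + 1 := by
  have hex : ∃ K : ℕ, R ≤ 2 ^ K * u := by
    obtain ⟨K, hK⟩ := pow_unbounded_of_one_lt R (show (1:ℝ) < 2 by norm_num)
    refine ⟨K, hK.le.trans ?_⟩
    have : (0:ℝ) < 2 ^ K := by positivity
    nlinarith
  classical
  refine ⟨Nat.find hex, Nat.find_spec hex, fun k hk => (not_le.1 (Nat.find_min hex hk)).le, ?_⟩
  rcases Nat.eq_zero_or_pos (Nat.find hex) with h | h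
  · rw [h]
    have := Real.log_nonneg (hu.trans huR)
    push_cast; linarith
  · have h1 := (not_le.1 (Nat.find_min hex (show Nat.find hex - 1 < Nat.find hex by omega))).le
    set K := Nat.find hex
    have h2 : (2:ℝ) ^ (K - 1) ≤ R := by
      have : (0:ℝ) < 2 ^ (K - 1) := by positivity
      nlinarith
    have h3 := Real.log_le_log (by positivity) h2
    rw [Real.log_pow, Nat.cast_sub h] at h3
    have h4 := Real.log_two_gt_d9
    have h5 : (0:ℝ) ≤ (K:ℝ) - 1 := by
      have : (1:ℝ) ≤ K := by exact_mod_cast h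
      linarith
    push_cast at h3
    nlinarith

lemma exists_typeI_inner {c : ℝ} (hc : 1 < c) (hc2 : c < 2) :
    ∃ C : ℝ, 0 < C ∧ ∀ (H X : ℝ) (n0 n1 a : ℕ) (w : ℕ → ℝ) (W : ℝ), X ≠ 0 → 1 ≤ a →
      4 * (a : ℝ) ≤ H → H / 4 ≤ n0 → (n1 : ℝ) ≤ H + 1 → Monotone w → (∀ b, 0 ≤ w b) →
      (∀ b < n1, w b ≤ W) → 0 ≤ W →
      ‖∑ b ∈ range n1, if n0 ≤ a * b ∧ a * b < n1 then
          (w b : ℂ) * ee (X * ((a * b : ℕ) : ℝ) ^ c) else 0‖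
        ≤ C * W * (√(|X| * H ^ c) + H / √(|X| * H ^ c) * (1 / a)) := by
  obtain ⟨C, hC, hsum⟩ := exists_norm_sum_ee_rpow_le hc hc2 (κ := 4) (by norm_num)
  refine ⟨3 * C, by positivity, ?_⟩
  intro H X n0 n1 a w W hX ha haH hn0 hn1 hmono hw0 hwW hW0
  have ha0 : (0:ℝ) < a := by exact_mod_cast ha
  have hH0 : 0 < H := by linarith
  have hX0 : 0 < |X| := abs_pos.2 hX
  rw [← sum_filter]
  set s := (range n1).filter (fun b => n0 ≤ a * b ∧ a * b < n1) with hs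
  obtain ⟨p, q, hpq⟩ := exists_eq_Ico_of_convex s (by
      intro x hx z hz y hxy hyz
      simp only [hs, mem_filter, mem_range] at hx hz ⊢
      refine ⟨by omega, ?_, ?_⟩
      · exact hx.2.1.trans (Nat.mul_le_mul_left _ hxy)
      · exact (Nat.mul_le_mul_left _ hyz).trans_lt hz.2.2)
  have hmem : ∀ b ∈ Ico p q, H / (4 * a) ≤ (b : ℝ) ∧ (b : ℝ) ≤ 4 * (H / (4 * a)) := by
    intro b hb
    rw [← hpq] at hb
    simp only [hs, mem_filter, mem_range] at hb
    obtain ⟨_, h1, h2⟩ := hb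
    have h1' : (n0 : ℝ) ≤ a * b := by exact_mod_cast h1
    have h2' : (a : ℝ) * b + 1 ≤ n1 := by exact_mod_cast h2
    constructor
    · rw [div_le_iff₀ (by positivity)]; nlinarith
    · rw [show 4 * (H / (4 * (a:ℝ))) = H / a by field_simp, le_div_iff₀ ha0]; nlinarith
  have hlt : ∀ b ∈ Ico p q, b < n1 := by
    intro b hb
    rw [← hpq] at hb
    exact mem_range.1 (mem_filter.1 hb).1
  set F := |X| * H ^ c with hF
  have hF0 : 0 < F := by positivity
  have hsF : 0 < √F := Real.sqrt_pos.2 hF0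
  have hB1 : 1 ≤ H / (4 * a) := by rw [le_div_iff₀ (by positivity)]; linarith
  have hY : X * (a : ℝ) ^ c ≠ 0 := by positivity
  have hZ : |X * (a : ℝ) ^ c| * (H / (4 * a)) ^ c = F / 4 ^ c := by
    rw [abs_mul, abs_of_pos (show (0:ℝ) < (a:ℝ) ^ c by positivity),
      Real.div_rpow hH0.le (by positivity), Real.mul_rpow (by norm_num) ha0.le]
    field_simp
    rw [hF]
  have h4 : (4:ℝ) ^ c ≤ 16 := by
    calc (4:ℝ) ^ c ≤ 4 ^ (2:ℝ) := Real.rpow_le_rpow_of_exponent_le (by norm_num) hc2.le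
      _ = 16 := by norm_num
  have h41 : (1:ℝ) ≤ 4 ^ c := Real.one_le_rpow (by norm_num) (by linarith)
  have hs1 : √(F / 4 ^ c) ≤ √F := Real.sqrt_le_sqrt (div_le_self hF0.le h41)
  have hs2 : √F / 4 ≤ √(F / 4 ^ c) := by
    calc √F / 4 = √(F / 4 ^ 2) := by
          rw [Real.sqrt_div hF0.le (4 ^ 2), Real.sqrt_sq (by norm_num)]
      _ ≤ _ := Real.sqrt_le_sqrt (by gcongr; linarith)
  have hpart : ∀ m, m ≤ q → ‖∑ b ∈ Ico p m, ee (X * ((a * b : ℕ) : ℝ) ^ c)‖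
      ≤ C * (√F + H / √F * (1 / a)) := by
    intro m hm
    have h := hsum (H / (4 * a)) (X * (a : ℝ) ^ c) p m hB1 hY
      (fun n hn => hmem n (by rw [mem_Ico] at hn ⊢; omega))
    rw [hZ] at h
    have e : ∑ b ∈ Ico p m, ee (X * ((a * b : ℕ) : ℝ) ^ c)
        = ∑ n ∈ Ico p m, ee (X * (a : ℝ) ^ c * (n : ℝ) ^ c) := by
      refine sum_congr rfl fun b _ => ?_
      push_cast
      rw [Real.mul_rpow (by positivity) (by positivity), mul_assoc]
    rw [e]
    refine h.trans ?_
    gcongr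
    calc H / (4 * a) / √(F / 4 ^ c) ≤ H / (4 * a) / (√F / 4) := by gcongr
      _ = _ := by field_simp
  rw [hpq]
  have := norm_sum_mul_le_of_monotone w (fun b => ee (X * ((a * b : ℕ) : ℝ) ^ c))
    (by positivity) hW0 (fun b _ => hw0 b) (fun b hb => hwW b (hlt b hb))
    (fun n _ _ => hmono (Nat.le_succ n)) hpart
  refine this.trans (le_of_eq ?_)
  ring

lemma sum_one_div_le (R : ℕ) : ∑ a ∈ Ioc 0 R, (1 / (a : ℝ)) ≤ 1 + Real.log R := by
  have := harmonic_le_one_add_log R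
  rw [harmonic_eq_sum_Icc] at this
  push_cast at this
  simp_rw [one_div]
  exact this

lemma exists_typeI {c : ℝ} (hc : 1 < c) (hc2 : c < 2) :
    ∃ C : ℝ, 0 < C ∧ ∀ (H X R : ℝ) (n0 n1 : ℕ) (h w : ℕ → ℝ) (h0 W : ℝ), X ≠ 0 → 3 ≤ H → 1 ≤ R →
      4 * R ≤ H → H / 4 ≤ n0 → (n1 : ℝ) ≤ H + 1 → Monotone w → (∀ b, 0 ≤ w b) →
      (∀ b < n1, w b ≤ W) → 0 ≤ W → (∀ a < n1, |h a| ≤ h0) → 0 ≤ h0 →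
      (∀ a, h a ≠ 0 → 1 ≤ a ∧ (a : ℝ) ≤ R) →
      ‖∑ a ∈ range n1, ∑ b ∈ range n1, if n0 ≤ a * b ∧ a * b < n1 then
          (h a : ℂ) * (w b : ℂ) * ee (X * ((a * b : ℕ) : ℝ) ^ c) else 0‖
        ≤ C * h0 * W * Real.log H * (R * √(|X| * H ^ c) + H / √(|X| * H ^ c)) := by
  obtain ⟨C, hC, hin⟩ := exists_typeI_inner hc hc2
  refine ⟨2 * C, by positivity, ?_⟩
  intro H X R n0 n1 h w h0 W hX hH hR hRH hn0 hn1 hmono hw0 hwW hW0 hh hh0 hsupp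
  have hX0 : 0 < |X| := abs_pos.2 hX
  have hF0 : 0 < |X| * H ^ c := by positivity
  set sF := √(|X| * H ^ c) with hsF
  have hsF0 : 0 < sF := Real.sqrt_pos.2 hF0
  have hL : 1 ≤ Real.log H := by
    rw [Real.le_log_iff_exp_le (by linarith)]
    exact Real.exp_one_lt_d9.le.trans (by linarith)
  have h1 : ∀ a ∈ range n1, ‖∑ b ∈ range n1, if n0 ≤ a * b ∧ a * b < n1 then
          (h a : ℂ) * (w b : ℂ) * ee (X * ((a * b : ℕ) : ℝ) ^ c) else 0‖
      ≤ if a ∈ Ioc 0 ⌊R⌋₊ then h0 * (C * W * (sF + H / sF * (1 / a))) else 0 := by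
    intro a ha
    have e : ∑ b ∈ range n1, (if n0 ≤ a * b ∧ a * b < n1 then
          (h a : ℂ) * (w b : ℂ) * ee (X * ((a * b : ℕ) : ℝ) ^ c) else 0)
        = (h a : ℂ) * ∑ b ∈ range n1, (if n0 ≤ a * b ∧ a * b < n1 then
          (w b : ℂ) * ee (X * ((a * b : ℕ) : ℝ) ^ c) else 0) := by
      rw [mul_sum]
      refine sum_congr rfl fun b _ => ?_
      split_ifs <;> ring
    rw [e, norm_mul, Complex.norm_real, Real.norm_eq_abs]
    by_cases hz : h a = 0
    · rw [hz, abs_zero, zero_mul]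
      split_ifs <;> positivity
    · obtain ⟨h2, h3⟩ := hsupp a hz
      rw [if_pos (by rw [mem_Ioc]; exact ⟨h2, Nat.le_floor h3⟩)]
      have h4 := hin H X n0 n1 a w W hX h2 (by linarith) hn0 hn1 hmono hw0 hwW hW0
      exact mul_le_mul (hh a (mem_range.1 ha)) h4 (norm_nonneg _) hh0
  refine (norm_sum_le_of_le _ h1).trans ?_
  rw [← sum_filter]
  have hnn : ∀ a : ℕ, 0 ≤ h0 * (C * W * (sF + H / sF * (1 / a))) := fun a => by positivity
  refine (sum_le_sum_of_subset_of_nonneg (t := Ioc 0 ⌊R⌋₊)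
    (fun a ha => (mem_filter.1 ha).2) fun a _ _ => hnn a).trans ?_
  rw [← mul_sum, ← mul_sum, sum_add_distrib, ← mul_sum, sum_const, Nat.card_Ioc, nsmul_eq_mul,
    Nat.sub_zero]
  have h5 := sum_one_div_le ⌊R⌋₊
  have h6 : (⌊R⌋₊ : ℝ) ≤ R := Nat.floor_le (by linarith)
  have h7 : Real.log ⌊R⌋₊ ≤ Real.log H := by
    apply Real.log_le_log
    · have : 1 ≤ ⌊R⌋₊ := Nat.le_floor (by simpa using hR)
      exact_mod_cast this
    · linarith
  have h8 : ∑ a ∈ Ioc 0 ⌊R⌋₊, (1 / (a : ℝ)) ≤ 2 * Real.log H := by linarith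
  calc _ ≤ h0 * (C * W * (R * sF + H / sF * (2 * Real.log H))) := by gcongr
    _ ≤ h0 * (C * W * (2 * Real.log H * (R * sF) + H / sF * (2 * Real.log H))) := by
        have h9 : R * sF ≤ 2 * Real.log H * (R * sF) :=
          le_mul_of_one_le_left (by positivity) (by linarith)
        exact mul_le_mul_of_nonneg_left (mul_le_mul_of_nonneg_left (add_le_add_left h9 _) (by positivity)) hh0
    _ = _ := by ring

lemma exists_typeII {c : ℝ} (hc : 1 < c) (hc2 : c < 2) :
    ∃ C : ℝ, 0 < C ∧ ∀ (H X u Φ : ℝ) (n0 n1 : ℕ) (x y : ℕ → ℝ) (Lx Ly : ℝ), X ≠ 0 → 64 ≤ H →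
      1 ≤ u → u ≤ √H → H / 4 ≤ n0 → (n1 : ℝ) ≤ H + 1 → 0 ≤ Lx → 0 ≤ Ly →
      (∀ a, |x a| ≤ Lx) → (∀ b < n1, |y b| ≤ Ly) → (∀ a, x a ≠ 0 → u < a ∧ (a : ℝ) ≤ √H) →
      (∀ A, u ≤ A → A ≤ √H → ∃ Q : ℕ, 1 ≤ Q ∧ (Q : ℝ) ≤ A ∧
        H / Q + √(A * (|X| * H ^ c) * Q) + H * √(A / ((|X| * H ^ c) * Q)) ≤ Φ) →
      ‖∑ a ∈ range n1, ∑ b ∈ range n1, if n0 ≤ a * b ∧ a * b < n1 then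
          (x a : ℂ) * (y b : ℂ) * ee (X * ((a * b : ℕ) : ℝ) ^ c) else 0‖
        ≤ C * Lx * Ly * Real.log H * (√H * √Φ) := by
  obtain ⟨C, hC, hbil⟩ := exists_bilinear_le hc hc2
  refine ⟨4 * √C, by positivity, ?_⟩
  intro H X u Φ n0 n1 x y Lx Ly hX hH hu huH hn0 hn1 hLx hLy hx hy hsupp hΦ
  have hH0 : 0 < H := by linarith
  have hsH : √H * √H = H := Real.mul_self_sqrt hH0.le
  have hsH8 : 8 ≤ √H := by
    rw [show (8:ℝ) = √(8 ^ 2) by rw [Real.sqrt_sq (by norm_num)]]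
    exact Real.sqrt_le_sqrt (by linarith)
  have hX0 : 0 < |X| := abs_pos.2 hX
  have hΦ0 : 0 ≤ Φ := by
    obtain ⟨Q, _, _, h3⟩ := hΦ u le_rfl huH
    refine le_trans ?_ h3
    positivity
  have hn00 : 1 ≤ n0 := by
    have : (0:ℝ) < n0 := by linarith
    exact_mod_cast this
  have hL : 1 ≤ Real.log H := by
    rw [Real.le_log_iff_exp_le (by linarith)]
    exact Real.exp_one_lt_d9.le.trans (by linarith)
  obtain ⟨K, hK1, hK2, hK3⟩ := exists_dyadic_length hu huH
  set g : ℕ → ℂ := fun a => ∑ b ∈ range n1, if n0 ≤ a * b ∧ a * b < n1 then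
          (x a : ℂ) * (y b : ℂ) * ee (X * ((a * b : ℕ) : ℝ) ^ c) else 0 with hg
  have hgx : ∀ a, g a ≠ 0 → x a ≠ 0 := by
    intro a h h0
    apply h
    simp only [hg, h0]
    simp
  have hgn : ∀ a, n1 ≤ a → g a = 0 := by
    intro a ha
    simp only [hg]
    refine sum_eq_zero fun b _ => if_neg ?_
    rintro ⟨h1, h2⟩
    have : b ≠ 0 := by rintro rfl; omega
    have : a * 1 ≤ a * b := Nat.mul_le_mul_left _ (by omega)
    omega
  have hsum : ∑ a ∈ range n1, g a = ∑ a ∈ Ico (⌊u⌋₊ + 1) (⌊2 ^ K * u⌋₊ + 1), g a := by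
    have e1 : ∑ a ∈ range n1 ∩ Ico (⌊u⌋₊ + 1) (⌊2 ^ K * u⌋₊ + 1), g a = ∑ a ∈ range n1, g a := by
      refine sum_subset inter_subset_left fun a ha h1 => ?_
      by_contra h
      apply h1
      rw [mem_inter, mem_Ico]
      obtain ⟨h2, h3⟩ := hsupp a (hgx a h)
      refine ⟨ha, ?_, ?_⟩
      · exact (Nat.floor_lt (by linarith)).2 h2
      · exact Nat.lt_succ_of_le (Nat.le_floor (h3.trans hK1))
    have e2 : ∑ a ∈ range n1 ∩ Ico (⌊u⌋₊ + 1) (⌊2 ^ K * u⌋₊ + 1), g a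
        = ∑ a ∈ Ico (⌊u⌋₊ + 1) (⌊2 ^ K * u⌋₊ + 1), g a := by
      refine sum_subset inter_subset_right fun a ha h1 => ?_
      by_contra h
      apply h1
      rw [mem_inter, mem_range]
      refine ⟨?_, ha⟩
      by_contra h2
      exact h (hgn a (by omega))
    rw [← e1, e2]
  rw [hsum]
  set R := 2 * √C * Lx * Ly * (√H * √Φ) with hR
  have hR0 : 0 ≤ R := by positivity
  have hdy : ∀ k < K, ‖∑ a ∈ Ico (⌊2 ^ k * u⌋₊ + 1) (⌊2 ^ (k + 1) * u⌋₊ + 1), g a‖ ≤ R := by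
    intro k hk
    set A : ℝ := 2 ^ k * u with hA
    have hAu : u ≤ A := by
      have : (1:ℝ) ≤ 2 ^ k := one_le_pow₀ (by norm_num)
      nlinarith
    have hAH := hK2 k hk
    have hA1 : 1 ≤ A := hu.trans hAu
    have hA2 : 2 ^ (k + 1) * u = 2 * A := by rw [hA]; ring
    rw [hA2]
    obtain ⟨Q, hQ1, hQA, hQ⟩ := hΦ A hAu hAH
    set M := min n1 (⌊H / A⌋₊ + 1) with hM
    have hAr : ∀ a ∈ Ico (⌊A⌋₊ + 1) (⌊2 * A⌋₊ + 1), A ≤ (a : ℝ) ∧ (a : ℝ) ≤ 2 * A := by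
      intro a ha
      rw [mem_Ico] at ha
      constructor
      · exact (Nat.lt_of_floor_lt (by omega)).le
      · exact (Nat.le_floor_iff (by linarith)).1 (by omega)
    have key := hbil H X A n0 n1 (⌊A⌋₊ + 1) (⌊2 * A⌋₊ + 1) M Q (fun a => (x a : ℂ))
      (fun b => (y b : ℂ)) hX hA1 (by nlinarith) hn0 hn1 hAr hQ1 hQA
    have e : ∑ a ∈ Ico (⌊A⌋₊ + 1) (⌊2 * A⌋₊ + 1), g a
        = ∑ a ∈ Ico (⌊A⌋₊ + 1) (⌊2 * A⌋₊ + 1), ∑ b ∈ range M, if n0 ≤ a * b ∧ a * b < n1 then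
          (x a : ℂ) * (y b : ℂ) * ee (X * ((a * b : ℕ) : ℝ) ^ c) else 0 := by
      refine sum_congr rfl fun a ha => ?_
      simp only [hg]
      symm
      apply sum_subset
      · intro b hb; rw [mem_range] at hb ⊢; exact hb.trans_le (min_le_left _ _)
      · intro b hb hb2
        rw [mem_range] at hb hb2
        refine if_neg ?_
        rintro ⟨h1, h2⟩
        apply hb2
        rw [hM, lt_min_iff]
        refine ⟨hb, Nat.lt_succ_of_le (Nat.le_floor ?_)⟩
        rw [le_div_iff₀ (by linarith)]
        have h3 : (a : ℝ) * b + 1 ≤ n1 := by exact_mod_cast h2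
        have h4 := (hAr a ha).1
        have h5 : (0:ℝ) ≤ b := by positivity
        nlinarith
    rw [← e] at key
    have n1' : ∑ a ∈ Ico (⌊A⌋₊ + 1) (⌊2 * A⌋₊ + 1), ‖(x a : ℂ)‖ ^ 2 ≤ 2 * A * Lx ^ 2 := by
      refine (sum_le_sum (g := fun _ => Lx ^ 2) fun a _ => ?_).trans ?_
      · rw [Complex.norm_real, Real.norm_eq_abs]
        exact pow_le_pow_left₀ (abs_nonneg _) (hx a) 2
      · rw [sum_const, nsmul_eq_mul, Nat.card_Ico]
        have h1 : ((⌊2 * A⌋₊ + 1 - (⌊A⌋₊ + 1) : ℕ) : ℝ) ≤ 2 * A := by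
          refine le_trans ?_ (Nat.floor_le (show 0 ≤ 2 * A by linarith))
          exact_mod_cast (show ⌊2 * A⌋₊ + 1 - (⌊A⌋₊ + 1) ≤ ⌊2 * A⌋₊ by omega)
        gcongr
    have n2' : ∑ b ∈ range M, ‖(y b : ℂ)‖ ^ 2 ≤ 2 * (H / A) * Ly ^ 2 := by
      refine (sum_le_sum (g := fun _ => Ly ^ 2) fun b hb => ?_).trans ?_
      · rw [Complex.norm_real, Real.norm_eq_abs]
        rw [mem_range] at hb
        exact pow_le_pow_left₀ (abs_nonneg _) (hy b (hb.trans_le (min_le_left _ _))) 2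
      · rw [sum_const, nsmul_eq_mul, card_range]
        have h0 : 1 ≤ H / A := by rw [le_div_iff₀ (by linarith)]; nlinarith
        have h1 : (M : ℝ) ≤ 2 * (H / A) := by
          calc (M : ℝ) ≤ ((⌊H / A⌋₊ + 1 : ℕ) : ℝ) := by exact_mod_cast min_le_right _ _
            _ ≤ H / A + 1 := by push_cast; gcongr; exact Nat.floor_le (by positivity)
            _ ≤ _ := by linarith
        gcongr
    have hfin : ‖∑ a ∈ Ico (⌊A⌋₊ + 1) (⌊2 * A⌋₊ + 1), g a‖ ^ 2 ≤ R ^ 2 := by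
      refine key.trans ?_
      calc _ ≤ C * (2 * A * Lx ^ 2) * (2 * (H / A) * Ly ^ 2) * Φ := by gcongr
        _ = R ^ 2 := by
          have e1 : √C ^ 2 = C := Real.sq_sqrt hC.le
          have e2 : √H ^ 2 = H := Real.sq_sqrt hH0.le
          have e3 : √Φ ^ 2 = Φ := Real.sq_sqrt hΦ0
          have e4 : R ^ 2 = 4 * √C ^ 2 * Lx ^ 2 * Ly ^ 2 * (√H ^ 2 * √Φ ^ 2) := by
            rw [hR]; ring
          rw [e4, e1, e2, e3]
          field_simp
          ring
    exact (pow_le_pow_iff_left₀ (norm_nonneg _) hR0 (by norm_num)).1 hfin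
  refine (norm_sum_dyadic_le g (by linarith) K hdy).trans ?_
  have hlog : Real.log (√H) = Real.log H / 2 := Real.log_sqrt hH0.le
  rw [hlog] at hK3
  calc (K : ℝ) * R ≤ (2 * Real.log H) * R := by gcongr; linarith
    _ = _ := by rw [hR]; ring

lemma log_monotone_nat : Monotone fun b : ℕ => Real.log b := by
  intro a b hab
  rcases Nat.eq_zero_or_pos a with rfl | ha
  · simpa using Real.log_natCast_nonneg b
  · exact Real.log_le_log (by exact_mod_cast ha) (by exact_mod_cast hab)

lemma zeta_monotone : Monotone fun b : ℕ => ((zeta : ArithmeticFunction ℝ) b) := by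
  intro a b hab
  simp only [natCoe_apply, zeta_apply]
  split_ifs <;> first | omega | simp

lemma exists_vaughan {c : ℝ} (hc : 1 < c) (hc2 : c < 2) :
    ∃ C : ℝ, 0 < C ∧ ∀ (H X u Φ : ℝ) (n0 n1 : ℕ), X ≠ 0 → 64 ≤ H → 1 ≤ u → 4 * u ^ 2 < H →
      H / 4 ≤ n0 → (n1 : ℝ) ≤ H + 1 →
      (∀ A, u ≤ A → A ≤ √H → ∃ Q : ℕ, 1 ≤ Q ∧ (Q : ℝ) ≤ A ∧
        H / Q + √(A * (|X| * H ^ c) * Q) + H * √(A / ((|X| * H ^ c) * Q)) ≤ Φ) →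
      ‖∑ n ∈ Ico n0 n1, (vonMangoldt n : ℂ) * ee (X * (n : ℝ) ^ c)‖
        ≤ C * Real.log H ^ 2 * (√H * √Φ + u ^ 2 * √(|X| * H ^ c) + H / √(|X| * H ^ c)) := by
  obtain ⟨C1, hC1, hI⟩ := exists_typeI hc hc2
  obtain ⟨C2, hC2, hII⟩ := exists_typeII hc hc2
  refine ⟨2 * C1 + 2 * C2, by positivity, ?_⟩
  intro H X u Φ n0 n1 hX hH hu huH hn0 hn1 hΦ
  have hH0 : 0 < H := by linarith
  have hX0 : 0 < |X| := abs_pos.2 hX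
  have hn00 : 1 ≤ n0 := by
    have : (0:ℝ) < n0 := by linarith
    exact_mod_cast this
  have hsH : √H * √H = H := Real.mul_self_sqrt hH0.le
  have hL0 : 0 ≤ Real.log H := Real.log_nonneg (by linarith)
  have huu : u ≤ u ^ 2 := by nlinarith
  have husH : u ≤ √H := Real.le_sqrt_of_sq_le (by linarith)
  have hlogb : ∀ b < n1, Real.log b ≤ Real.log H := by
    intro b hb
    rcases Nat.eq_zero_or_pos b with rfl | hb0
    · simpa using hL0
    · have : (b : ℝ) + 1 ≤ n1 := by exact_mod_cast hb
      exact Real.log_le_log (by exact_mod_cast hb0) (by linarith)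
  set E : ℕ → ℂ := fun n => ee (X * (n : ℝ) ^ c) with hE
  set T : (ℕ → ℝ) → (ℕ → ℝ) → ℂ := fun f g => ∑ a ∈ range n1, ∑ b ∈ range n1,
    if n0 ≤ a * b ∧ a * b < n1 then (f a : ℂ) * (g b : ℂ) * E (a * b) else 0 with hT
  set m1 := lowPart u (moebius : ArithmeticFunction ℝ) with hm1
  set m2 := highPart u (moebius : ArithmeticFunction ℝ) with hm2
  set L1 := lowPart u vonMangoldt with hL1
  set L2 := highPart u vonMangoldt with hL2
  set Y := L2 * (zeta : ArithmeticFunction ℝ) with hY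
  have hm1b : ∀ n, |m1 n| ≤ 1 := by
    intro n
    rw [hm1, lowPart_apply]
    split_ifs
    · exact abs_moebius_le n
    · simp
  have hm2b : ∀ n, |m2 n| ≤ 1 := by
    intro n
    rw [hm2, highPart_apply]
    split_ifs
    · simp
    · exact abs_moebius_le n
  have hL1b : ∀ n, |L1 n| ≤ vonMangoldt n := by
    intro n
    rw [hL1, lowPart_apply]
    split_ifs
    · rw [abs_of_nonneg vonMangoldt_nonneg]
    · simpa using vonMangoldt_nonneg
  have hL2b : ∀ n, |L2 n| ≤ vonMangoldt n := by
    intro n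
    rw [hL2, highPart_apply]
    split_ifs
    · simpa using vonMangoldt_nonneg
    · rw [abs_of_nonneg vonMangoldt_nonneg]
  have hzb : ∀ n, |(zeta : ArithmeticFunction ℝ) n| ≤ 1 := by
    intro n
    simp only [natCoe_apply, zeta_apply]
    split_ifs <;> simp
  have hYb : ∀ n, |Y n| ≤ Real.log n := by
    intro n
    rw [hY, mul_comm]
    exact abs_mul_apply_le_log _ _ hzb hL2b n
  have hYu : ∀ n, Y n ≠ 0 → u < n := by
    intro n h
    by_contra! h2
    apply h
    refine mul_apply_eq_zero_of_forall _ _ fun d e hde hn => Or.inl ?_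
    rw [hL2, highPart_apply, if_pos]
    refine le_trans ?_ h2
    have : d ≤ n := Nat.le_of_dvd (by omega) (Dvd.intro _ hde)
    exact_mod_cast this
  have hdec : ∑ n ∈ Ico n0 n1, (vonMangoldt n : ℂ) * E n
      = T m1 log - T ⇑(m1 * L1) ⇑(zeta : ArithmeticFunction ℝ) + T m2 Y := by
    have h1 : ∀ n ∈ Ico n0 n1, (vonMangoldt n : ℂ) * E n
        = (((m1 * log) n : ℝ) : ℂ) * E n - (((m1 * L1 * zeta) n : ℝ) : ℂ) * E n
          + (((m2 * Y) n : ℝ) : ℂ) * E n := by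
      intro n hn
      rw [mem_Ico] at hn
      have h2 : vonMangoldt n = L1 n + (m1 * log) n - (m1 * L1 * zeta) n + (m2 * Y) n := by
        conv_lhs => rw [vaughan_identity u, sub_eq_add_neg]
        simp only [ArithmeticFunction.add_apply, ArithmeticFunction.neg_apply]
        rfl
      have h3 : L1 n = 0 := by
        rw [hL1, lowPart_apply, if_neg]
        have : (n0 : ℝ) ≤ n := by exact_mod_cast hn.1
        nlinarith
      rw [h2, h3]
      push_cast
      ring
    rw [sum_congr rfl h1, sum_add_distrib, sum_sub_distrib, sum_convolution _ _ _ hn00,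
      sum_convolution _ _ _ hn00, sum_convolution _ _ _ hn00]
  have b1 : ‖T m1 log‖ ≤ C1 * 1 * Real.log H * Real.log H
      * (u * √(|X| * H ^ c) + H / √(|X| * H ^ c)) := by
    refine hI H X u n0 n1 m1 log 1 (Real.log H) hX (by linarith) hu (by nlinarith) hn0 hn1
      log_monotone_nat (fun b => Real.log_natCast_nonneg b) (fun b hb => hlogb b hb) hL0
      (fun a _ => hm1b a) zero_le_one fun a ha => ?_
    constructor
    · by_contra! h
      apply ha
      rw [show a = 0 by omega]; simp
    · by_contra h
      apply ha
      rw [hm1, lowPart_apply, if_neg h]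
  have b2 : ‖T ⇑(m1 * L1) ⇑(zeta : ArithmeticFunction ℝ)‖ ≤ C1 * Real.log H * 1 * Real.log H
      * (u ^ 2 * √(|X| * H ^ c) + H / √(|X| * H ^ c)) := by
    refine hI H X (u ^ 2) n0 n1 ⇑(m1 * L1) ⇑(zeta : ArithmeticFunction ℝ) (Real.log H) 1 hX
      (by linarith) (by nlinarith) huH.le hn0 hn1 zeta_monotone ?_ (fun b _ => ?_)
      zero_le_one (fun a ha => ?_) hL0 fun a ha => ?_
    · intro b
      simp only [natCoe_apply]
      positivity
    · exact (le_abs_self _).trans (hzb b)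
    · exact (abs_mul_apply_le_log _ _ hm1b hL1b a).trans (hlogb a ha)
    · constructor
      · by_contra! h
        apply ha
        rw [show a = 0 by omega]; simp
      · by_contra! h
        apply ha
        refine mul_apply_eq_zero_of_forall _ _ fun d e hde hn => ?_
        rw [hm1, hL1, lowPart_apply, lowPart_apply]
        by_cases hd : (d : ℝ) ≤ u
        · right
          rw [if_neg]
          intro he
          have h1 : (d : ℝ) * e = a := by exact_mod_cast hde
          have h2 : (0:ℝ) ≤ d := by positivity
          nlinarith
        · left
          rw [if_neg hd]
  set x1 : ℕ → ℝ := fun a => if (a : ℝ) ≤ √H then m2 a else 0 with hx1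
  set x2 : ℕ → ℝ := fun a => if (a : ℝ) ≤ √H then 0 else m2 a with hx2
  set Y1 : ℕ → ℝ := fun b => if (b : ℝ) ≤ √H then Y b else 0 with hY1
  have hTd : T m2 Y = T x1 Y + T Y1 x2 := by
    have h1 : T Y1 x2 = T x2 Y := by
      simp only [hT]
      rw [sum_comm]
      refine sum_congr rfl fun a _ => sum_congr rfl fun b _ => ?_
      rw [mul_comm b a]
      split_ifs with h
      · simp only [hx2, hY1]
        by_cases ha : (a : ℝ) ≤ √H
        · simp [ha]
        · have hb : (b : ℝ) ≤ √H := by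
            by_contra! hb
            push Not at ha
            have h2 : (a : ℝ) * b + 1 ≤ n1 := by exact_mod_cast h.2
            have : √H * √H < a * b := by gcongr
            nlinarith
          rw [if_pos hb, if_neg ha]
          ring
      · rfl
    rw [h1]
    simp only [hT]
    rw [← sum_add_distrib]
    refine sum_congr rfl fun a _ => ?_
    rw [← sum_add_distrib]
    refine sum_congr rfl fun b _ => ?_
    simp only [hx1, hx2]
    split_ifs <;> push_cast <;> ring
  have b3 : ‖T x1 Y‖ ≤ C2 * 1 * Real.log H * Real.log H * (√H * √Φ) := by
    refine hII H X u Φ n0 n1 x1 Y 1 (Real.log H) hX hH hu husH hn0 hn1 zero_le_one hL0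
      (fun a => ?_) (fun b hb => (hYb b).trans (hlogb b hb)) (fun a ha => ?_) hΦ
    · simp only [hx1]
      split_ifs
      · exact hm2b a
      · simp
    · simp only [hx1] at ha
      by_cases h : (a : ℝ) ≤ √H
      · rw [if_pos h, hm2, highPart_apply] at ha
        refine ⟨?_, h⟩
        by_contra! h3
        exact ha (if_pos h3)
      · exact absurd (if_neg h) ha
  have b4 : ‖T Y1 x2‖ ≤ C2 * Real.log H * 1 * Real.log H * (√H * √Φ) := by
    refine hII H X u Φ n0 n1 Y1 x2 (Real.log H) 1 hX hH hu husH hn0 hn1 hL0 zero_le_one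
      (fun a => ?_) (fun b hb => ?_) (fun a ha => ?_) hΦ
    · simp only [hY1]
      split_ifs with h
      · refine (hYb a).trans ?_
        rcases Nat.eq_zero_or_pos a with rfl | ha0
        · simpa using hL0
        · refine Real.log_le_log (by exact_mod_cast ha0) (h.trans ?_)
          have : 1 ≤ √H := hu.trans husH
          nlinarith
      · simpa using hL0
    · simp only [hx2]
      split_ifs
      · simp
      · exact hm2b b
    · simp only [hY1] at ha
      by_cases h : (a : ℝ) ≤ √H
      · rw [if_pos h] at ha
        exact ⟨hYu a ha, h⟩
      · exact absurd (if_neg h) ha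
  rw [hdec, hTd]
  set sF := √(|X| * H ^ c) with hsF
  have hsF0 : 0 ≤ sF := Real.sqrt_nonneg _
  have hV : 0 ≤ √H * √Φ := by positivity
  have hHs : 0 ≤ H / sF := by positivity
  calc ‖T m1 log - T ⇑(m1 * L1) ⇑(zeta : ArithmeticFunction ℝ) + (T x1 Y + T Y1 x2)‖
      ≤ ‖T m1 log‖ + ‖T ⇑(m1 * L1) ⇑(zeta : ArithmeticFunction ℝ)‖ + (‖T x1 Y‖ + ‖T Y1 x2‖) :=
        (norm_add_le _ _).trans (add_le_add (norm_sub_le _ _) (norm_add_le _ _))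
    _ ≤ Real.log H ^ 2 * (2 * C1 * (u ^ 2 * sF + H / sF) + 2 * C2 * (√H * √Φ)) := by
        have : u * sF ≤ u ^ 2 * sF := by gcongr
        have h5 : C1 * 1 * Real.log H * Real.log H * (u * sF + H / sF)
          ≤ C1 * 1 * Real.log H * Real.log H * (u ^ 2 * sF + H / sF) := by gcongr
        linarith
    _ ≤ Real.log H ^ 2 * ((2 * C1 + 2 * C2) * (√H * √Φ + u ^ 2 * sF + H / sF)) := by
        gcongr ?_ * ?_
        have q1 : 0 ≤ C1 * (√H * √Φ) := by positivity
        have q2 : 0 ≤ C2 * (u ^ 2 * sF + H / sF) := by positivity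
        linarith
    _ = _ := by ring

lemma four_mul_rpow_lt {H : ℝ} (hH : 64 ≤ H) : 4 * (H ^ (2 / 13 : ℝ)) ^ 2 < H := by
  have hH0 : 0 < H := by linarith
  have h1 : (4:ℝ) ≤ H ^ (1 / 3 : ℝ) := by
    calc (4:ℝ) = (64:ℝ) ^ (1 / 3 : ℝ) := by
          rw [show (64:ℝ) = 4 ^ (3:ℝ) by norm_num, ← Real.rpow_mul (by norm_num)]; norm_num
      _ ≤ _ := Real.rpow_le_rpow (by norm_num) hH (by norm_num)
  calc 4 * (H ^ (2 / 13 : ℝ)) ^ 2 ≤ H ^ (1 / 3 : ℝ) * (H ^ (2 / 13 : ℝ)) ^ 2 := by gcongr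
    _ = H ^ (1 / 3 + 4 / 13 : ℝ) := by
        rw [← Real.rpow_natCast, ← Real.rpow_mul hH0.le, ← Real.rpow_add hH0]; norm_num
    _ < H ^ (1:ℝ) := Real.rpow_lt_rpow_of_exponent_lt (by linarith) (by norm_num)
    _ = H := Real.rpow_one H

lemma half_le_floor {x : ℝ} (hx : 1 ≤ x) : x / 2 ≤ (⌊x⌋₊ : ℝ) := by
  have h1 : 1 ≤ ⌊x⌋₊ := Nat.le_floor (by simpa using hx)
  have h2 : (1:ℝ) ≤ ⌊x⌋₊ := by exact_mod_cast h1
  have := Nat.lt_floor_add_one x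
  linarith

lemma sqrt_le_rpow {H y p : ℝ} (hH : 0 < H) (h : y ≤ H ^ (2 * p)) : √y ≤ H ^ p := by
  rw [Real.sqrt_le_left (by positivity), ← Real.rpow_natCast, ← Real.rpow_mul hH.le]
  convert h using 2
  push_cast; ring

lemma rpow_le_sqrt {H y p : ℝ} (hH : 0 < H) (h : H ^ (2 * p) ≤ y) : H ^ p ≤ √y := by
  apply Real.le_sqrt_of_sq_le
  rw [← Real.rpow_natCast, ← Real.rpow_mul hH.le]
  convert h using 2
  push_cast; ring

/-- The exponential sum over primes for frequencies that are not too small. -/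
lemma exists_norm_sum_vonMangoldt_le {c : ℝ} (hc : 1 < c) (hc2 : c ≤ 27 / 26) :
    ∃ C : ℝ, 0 < C ∧ ∀ (H X : ℝ) (n0 n1 : ℕ), 64 ≤ H → H ^ (-1 / 5 : ℝ) ≤ |X| →
      H / 4 ≤ n0 → (n1 : ℝ) ≤ H + 1 →
      ‖∑ n ∈ Ico n0 n1, (vonMangoldt n : ℂ) * ee (X * (n : ℝ) ^ c)‖
        ≤ C * Real.log H ^ 2 * H ^ (12 / 13 : ℝ) * √(1 + |X|) := by
  obtain ⟨C, hC, hV⟩ := exists_vaughan hc (by linarith)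
  refine ⟨5 * C, by positivity, ?_⟩
  intro H X n0 n1 hH hX hn0 hn1
  have hH0 : 0 < H := by linarith
  have hH1 : 1 ≤ H := by linarith
  have hXp : 0 < |X| := lt_of_lt_of_le (by positivity) hX
  have hX0 : X ≠ 0 := abs_pos.1 hXp
  set t := 1 + |X| with ht
  have ht1 : 1 ≤ t := by linarith
  set u := H ^ (2 / 13 : ℝ) with hu
  have hu1 : 1 ≤ u := Real.one_le_rpow hH1 (by norm_num)
  set F := |X| * H ^ c with hF
  have hmono : ∀ {p q : ℝ}, p ≤ q → H ^ p ≤ H ^ q := fun h =>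
    Real.rpow_le_rpow_of_exponent_le hH1 h
  have hF1 : F ≤ t * H ^ (27 / 26 : ℝ) := by
    rw [hF]
    gcongr
    linarith
  have hF2 : H ^ (4 / 5 : ℝ) ≤ F := by
    calc H ^ (4 / 5 : ℝ) = H ^ (-1 / 5 : ℝ) * H ^ (1 : ℝ) := by
          rw [← Real.rpow_add hH0]; norm_num
      _ ≤ |X| * H ^ c := by gcongr
  have hF0 : 0 < F := by positivity
  have hst1 : 1 ≤ √t := Real.one_le_sqrt.2 ht1
  have key := hV H X u (5 * t * H ^ (11 / 13 : ℝ)) n0 n1 hX0 hH hu1 (four_mul_rpow_lt hH) hn0 hn1 (by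
    intro A hA1 hA2
    have hQ1 := half_le_floor hu1
    have hQ2 : (⌊u⌋₊ : ℝ) ≤ u := Nat.floor_le (by linarith)
    have hA0 : 0 < A := by linarith
    have hQ0 : (0:ℝ) < ⌊u⌋₊ := by linarith
    refine ⟨⌊u⌋₊, Nat.le_floor (by simpa using hu1), hQ2.trans hA1, ?_⟩
    have hA3 : A ≤ H ^ (1 / 2 : ℝ) := by rwa [← Real.sqrt_eq_rpow]
    have i1 : H / ⌊u⌋₊ ≤ 2 * H ^ (11 / 13 : ℝ) := by
      calc H / ⌊u⌋₊ ≤ H / (u / 2) := by gcongr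
        _ = 2 * (H / u) := by field_simp
        _ = 2 * H ^ (11 / 13 : ℝ) := by
            congr 1
            nth_rewrite 1 [← Real.rpow_one H]
            rw [hu, ← Real.rpow_sub hH0]; norm_num
    have i2 : √(A * F * ⌊u⌋₊) ≤ t * H ^ (11 / 13 : ℝ) := by
      rw [Real.sqrt_le_left (by positivity)]
      calc A * F * ⌊u⌋₊ ≤ H ^ (1 / 2 : ℝ) * (t * H ^ (27 / 26 : ℝ)) * H ^ (2 / 13 : ℝ) := by gcongr
        _ = t * H ^ (22 / 13 : ℝ) := by
            rw [show (22 / 13 : ℝ) = 1 / 2 + 27 / 26 + 2 / 13 by norm_num, Real.rpow_add hH0,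
              Real.rpow_add hH0]
            ring
        _ ≤ t ^ 2 * H ^ (22 / 13 : ℝ) := by gcongr; nlinarith
        _ = _ := by
            rw [mul_pow, ← Real.rpow_natCast (H ^ (11 / 13 : ℝ)), ← Real.rpow_mul hH0.le]
            norm_num
    have i3 : H * √(A / (F * ⌊u⌋₊)) ≤ 2 * H ^ (11 / 13 : ℝ) := by
      have : √(A / (F * ⌊u⌋₊)) ≤ 2 * H ^ (-2 / 13 : ℝ) := by
        rw [Real.sqrt_le_left (by positivity)]
        calc A / (F * ⌊u⌋₊) ≤ H ^ (1 / 2 : ℝ) / (H ^ (4 / 5 : ℝ) * (u / 2)) := by gcongr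
          _ = 2 * H ^ (1 / 2 - 4 / 5 - 2 / 13 : ℝ) := by
              rw [Real.rpow_sub hH0, Real.rpow_sub hH0, hu]
              field_simp
          _ ≤ 4 * H ^ (-4 / 13 : ℝ) := by
              have : H ^ (1 / 2 - 4 / 5 - 2 / 13 : ℝ) ≤ H ^ (-4 / 13 : ℝ) := hmono (by norm_num)
              have h0 : 0 < H ^ (-4 / 13 : ℝ) := by positivity
              linarith
          _ = _ := by
            rw [mul_pow, ← Real.rpow_natCast (H ^ (-2 / 13 : ℝ)), ← Real.rpow_mul hH0.le]
            norm_num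
      calc H * √(A / (F * ⌊u⌋₊)) ≤ H ^ (1:ℝ) * (2 * H ^ (-2 / 13 : ℝ)) := by
            rw [Real.rpow_one]; gcongr
        _ = 2 * (H ^ (1:ℝ) * H ^ (-2 / 13 : ℝ)) := by ring
        _ = _ := by rw [← Real.rpow_add hH0]; norm_num
    have h0 : 0 < H ^ (11 / 13 : ℝ) := by positivity
    nlinarith)
  have j1 : √H * √(5 * t * H ^ (11 / 13 : ℝ)) ≤ 3 * (H ^ (12 / 13 : ℝ) * √t) := by
    rw [← Real.sqrt_mul hH0.le, show H * (5 * t * H ^ (11 / 13 : ℝ))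
      = 5 * t * (H ^ (1:ℝ) * H ^ (11 / 13 : ℝ)) by rw [Real.rpow_one]; ring, ← Real.rpow_add hH0,
      Real.sqrt_le_left (by positivity), mul_pow, mul_pow, Real.sq_sqrt (by linarith),
      ← Real.rpow_natCast (H ^ (12 / 13 : ℝ)), ← Real.rpow_mul hH0.le]
    norm_num
    have h0 : 0 < t * H ^ (24 / 13 : ℝ) := by positivity
    linarith
  have j2 : u ^ 2 * √F ≤ H ^ (12 / 13 : ℝ) * √t := by
    calc u ^ 2 * √F ≤ u ^ 2 * √(t * H ^ (27 / 26 : ℝ)) := by gcongr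
      _ = H ^ (43 / 52 : ℝ) * √t := by
          rw [Real.sqrt_mul (by linarith), hu, ← Real.rpow_natCast, ← Real.rpow_mul hH0.le,
            Real.sqrt_eq_rpow (H ^ (27 / 26 : ℝ)), ← Real.rpow_mul hH0.le,
            mul_comm (√t), ← mul_assoc, ← Real.rpow_add hH0]
          norm_num
      _ ≤ _ := by gcongr ?_ * _; exact hmono (by norm_num)
  have j3 : H / √F ≤ H ^ (12 / 13 : ℝ) * √t := by
    have : H ^ (2 / 5 : ℝ) ≤ √F := rpow_le_sqrt hH0 (by convert hF2 using 2; norm_num)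
    calc H / √F ≤ H ^ (1:ℝ) / H ^ (2 / 5 : ℝ) := by rw [Real.rpow_one]; gcongr
      _ = H ^ (3 / 5 : ℝ) := by rw [← Real.rpow_sub hH0]; norm_num
      _ ≤ H ^ (12 / 13 : ℝ) := hmono (by norm_num)
      _ ≤ _ := le_mul_of_one_le_right (by positivity) hst1
  refine key.trans ?_
  calc _ ≤ C * Real.log H ^ 2 * (5 * (H ^ (12 / 13 : ℝ) * √t)) := by
        gcongr ?_ * ?_
        linarith
    _ = _ := by ring

/-- The exponential sum over primes for small frequencies. -/
lemma exists_norm_sum_vonMangoldt_le_of_small {c ω : ℝ} (hc : 1 < c) (hc2 : c ≤ 27 / 26)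
    (hω : 0 < ω) (hω2 : ω ≤ 1 / 10) :
    ∃ C : ℝ, 0 < C ∧ ∀ (H X : ℝ) (n0 n1 : ℕ), 64 ≤ H → H ^ (ω - c) ≤ |X| →
      |X| ≤ H ^ (-1 / 5 : ℝ) → H / 4 ≤ n0 → (n1 : ℝ) ≤ H + 1 →
      ‖∑ n ∈ Ico n0 n1, (vonMangoldt n : ℂ) * ee (X * (n : ℝ) ^ c)‖
        ≤ C * Real.log H ^ 2 * H ^ (1 - ω / 4) := by
  obtain ⟨C, hC, hV⟩ := exists_vaughan hc (by linarith)
  refine ⟨5 * C, by positivity, ?_⟩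
  intro H X n0 n1 hH hX hX2 hn0 hn1
  have hH0 : 0 < H := by linarith
  have hH1 : 1 ≤ H := by linarith
  have hXp : 0 < |X| := lt_of_lt_of_le (by positivity) hX
  have hX0 : X ≠ 0 := abs_pos.1 hXp
  set u := H ^ (2 / 13 : ℝ) with hu
  have hu1 : 1 ≤ u := Real.one_le_rpow hH1 (by norm_num)
  set F := |X| * H ^ c with hF
  have hmono : ∀ {p q : ℝ}, p ≤ q → H ^ p ≤ H ^ q := fun h =>
    Real.rpow_le_rpow_of_exponent_le hH1 h
  have hF1 : F ≤ H ^ (0.84 : ℝ) := by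
    calc F ≤ H ^ (-1 / 5 : ℝ) * H ^ (27 / 26 : ℝ) := by rw [hF]; gcongr
      _ = H ^ (-1 / 5 + 27 / 26 : ℝ) := by rw [← Real.rpow_add hH0]
      _ ≤ _ := hmono (by norm_num)
  have hF2 : H ^ ω ≤ F := by
    calc H ^ ω = H ^ (ω - c) * H ^ c := by rw [← Real.rpow_add hH0]; congr 1; ring
      _ ≤ |X| * H ^ c := by gcongr
  have hF0 : 0 < F := by positivity
  have hsF1 : √F ≤ H ^ (0.42 : ℝ) := sqrt_le_rpow hH0 (by convert hF1 using 2; norm_num)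
  have hsF2 : H ^ (ω / 2) ≤ √F := rpow_le_sqrt hH0 (by convert hF2 using 2; ring)
  have hsF0 : 0 < √F := Real.sqrt_pos.2 hF0
  have j3 : H / √F ≤ H ^ (1 - ω / 2) := by
    calc H / √F ≤ H ^ (1:ℝ) / H ^ (ω / 2) := by rw [Real.rpow_one]; gcongr
      _ = _ := by rw [← Real.rpow_sub hH0]
  have key := hV H X u (5 * H ^ (1 - ω / 2)) n0 n1 hX0 hH hu1 (four_mul_rpow_lt hH) hn0 hn1 (by
    intro A hA1 hA2
    have hA3 : 1 ≤ A := hu1.trans hA1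
    have hQ1 := half_le_floor hA3
    have hQ2 : (⌊A⌋₊ : ℝ) ≤ A := Nat.floor_le (by linarith)
    have hA0 : 0 < A := by linarith
    have hQ0 : (0:ℝ) < ⌊A⌋₊ := by linarith
    refine ⟨⌊A⌋₊, Nat.le_floor (by simpa using hA3), hQ2, ?_⟩
    have hA3 : A ≤ H ^ (1 / 2 : ℝ) := by rwa [← Real.sqrt_eq_rpow]
    have i1 : H / ⌊A⌋₊ ≤ 2 * H ^ (1 - ω / 2) := by
      calc H / ⌊A⌋₊ ≤ H / (u / 2) := by gcongr; linarith
        _ = 2 * (H / u) := by field_simp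
        _ = 2 * H ^ (11 / 13 : ℝ) := by
            congr 1
            nth_rewrite 1 [← Real.rpow_one H]
            rw [hu, ← Real.rpow_sub hH0]; norm_num
        _ ≤ _ := by gcongr 2 * ?_; exact hmono (by linarith)
    have i2 : √(A * F * ⌊A⌋₊) ≤ H ^ (1 - ω / 2) := by
      calc √(A * F * ⌊A⌋₊) ≤ √(A ^ 2 * F) := by
            apply Real.sqrt_le_sqrt
            have : 0 < A * F := by positivity
            nlinarith
        _ = A * √F := by rw [Real.sqrt_mul (by positivity), Real.sqrt_sq hA0.le]
        _ ≤ H ^ (1 / 2 : ℝ) * H ^ (0.42 : ℝ) := by gcongr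
        _ = H ^ (1 / 2 + 0.42 : ℝ) := by rw [← Real.rpow_add hH0]
        _ ≤ _ := hmono (by norm_num; linarith)
    have i3 : H * √(A / (F * ⌊A⌋₊)) ≤ 2 * H ^ (1 - ω / 2) := by
      have : √(A / (F * ⌊A⌋₊)) ≤ 2 / √F := by
        rw [Real.sqrt_le_left (by positivity), div_pow, Real.sq_sqrt hF0.le]
        rw [div_le_div_iff₀ (by positivity) hF0]
        nlinarith
      calc H * √(A / (F * ⌊A⌋₊)) ≤ H * (2 / √F) := by gcongr
        _ = 2 * (H / √F) := by ring
        _ ≤ _ := by gcongr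
    linarith)
  have j1 : √H * √(5 * H ^ (1 - ω / 2)) ≤ 3 * H ^ (1 - ω / 4) := by
    rw [← Real.sqrt_mul hH0.le, show H * (5 * H ^ (1 - ω / 2))
      = 5 * (H ^ (1:ℝ) * H ^ (1 - ω / 2)) by rw [Real.rpow_one]; ring, ← Real.rpow_add hH0,
      Real.sqrt_le_left (by positivity), mul_pow, ← Real.rpow_natCast (H ^ (1 - ω / 4)),
      ← Real.rpow_mul hH0.le, show (1 - ω / 4) * ((2:ℕ):ℝ) = 1 + (1 - ω / 2) by push_cast; ring]
    gcongr ?_ * _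
    norm_num
  have j2 : u ^ 2 * √F ≤ H ^ (1 - ω / 4) := by
    calc u ^ 2 * √F ≤ u ^ 2 * H ^ (0.42 : ℝ) := by gcongr
      _ = H ^ (4 / 13 + 0.42 : ℝ) := by
          rw [hu, ← Real.rpow_natCast, ← Real.rpow_mul hH0.le, ← Real.rpow_add hH0]
          norm_num
      _ ≤ _ := hmono (by norm_num; linarith)
  have j4 : H ^ (1 - ω / 2) ≤ H ^ (1 - ω / 4) := hmono (by linarith)
  refine key.trans ?_
  calc _ ≤ C * Real.log H ^ 2 * (5 * H ^ (1 - ω / 4)) := by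
        gcongr ?_ * ?_
        linarith
    _ = _ := by ring

/-- The `1`-periodic tent function of height `1` supported within distance `η` of `ℤ`. -/
noncomputable def tent (η y : ℝ) : ℝ := max 0 (1 - |y - round y| / η)

/-- The Fourier coefficients of `tent η`. -/
noncomputable def tentCoeff (η : ℝ) (k : ℤ) : ℝ :=
  if k = 0 then η else (1 - Real.cos (2 * Real.pi * (k * η))) / (2 * Real.pi ^ 2 * η * k ^ 2)

lemma tentCoeff_zero (η : ℝ) : tentCoeff η 0 = η := if_pos rfl

lemma tentCoeff_nonneg {η : ℝ} (hη : 0 < η) (k : ℤ) : 0 ≤ tentCoeff η k := by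
  unfold tentCoeff
  split_ifs
  · exact hη.le
  · have := Real.cos_le_one (2 * Real.pi * (k * η))
    exact div_nonneg (by linarith) (by positivity)

lemma tentCoeff_le {η : ℝ} (hη : 0 < η) (k : ℤ) : tentCoeff η k ≤ 4 * η / (1 + η * |(k : ℝ)|) ^ 2 := by
  unfold tentCoeff
  split_ifs with h
  · subst h
    simp
    linarith
  · have hk : (k : ℝ) ≠ 0 := by exact_mod_cast h
    have hk0 : 0 < |(k : ℝ)| := abs_pos.2 hk
    have hk2 : (k : ℝ) ^ 2 = |(k : ℝ)| ^ 2 := (sq_abs _).symm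
    have hpi := Real.pi_gt_three
    rcases le_total (η * |(k : ℝ)|) 1 with h1 | h1
    · have h2 := Real.one_sub_sq_div_two_le_cos (x := 2 * Real.pi * (k * η))
      calc (1 - Real.cos (2 * Real.pi * (k * η))) / (2 * Real.pi ^ 2 * η * k ^ 2)
          ≤ ((2 * Real.pi * (k * η)) ^ 2 / 2) / (2 * Real.pi ^ 2 * η * k ^ 2) := by
            gcongr; linarith
        _ = η := by field_simp
        _ ≤ _ := by
            rw [le_div_iff₀ (by positivity)]
            have : (1 + η * |(k : ℝ)|) ^ 2 ≤ 2 ^ 2 := by gcongr; linarith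
            nlinarith
    · have h2 := Real.neg_one_le_cos (2 * Real.pi * (k * η))
      calc (1 - Real.cos (2 * Real.pi * (k * η))) / (2 * Real.pi ^ 2 * η * k ^ 2)
          ≤ 2 / (2 * Real.pi ^ 2 * η * k ^ 2) := by gcongr; linarith
        _ ≤ 2 / (2 * 1 ^ 2 * η * k ^ 2) := by gcongr; linarith
        _ = 4 * η / (2 * (η * |(k : ℝ)|)) ^ 2 := by
            rw [hk2]; field_simp; norm_num
        _ ≤ _ := by gcongr; linarith

lemma ee_re (x : ℝ) : (ee x).re = Real.cos (2 * Real.pi * x) := by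
  unfold ee
  rw [show (2 * Real.pi * x * Complex.I : ℂ) = ((2 * Real.pi * x : ℝ) : ℂ) * Complex.I by
    push_cast; ring, Complex.exp_ofReal_mul_I_re]

lemma ee_add_ee_neg (x : ℝ) : ee x + ee (-x) = 2 * Real.cos (2 * Real.pi * x) := by
  rw [ee_neg, Complex.add_conj, ee_re]
  push_cast; ring

lemma hasSum_ee_div_sq {z : ℝ} (hz : |z| ≤ 1) :
    HasSum (fun n : ℤ => 1 / (n : ℂ) ^ 2 * ee (n * z))
      ((2 * Real.pi ^ 2 * (z ^ 2 - |z| + 1 / 6) : ℝ) : ℂ) := by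
  have main : ∀ x ∈ Set.Icc (0:ℝ) 1, HasSum (fun n : ℤ => 1 / (n : ℂ) ^ 2 * ee (n * x))
      ((2 * Real.pi ^ 2 * (x ^ 2 - x + 1 / 6) : ℝ) : ℂ) := by
    intro x hx
    have h := hasSum_one_div_pow_mul_fourier_mul_bernoulliFun (k := 2) le_rfl hx
    have e1 : (-(2 * (Real.pi : ℂ) * Complex.I) ^ 2 / (Nat.factorial 2 : ℂ) * (bernoulliFun 2 x : ℂ))
        = ((2 * Real.pi ^ 2 * (x ^ 2 - x + 1 / 6) : ℝ) : ℂ) := by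
      rw [bernoulliFun_two, mul_pow, Complex.I_sq]
      simp only [Nat.factorial]
      push_cast
      ring
    rw [e1] at h
    convert h using 2 with n
    rw [fourier_coe_apply]
    unfold ee
    congr 2
    push_cast
    ring
  rcases le_total 0 z with h0 | h0
  · rw [abs_of_nonneg h0] at hz ⊢
    exact main z ⟨h0, hz⟩
  · rw [abs_of_nonpos h0] at hz ⊢
    have h := main (-z) ⟨by linarith, hz⟩
    have h2 := (Equiv.neg ℤ).hasSum_iff.2 h
    convert h2 using 2 with n
    · simp
    · ring_nf

lemma hasSum_tent_of_le {η y : ℝ} (hη : 0 < η) (hη2 : η ≤ 1 / 2) (hy : |y| ≤ 1 / 2) :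
    HasSum (fun k : ℤ => (tentCoeff η k : ℂ) * ee (k * y)) ((max 0 (1 - |y| / η) : ℝ) : ℂ) := by
  have h0 := hasSum_ee_div_sq (z := y) (by linarith)
  have h1 := hasSum_ee_div_sq (z := y + η) ((abs_add_le _ _).trans (by rw [abs_of_pos hη]; linarith))
  have h2 := hasSum_ee_div_sq (z := y - η) ((abs_sub _ _).trans (by rw [abs_of_pos hη]; linarith))
  have h3 := (((h0.mul_left 2).sub h1).sub h2).mul_left (1 / (4 * Real.pi ^ 2 * η : ℂ))
  have h4 := h3.add (hasSum_ite_eq (0 : ℤ) (η : ℂ))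
  have hpi : (Real.pi : ℂ) ≠ 0 := by exact_mod_cast Real.pi_ne_zero
  have hηc : (η : ℂ) ≠ 0 := by exact_mod_cast hη.ne'
  convert h4 using 1
  · rfl
  · funext n
    by_cases hn : n = 0
    · subst hn
      simp [tentCoeff, ee_zero]
    · have hnc : (n : ℂ) ≠ 0 := by exact_mod_cast hn
      rw [if_neg hn, add_zero, tentCoeff, if_neg hn]
      have e1 : ee (n * (y + η)) + ee (n * (y - η))
          = 2 * Real.cos (2 * Real.pi * (n * η)) * ee (n * y) := by
        rw [← ee_add_ee_neg, mul_add, ee_add, show (n : ℝ) * (y - η) = n * y + -(n * η) by ring,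
          ee_add]
        ring
      have e2 : 2 * (1 / (n : ℂ) ^ 2 * ee (n * y)) - 1 / (n : ℂ) ^ 2 * ee (n * (y + η))
          - 1 / (n : ℂ) ^ 2 * ee (n * (y - η))
          = 1 / (n : ℂ) ^ 2 * (2 * ee (n * y) - (ee (n * (y + η)) + ee (n * (y - η)))) := by ring
      rw [e2, e1]
      push_cast
      field_simp
      ring
  · have hpi' : Real.pi ≠ 0 := Real.pi_ne_zero
    have e : max 0 (1 - |y| / η) = 1 / (4 * Real.pi ^ 2 * η) *
        (2 * (2 * Real.pi ^ 2 * (y ^ 2 - |y| + 1 / 6))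
          - 2 * Real.pi ^ 2 * ((y + η) ^ 2 - |y + η| + 1 / 6)
          - 2 * Real.pi ^ 2 * ((y - η) ^ 2 - |y - η| + 1 / 6)) + η := by
      rcases le_total |y| η with h | h
      · rw [max_eq_right (by rw [sub_nonneg, div_le_one hη]; exact h)]
        rw [abs_le] at h
        rw [abs_of_nonneg (show 0 ≤ y + η by linarith), abs_of_nonpos (show y - η ≤ 0 by linarith)]
        field_simp
        ring
      · rw [max_eq_left (by rw [sub_nonpos, one_le_div hη]; exact h)]
        rcases le_total 0 y with hy0 | hy0
        · rw [abs_of_nonneg hy0] at h ⊢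
          rw [abs_of_nonneg (show 0 ≤ y + η by linarith),
            abs_of_nonneg (show 0 ≤ y - η by linarith)]
          field_simp
          ring
        · rw [abs_of_nonpos hy0] at h ⊢
          rw [abs_of_nonpos (show y + η ≤ 0 by linarith),
            abs_of_nonpos (show y - η ≤ 0 by linarith)]
          field_simp
          ring
    rw [e]
    push_cast
    ring

lemma hasSum_tent {η : ℝ} (hη : 0 < η) (hη2 : η ≤ 1 / 2) (y : ℝ) :
    HasSum (fun k : ℤ => (tentCoeff η k : ℂ) * ee (k * y)) (tent η y : ℂ) := by
  have h := hasSum_tent_of_le hη hη2 (abs_sub_round y)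
  have e : ∀ k : ℤ, ee (k * y) = ee (k * (y - round y)) := by
    intro k
    rw [show (k : ℝ) * y = k * (y - round y) + ((k * round y : ℤ) : ℝ) by push_cast; ring,
      ee_add_int]
  simp_rw [e]
  exact h

lemma tent_nonneg (η y : ℝ) : 0 ≤ tent η y := le_max_left _ _

lemma tent_le_one {η : ℝ} (hη : 0 < η) (y : ℝ) : tent η y ≤ 1 := by
  unfold tent
  have : 0 ≤ |y - round y| / η := by positivity
  exact max_le (by norm_num) (by linarith)

lemma abs_sub_round_lt_of_tent_pos {η y : ℝ} (hη : 0 < η) (h : 0 < tent η y) :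
    |y - round y| < η := by
  by_contra! h2
  rw [tent, max_eq_left] at h
  · exact h.false
  · rw [sub_nonpos, one_le_div hη]; exact h2

lemma tent_neg (η y : ℝ) : tent η (-y) = tent η y := by
  have h : |(-y) - round (-y)| = |y - round y| := by
    apply le_antisymm
    · calc |(-y) - round (-y)| ≤ |(-y) - (-(round y) : ℤ)| := round_le _ _
        _ = |y - round y| := by rw [← abs_neg]; congr 1; push_cast; ring
    · calc |y - round y| ≤ |y - (-(round (-y)) : ℤ)| := round_le _ _
        _ = _ := by rw [← abs_neg]; congr 1; push_cast; ring
  rw [tent, tent, h]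

lemma tent_le_tent_div {η y r : ℝ} (hη : 0 < η) (hr : 0 < r) {j : ℤ} (hj : (round y : ℝ) = r * j) :
    tent η y ≤ tent (η / r) (y / r) := by
  unfold tent
  apply max_le_max le_rfl
  have h1 : |y / r - round (y / r)| ≤ |y / r - j| := round_le _ _
  have h2 : |y / r - j| = |y - round y| / r := by
    rw [hj, ← abs_of_pos hr, ← abs_div, abs_of_pos hr]
    congr 1
    field_simp
  have h3 : |y / r - round (y / r)| / (η / r) ≤ |y - round y| / η := by
    rw [div_le_div_iff₀ (by positivity) hη]
    rw [h2] at h1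
    calc _ ≤ |y - round y| / r * η := by gcongr
      _ = _ := by ring
  linarith

lemma mul_inv_sqrt_pow_three_le {δ x : ℝ} (hδ : 0 ≤ δ) (hx : 0 < x) :
    δ * (1 / √(x + δ)) ^ 3 ≤ 2 * (1 / √x - 1 / √(x + δ)) := by
  have h1 : 0 < √x := Real.sqrt_pos.2 hx
  have h2 : √x ≤ √(x + δ) := Real.sqrt_le_sqrt (by linarith)
  have h3 : √x ^ 2 = x := Real.sq_sqrt hx.le
  have h4 : √(x + δ) ^ 2 = x + δ := Real.sq_sqrt (by linarith)
  set p := √x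
  set q := √(x + δ)
  have hq : 0 < q := by linarith
  have hd : δ = (q - p) * (q + p) := by nlinarith
  rw [hd, one_div_pow, mul_one_div, div_sub_div _ _ h1.ne' hq.ne', ← mul_div_assoc,
    div_le_div_iff₀ (by positivity) (by positivity)]
  have h5 : 0 ≤ q - p := by linarith
  have h6 : (q + p) * p ≤ 2 * q ^ 2 := by nlinarith
  calc (q - p) * (q + p) * (p * q) = (q - p) * q * ((q + p) * p) := by ring
    _ ≤ (q - p) * q * (2 * q ^ 2) := by gcongr
    _ = _ := by ring

lemma summable_tentCoeff_mul_sqrt {δ : ℝ} (hδ : 0 < δ) (hδ2 : δ ≤ 1 / 2) :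
    Summable (fun k : ℤ => tentCoeff δ k * √(3 + 8 * δ * |(k : ℝ)|)) ∧
      ∑' k : ℤ, tentCoeff δ k * √(3 + 8 * δ * |(k : ℝ)|) ≤ 60 := by
  set f : ℤ → ℝ := fun k => tentCoeff δ k * √(3 + 8 * δ * |(k : ℝ)|) with hf
  set g : ℕ → ℝ := fun n => 12 * (δ * (1 / √(1 + δ * n)) ^ 3) with hg
  have hg0 : ∀ n, 0 ≤ g n := fun n => by positivity
  have hf0 : ∀ k, 0 ≤ f k := fun k => mul_nonneg (tentCoeff_nonneg hδ k) (Real.sqrt_nonneg _)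
  have hfg : ∀ (k : ℤ) (n : ℕ), |(k : ℝ)| = n → f k ≤ g n := by
    intro k n hkn
    simp only [hf, hg]
    have h1 := tentCoeff_le hδ k
    rw [hkn] at h1 ⊢
    have h2 : √(3 + 8 * δ * n) ≤ 3 * √(1 + δ * n) := by
      rw [Real.sqrt_le_left (by positivity), mul_pow, Real.sq_sqrt (by positivity)]
      have : 0 ≤ δ * n := by positivity
      linarith
    have h3 : 0 < √(1 + δ * n) := Real.sqrt_pos.2 (by positivity)
    have h4 : √(1 + δ * n) ^ 2 = 1 + δ * n := Real.sq_sqrt (by positivity)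
    calc tentCoeff δ k * √(3 + 8 * δ * n) ≤ 4 * δ / (1 + δ * n) ^ 2 * (3 * √(1 + δ * n)) := by
          gcongr
      _ = _ := by
          rw [show (1 + δ * n) ^ 2 = (√(1 + δ * n) ^ 2) ^ 2 by rw [h4]]
          generalize √(1 + δ * n) = q at h3
          field_simp
          ring
  have hgs : ∀ K, ∑ n ∈ range K, g n ≤ 30 := by
    intro K
    have : ∀ K : ℕ, ∑ n ∈ range (K + 1), g n ≤ 12 * (δ + 2 * (1 - 1 / √(1 + δ * K))) := by
      intro K
      induction K with
      | zero => simp [hg]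
      | succ K ih =>
        rw [sum_range_succ]
        have h := mul_inv_sqrt_pow_three_le hδ.le (x := 1 + δ * K) (by positivity)
        have e : 1 + δ * K + δ = 1 + δ * ((K + 1 : ℕ) : ℝ) := by push_cast; ring
        rw [e] at h
        have : g (K + 1) ≤ 12 * (2 * (1 / √(1 + δ * K) - 1 / √(1 + δ * ((K + 1 : ℕ) : ℝ)))) := by
          simp only [hg]; gcongr
        linarith
    have h2 : ∑ n ∈ range K, g n ≤ ∑ n ∈ range (K + 1), g n := by
      rw [sum_range_succ]; linarith [hg0 K]
    have h3 : 0 ≤ 1 / √(1 + δ * K) := by positivity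
    linarith [this K]
  have hs1 : ∀ K, ∑ n ∈ range K, f (n : ℤ) ≤ 30 := fun K =>
    (sum_le_sum fun (n : ℕ) _ => hfg (n : ℤ) n (by simp)).trans (hgs K)
  have s1 : Summable (fun n : ℕ => f n) :=
    summable_of_sum_range_le (c := 30) (fun n => hf0 _) hs1
  have hs2 : ∀ K, ∑ n ∈ range K, f (-((n : ℤ) + 1)) ≤ 30 := by
    intro K
    refine (sum_le_sum fun (n : ℕ) _ => hfg (-((n : ℤ) + 1)) (n + 1) ?_).trans ?_
    · push_cast
      rw [abs_neg, abs_of_nonneg (by positivity)]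
    · have := hgs (K + 1)
      rw [sum_range_succ'] at this
      linarith [hg0 0]
  have s2 : Summable (fun n : ℕ => f (-((n : ℤ) + 1))) :=
    summable_of_sum_range_le (c := 30) (fun n => hf0 _) hs2
  refine ⟨Summable.of_nat_of_neg_add_one s1 s2, ?_⟩
  rw [tsum_of_nat_of_neg_add_one s1 s2]
  have t1 : ∑' n : ℕ, f n ≤ 30 := Real.tsum_le_of_sum_range_le (fun n => hf0 _) hs1
  have t2 : ∑' n : ℕ, f (-((n : ℤ) + 1)) ≤ 30 :=
    Real.tsum_le_of_sum_range_le (fun n => hf0 _) hs2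
  linarith

/-- Equidistribution of `a * p ^ c` twisted by `ee (h * p ^ c)`, at the scale of `a`. -/
lemma exists_norm_sum_tent_le {c ω : ℝ} (hc : 1 < c) (hc2 : c ≤ 27 / 26)
    (hω : 0 < ω) (hω2 : ω ≤ 1 / 10) :
    ∃ C : ℝ, 0 < C ∧ ∀ (H h a b : ℝ) (n0 n1 : ℕ), 64 ≤ H → H / 4 ≤ n0 → (n1 : ℝ) ≤ H + 1 →
      |h| ≤ 2 → 2 * H ^ (-1 / 5 : ℝ) ≤ a → a ≤ 1 →
      (h ≠ 0 → ∀ k : ℤ, H ^ (ω - c) ≤ |h + k * a|) →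
      ‖∑ n ∈ Ico n0 n1, (vonMangoldt n : ℂ) * ee (h * (n : ℝ) ^ c)
            * (tent (a / 8) (a * (n : ℝ) ^ c - b) : ℂ)
          - (if h = 0 then (a / 8 : ℂ) * ∑ n ∈ Ico n0 n1, (vonMangoldt n : ℂ) else 0)‖
        ≤ C * Real.log H ^ 2 * (H ^ (12 / 13 : ℝ) + if h = 0 then 0 else a * H ^ (1 - ω / 4)) := by
  obtain ⟨C1, hC1, hE1⟩ := exists_norm_sum_vonMangoldt_le hc hc2
  obtain ⟨C2, hC2, hE2⟩ := exists_norm_sum_vonMangoldt_le_of_small hc hc2 hω hω2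
  refine ⟨60 * C1 + C2, by positivity, ?_⟩
  intro H h a b n0 n1 hH hn0 hn1 hh ha ha1 hres
  have hH0 : 0 < H := by linarith
  have hHp : 0 < H ^ (-1 / 5 : ℝ) := by positivity
  have ha0 : 0 < a := by linarith
  set δ := a / 8 with hδ
  have hδ0 : 0 < δ := by positivity
  have hδ2 : δ ≤ 1 / 2 := by linarith
  set S : ℝ → ℂ := fun X => ∑ n ∈ Ico n0 n1, (vonMangoldt n : ℂ) * ee (X * (n : ℝ) ^ c) with hS
  set G : ℤ → ℂ := fun k => (tentCoeff δ k : ℂ) * ee (-(k * b)) * S (h + k * a) with hG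
  have hGsum : HasSum G (∑ n ∈ Ico n0 n1, (vonMangoldt n : ℂ) * ee (h * (n : ℝ) ^ c)
            * (tent δ (a * (n : ℝ) ^ c - b) : ℂ)) := by
    have h1 : HasSum (fun k : ℤ => ∑ n ∈ Ico n0 n1, (vonMangoldt n : ℂ) * ee (h * (n : ℝ) ^ c)
        * ((tentCoeff δ k : ℂ) * ee (k * (a * (n : ℝ) ^ c - b))))
        (∑ n ∈ Ico n0 n1, (vonMangoldt n : ℂ) * ee (h * (n : ℝ) ^ c)
            * (tent δ (a * (n : ℝ) ^ c - b) : ℂ)) :=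
      hasSum_sum fun n _ => (hasSum_tent hδ0 hδ2 _).mul_left _
    convert h1 using 2 with k
    simp only [hG, hS]
    rw [mul_sum]
    refine sum_congr rfl fun n _ => ?_
    rw [show (h + k * a) * (n : ℝ) ^ c = h * (n : ℝ) ^ c + k * (a * (n : ℝ) ^ c) by ring, ee_add,
      mul_sub, sub_eq_add_neg, ee_add]
    ring
  set Mt : ℂ := if h = 0 then (a / 8 : ℂ) * ∑ n ∈ Ico n0 n1, (vonMangoldt n : ℂ) else 0 with hMt
  have hM := hasSum_ite_eq (0 : ℤ) Mt
  have hGM := hGsum.sub hM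
  obtain ⟨k0, hk0⟩ : ∃ k0 : ℤ, ∀ k : ℤ, |h + k * a| < H ^ (-1 / 5 : ℝ) → k = k0 := by
    by_cases hex : ∃ k0 : ℤ, |h + k0 * a| < H ^ (-1 / 5 : ℝ)
    · obtain ⟨k0, hk0⟩ := hex
      refine ⟨k0, fun k hk => ?_⟩
      by_contra hne
      have h1 : (1:ℝ) ≤ |(k:ℝ) - k0| := by
        have : (1:ℤ) ≤ |k - k0| := Int.one_le_abs (sub_ne_zero.2 hne)
        exact_mod_cast this
      have h2 : |((k:ℝ) - k0) * a| ≤ |h + k * a| + |h + k0 * a| := by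
        rw [show ((k:ℝ) - k0) * a = (h + k * a) - (h + k0 * a) by ring]
        exact abs_sub _ _
      rw [abs_mul, abs_of_pos ha0] at h2
      nlinarith
    · push Not at hex
      exact ⟨0, fun k hk => absurd hk (not_lt.2 (hex k))⟩
  set B1 := C1 * Real.log H ^ 2 * H ^ (12 / 13 : ℝ) with hB1
  set B2 := if h = 0 then 0 else C2 * Real.log H ^ 2 * H ^ (1 - ω / 4) * a with hB2
  have hB10 : 0 ≤ B1 := by positivity
  have hB20 : 0 ≤ B2 := by rw [hB2]; split_ifs <;> positivity
  obtain ⟨hs1, hs2⟩ := summable_tentCoeff_mul_sqrt hδ0 hδ2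
  have hbd := (hs1.hasSum.mul_left B1).add (hasSum_ite_eq k0 B2)
  have hle : ∀ k : ℤ, ‖G k - (if k = 0 then Mt else 0)‖
      ≤ B1 * (tentCoeff δ k * √(3 + 8 * δ * |(k : ℝ)|)) + (if k = k0 then B2 else 0) := by
    intro k
    have hr0 : 0 ≤ B1 * (tentCoeff δ k * √(3 + 8 * δ * |(k : ℝ)|)) :=
      mul_nonneg hB10 (mul_nonneg (tentCoeff_nonneg hδ0 k) (Real.sqrt_nonneg _))
    have hr1 : 0 ≤ (if k = k0 then B2 else 0) := by split_ifs <;> simp [hB20]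
    by_cases h00 : k = 0 ∧ h = 0
    · obtain ⟨rfl, rfl⟩ := h00
      have : G 0 - (if (0:ℤ) = 0 then Mt else 0) = 0 := by
        rw [if_pos rfl, hMt, if_pos rfl, hG]
        simp [tentCoeff_zero, ee_zero, hS, hδ]
      rw [this, norm_zero]
      positivity
    · have e1 : (if k = 0 then Mt else 0) = 0 := by
        split_ifs with hk
        · rw [hMt, if_neg fun h0 => h00 ⟨hk, h0⟩]
        · rfl
      have e2 : ‖G k‖ = tentCoeff δ k * ‖S (h + k * a)‖ := by
        simp only [hG]
        rw [norm_mul, norm_mul, norm_ee, Complex.norm_real, Real.norm_eq_abs,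
          abs_of_nonneg (tentCoeff_nonneg hδ0 k), mul_one]
      rw [e1, sub_zero, e2]
      by_cases hX : H ^ (-1 / 5 : ℝ) ≤ |h + k * a|
      · have h1 := hE1 H (h + k * a) n0 n1 hH hX hn0 hn1
        have h2 : √(1 + |h + k * a|) ≤ √(3 + 8 * δ * |(k : ℝ)|) := by
          apply Real.sqrt_le_sqrt
          have := abs_add_le h (k * a)
          rw [abs_mul, abs_of_pos ha0] at this
          rw [hδ]
          linarith
        have h3 : ‖S (h + k * a)‖ ≤ B1 * √(3 + 8 * δ * |(k : ℝ)|) := by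
          refine h1.trans ?_
          rw [hB1]
          gcongr
        calc _ ≤ tentCoeff δ k * (B1 * √(3 + 8 * δ * |(k : ℝ)|)) :=
              mul_le_mul_of_nonneg_left h3 (tentCoeff_nonneg hδ0 k)
          _ = B1 * (tentCoeff δ k * √(3 + 8 * δ * |(k : ℝ)|)) := by ring
          _ ≤ _ := by linarith
      · push Not at hX
        have hk := hk0 k hX
        have hh0 : h ≠ 0 := by
          rintro rfl
          have hk1 : k ≠ 0 := fun hk1 => h00 ⟨hk1, rfl⟩
          have h1 : (1:ℝ) ≤ |(k:ℝ)| := by exact_mod_cast Int.one_le_abs hk1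
          rw [zero_add, abs_mul, abs_of_pos ha0] at hX
          nlinarith
        have h1 := hE2 H (h + k * a) n0 n1 hH (hres hh0 k) hX.le hn0 hn1
        have h2 : tentCoeff δ k ≤ a := by
          refine (tentCoeff_le hδ0 k).trans ?_
          rw [div_le_iff₀ (by positivity)]
          have : 1 ≤ (1 + δ * |(k:ℝ)|) ^ 2 := one_le_pow₀ (by
            have : 0 ≤ δ * |(k:ℝ)| := by positivity
            linarith)
          rw [hδ] at this ⊢
          nlinarith
        rw [if_pos hk, hB2, if_neg hh0]
        calc tentCoeff δ k * ‖S (h + k * a)‖ ≤ a * (C2 * Real.log H ^ 2 * H ^ (1 - ω / 4)) := by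
              gcongr
          _ = C2 * Real.log H ^ 2 * H ^ (1 - ω / 4) * a := by ring
          _ ≤ _ := by linarith
  have hfin := tsum_of_norm_bounded hbd hle
  rw [hGM.tsum_eq] at hfin
  refine hfin.trans ?_
  have hL : 0 ≤ Real.log H ^ 2 := by positivity
  have h1 : B1 * ∑' k : ℤ, tentCoeff δ k * √(3 + 8 * δ * |(k : ℝ)|) ≤ B1 * 60 := by gcongr
  have hq : 0 ≤ Real.log H ^ 2 * H ^ (12 / 13 : ℝ) := by positivity
  have hq2 : 0 ≤ Real.log H ^ 2 * (a * H ^ (1 - ω / 4)) := by positivity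
  by_cases hh0 : h = 0
  · rw [hB2, if_pos hh0, if_pos hh0]
    rw [hB1] at h1 ⊢
    nlinarith
  · rw [hB2, if_neg hh0, if_neg hh0]
    rw [hB1] at h1 ⊢
    nlinarith

lemma exists_sum_tent_le {c : ℝ} (hc : 1 < c) (hc2 : c ≤ 27 / 26) :
    ∃ C : ℝ, 0 < C ∧ ∀ (H a b : ℝ) (n0 n1 : ℕ), 64 ≤ H → H / 4 ≤ n0 → (n1 : ℝ) ≤ H + 1 →
      H ^ (-1 / 5 : ℝ) ≤ a → a ≤ 1 →
      ∑ n ∈ Ico n0 n1, tent (a / 4) (a * (n : ℝ) ^ c - b) ≤ a * H + C * H ^ (3 / 5 : ℝ) := by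
  obtain ⟨C, hC, hsum⟩ := exists_norm_sum_ee_rpow_le hc (by linarith) (κ := 4) (by norm_num)
  refine ⟨120 * C, by positivity, ?_⟩
  intro H a b n0 n1 hH hn0 hn1 ha ha1
  have hH0 : 0 < H := by linarith
  have hH1 : 1 ≤ H := by linarith
  have ha0 : 0 < a := lt_of_lt_of_le (by positivity) ha
  set δ := a / 4 with hδ
  have hδ0 : 0 < δ := by positivity
  have hδ2 : δ ≤ 1 / 2 := by linarith
  set S : ℤ → ℂ := fun k => ∑ n ∈ Ico n0 n1, ee (k * a * (n : ℝ) ^ c) with hS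
  set G : ℤ → ℂ := fun k => (tentCoeff δ k : ℂ) * ee (-(k * b)) * S k with hG
  have hGsum : HasSum G (∑ n ∈ Ico n0 n1, (tent δ (a * (n : ℝ) ^ c - b) : ℂ)) := by
    have h1 : HasSum (fun k : ℤ => ∑ n ∈ Ico n0 n1,
        ((tentCoeff δ k : ℂ) * ee (k * (a * (n : ℝ) ^ c - b))))
        (∑ n ∈ Ico n0 n1, (tent δ (a * (n : ℝ) ^ c - b) : ℂ)) :=
      hasSum_sum fun n _ => hasSum_tent hδ0 hδ2 _
    convert h1 using 2 with k
    simp only [hG, hS]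
    rw [mul_sum]
    refine sum_congr rfl fun n _ => ?_
    rw [mul_sub, sub_eq_add_neg, ee_add, ← mul_assoc (k : ℝ)]
    ring
  set Mt : ℂ := (δ : ℂ) * S 0 with hMt
  have hGM := hGsum.sub (hasSum_ite_eq (0 : ℤ) Mt)
  set B1 := 2 * C * H ^ (3 / 5 : ℝ) with hB1
  have hB10 : 0 ≤ B1 := by positivity
  obtain ⟨hs1, hs2⟩ := summable_tentCoeff_mul_sqrt hδ0 hδ2
  have hbd := hs1.hasSum.mul_left B1
  have hle : ∀ k : ℤ, ‖G k - (if k = 0 then Mt else 0)‖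
      ≤ B1 * (tentCoeff δ k * √(3 + 8 * δ * |(k : ℝ)|)) := by
    intro k
    have hr0 : 0 ≤ B1 * (tentCoeff δ k * √(3 + 8 * δ * |(k : ℝ)|)) :=
      mul_nonneg hB10 (mul_nonneg (tentCoeff_nonneg hδ0 k) (Real.sqrt_nonneg _))
    by_cases hk : k = 0
    · subst hk
      have : G 0 - (if (0:ℤ) = 0 then Mt else 0) = 0 := by
        rw [if_pos rfl, hMt, hG]
        simp [tentCoeff_zero, ee_zero]
      rw [this, norm_zero]
      exact hr0
    · have e2 : ‖G k‖ = tentCoeff δ k * ‖S k‖ := by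
        simp only [hG]
        rw [norm_mul, norm_mul, norm_ee, Complex.norm_real, Real.norm_eq_abs,
          abs_of_nonneg (tentCoeff_nonneg hδ0 k), mul_one]
      rw [if_neg hk, sub_zero, e2]
      have hk0 : (k : ℝ) ≠ 0 := by exact_mod_cast hk
      have hk1 : (1:ℝ) ≤ |(k:ℝ)| := by exact_mod_cast Int.one_le_abs hk
      have h1 := hsum (H / 4) (k * a) n0 n1 (by linarith) (by positivity) (by
        intro n hn
        rw [mem_Ico] at hn
        have h3 : (n0 : ℝ) ≤ n := by exact_mod_cast hn.1
        have h4 : (n : ℝ) + 1 ≤ n1 := by exact_mod_cast hn.2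
        exact ⟨by linarith, by linarith⟩)
      set Z := |(k:ℝ) * a| * (H / 4) ^ c with hZ
      have hka : |(k:ℝ) * a| = |(k:ℝ)| * a := by rw [abs_mul, abs_of_pos ha0]
      have hZ1 : √Z ≤ √(3 + 8 * δ * |(k : ℝ)|) * H ^ (3 / 5 : ℝ) := by
        rw [Real.sqrt_le_left (by positivity), mul_pow, Real.sq_sqrt (by positivity),
          ← Real.rpow_natCast, ← Real.rpow_mul hH0.le, hZ, hka]
        have : (H / 4) ^ c ≤ H ^ (3 / 5 * ((2:ℕ):ℝ) : ℝ) := by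
          calc (H / 4) ^ c ≤ H ^ c := by gcongr; linarith
            _ ≤ _ := Real.rpow_le_rpow_of_exponent_le hH1 (by norm_num; linarith)
        have h5 : |(k:ℝ)| * a ≤ 3 + 8 * δ * |(k : ℝ)| := by
          rw [hδ]
          have : 0 ≤ |(k:ℝ)| * a := by positivity
          linarith
        gcongr
      have hZ2 : H ^ (4 / 5 : ℝ) / 4 ≤ Z := by
        have h5 : H / 4 ≤ (H / 4) ^ c := by
          calc H / 4 = (H / 4) ^ (1:ℝ) := (Real.rpow_one _).symm
            _ ≤ _ := Real.rpow_le_rpow_of_exponent_le (by linarith) hc.le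
        calc H ^ (4 / 5 : ℝ) / 4 = H ^ (-1 / 5 : ℝ) * (H ^ (1:ℝ) / 4) := by
              rw [← mul_div_assoc, ← Real.rpow_add hH0]; norm_num
          _ = 1 * H ^ (-1 / 5 : ℝ) * (H / 4) := by rw [Real.rpow_one, one_mul]
          _ ≤ Z := by rw [hZ, hka]; gcongr
      have hZ3 : H ^ (2 / 5 : ℝ) / 2 ≤ √Z := by
        apply Real.le_sqrt_of_sq_le
        rw [div_pow, ← Real.rpow_natCast, ← Real.rpow_mul hH0.le]
        convert hZ2 using 2 <;> norm_num
      have hZ4 : H / 4 / √Z ≤ H ^ (3 / 5 : ℝ) := by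
        calc H / 4 / √Z ≤ H / 4 / (H ^ (2 / 5 : ℝ) / 2) := by gcongr
          _ = (H ^ (1:ℝ) / H ^ (2 / 5 : ℝ)) / 2 := by rw [Real.rpow_one]; field_simp; norm_num
          _ = H ^ (3 / 5 : ℝ) / 2 := by rw [← Real.rpow_sub hH0]; norm_num
          _ ≤ _ := half_le_self (by positivity)
      have h6 : (1:ℝ) ≤ √(3 + 8 * δ * |(k : ℝ)|) := by
        rw [Real.one_le_sqrt]
        have : 0 ≤ 8 * δ * |(k:ℝ)| := by positivity
        linarith
      have h7 : ‖S k‖ ≤ B1 * √(3 + 8 * δ * |(k : ℝ)|) := by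
        refine h1.trans ?_
        have h8 : H ^ (3 / 5 : ℝ) ≤ √(3 + 8 * δ * |(k : ℝ)|) * H ^ (3 / 5 : ℝ) :=
          le_mul_of_one_le_left (by positivity) h6
        calc C * (√Z + H / 4 / √Z) ≤ C * (√(3 + 8 * δ * |(k : ℝ)|) * H ^ (3 / 5 : ℝ)
              + √(3 + 8 * δ * |(k : ℝ)|) * H ^ (3 / 5 : ℝ)) := by
              gcongr; exact hZ4.trans h8
          _ = _ := by rw [hB1]; ring
      calc _ ≤ tentCoeff δ k * (B1 * √(3 + 8 * δ * |(k : ℝ)|)) :=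
            mul_le_mul_of_nonneg_left h7 (tentCoeff_nonneg hδ0 k)
        _ = _ := by ring
  have hfin := tsum_of_norm_bounded hbd hle
  rw [hGM.tsum_eq] at hfin
  have h1 : B1 * ∑' k : ℤ, tentCoeff δ k * √(3 + 8 * δ * |(k : ℝ)|) ≤ B1 * 60 := by gcongr
  have hS0 : S 0 = ((n1 - n0 : ℕ) : ℂ) := by
    simp [hS, ee_zero]
  have e : (∑ n ∈ Ico n0 n1, (tent δ (a * (n : ℝ) ^ c - b) : ℂ)) - Mt
      = ((∑ n ∈ Ico n0 n1, tent δ (a * (n : ℝ) ^ c - b) - δ * ((n1 - n0 : ℕ) : ℝ) : ℝ) : ℂ) := by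
    rw [hMt, hS0]; push_cast; rfl
  rw [e, Complex.norm_real, Real.norm_eq_abs] at hfin
  have h2 := (le_abs_self _).trans (hfin.trans h1)
  have h3 : ((n1 - n0 : ℕ) : ℝ) ≤ 2 * H := by
    calc ((n1 - n0 : ℕ) : ℝ) ≤ n1 := by exact_mod_cast Nat.sub_le _ _
      _ ≤ _ := by linarith
  have h4 : δ * ((n1 - n0 : ℕ) : ℝ) ≤ δ * (2 * H) := by gcongr
  have h5 : 0 ≤ a * H := by positivity
  rw [hδ] at h4 h2
  rw [hB1] at h2
  linarith

lemma sum_Ioc_inv_sq_le {D : ℝ} (hD : 1 ≤ D) (M : ℕ) :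
    ∑ d ∈ Ioc ⌊D⌋₊ M, 1 / ((d : ℝ) ^ 2) ≤ 2 / D := by
  have h1 : (1:ℝ) ≤ ⌊D⌋₊ := by
    have := Nat.floor_pos.2 hD
    exact_mod_cast this
  have hf := half_le_floor hD
  have hD0 : 0 < D := by linarith
  rcases le_total ⌊D⌋₊ M with h | h
  · have h2 := sum_Ioc_inv_sq_le_sub (α := ℝ) (k := ⌊D⌋₊) (n := M)
      (by have := Nat.floor_pos.2 hD; omega) h
    simp only [one_div]
    refine h2.trans ?_
    have h3 : (0:ℝ) ≤ (M:ℝ)⁻¹ := by positivity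
    have h4 : ((⌊D⌋₊:ℝ))⁻¹ ≤ (D / 2)⁻¹ := by gcongr
    rw [inv_div] at h4
    linarith
  · rw [Ioc_eq_empty_of_le h, sum_empty]
    positivity

lemma sub_le_rpow_sub_rpow {c x y : ℝ} (hc : 1 ≤ c) (hx : 1 ≤ x) (hxy : x ≤ y) :
    y - x ≤ y ^ c - x ^ c := by
  rcases eq_or_lt_of_le hxy with rfl | h
  · simp
  · obtain ⟨ξ, hξ, h2⟩ := rpow_mvt c (by linarith) h
    rw [h2]
    have h3 : 1 ≤ ξ ^ (c - 1) := Real.one_le_rpow (by linarith [hξ.1]) (by linarith)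
    have h4 : 1 ≤ c * ξ ^ (c - 1) := by nlinarith
    nlinarith

lemma eq_of_near_rpow {c α X : ℝ} (hc : 1 ≤ c) (hα : 0 < α) {n n' : ℕ} {m : ℝ} (hn : 1 ≤ n)
    (hn' : 1 ≤ n') (h : |m - (X - α * (n : ℝ) ^ c)| ≤ α / 8)
    (h' : |m - (X - α * (n' : ℝ) ^ c)| ≤ α / 8) : n = n' := by
  wlog hlt : n ≤ n' generalizing n n'
  · exact (this hn' hn h' h (by omega)).symm
  by_contra hne
  have h1 : (n : ℝ) + 1 ≤ n' := by
    have : n + 1 ≤ n' := by omega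
    exact_mod_cast this
  have h2 := sub_le_rpow_sub_rpow hc (x := n) (y := n') (by exact_mod_cast hn) (by linarith)
  rw [abs_le] at h h'
  nlinarith

open scoped Classical in
/-- The `n` in `[n0, n1)` such that `X - α n ^ c` lies within `α / 8` of a natural number with
property `P`. -/
noncomputable def near (c α X : ℝ) (n0 n1 : ℕ) (P : ℕ → Prop) : Finset ℕ :=
  (Ico n0 n1).filter fun n => ∃ m : ℕ, P m ∧ |(m : ℝ) - (X - α * (n : ℝ) ^ c)| ≤ α / 8

lemma mem_near {c α X : ℝ} {n0 n1 : ℕ} {P : ℕ → Prop} {n : ℕ} : n ∈ near c α X n0 n1 P ↔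
    n ∈ Ico n0 n1 ∧ ∃ m : ℕ, P m ∧ |(m : ℝ) - (X - α * (n : ℝ) ^ c)| ≤ α / 8 := by
  simp [near]

lemma card_near_multiple_le_tent {c : ℝ} (hc : 1 < c) (hc2 : c ≤ 27 / 26) :
    ∃ C : ℝ, 0 < C ∧ ∀ (H α X : ℝ) (d n0 n1 : ℕ), 64 ≤ H → H / 4 ≤ n0 → (n1 : ℝ) ≤ H + 1 →
      H ^ (-1 / 5 : ℝ) ≤ α / (d : ℝ) ^ 2 → 1 ≤ d → α ≤ 1 →
      (#(near c α X n0 n1 fun m => d ^ 2 ∣ m) : ℝ)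
        ≤ 2 * (α / (d : ℝ) ^ 2 * H) + C * H ^ (3 / 5 : ℝ) := by
  obtain ⟨C, hC, hs⟩ := exists_sum_tent_le hc hc2
  refine ⟨2 * C, by positivity, ?_⟩
  intro H α X d n0 n1 hH hn0 hn1 ha hd hα
  have hd1 : (1:ℝ) ≤ (d:ℝ) := by exact_mod_cast hd
  have hd2 : (1:ℝ) ≤ (d:ℝ) ^ 2 := one_le_pow₀ hd1
  have hpos : 0 < α / (d:ℝ) ^ 2 := lt_of_lt_of_le (Real.rpow_pos_of_pos (by linarith) _) ha
  have hα0 : 0 < α := by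
    by_contra h
    have := div_nonpos_of_nonpos_of_nonneg (not_lt.1 h) (by positivity : (0:ℝ) ≤ (d:ℝ)^2)
    linarith
  have h1 := hs H (α / (d:ℝ) ^ 2) (X / (d:ℝ) ^ 2) n0 n1 hH hn0 hn1 ha
    ((div_le_one (by positivity)).2 (hα.trans hd2))
  have h2 : (#(near c α X n0 n1 fun m => d ^ 2 ∣ m) : ℝ)
      ≤ 2 * ∑ n ∈ Ico n0 n1, tent (α / (d:ℝ) ^ 2 / 4)
        (α / (d:ℝ) ^ 2 * (n : ℝ) ^ c - X / (d:ℝ) ^ 2) := by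
    rw [near, card_filter, mul_sum]
    push_cast
    refine sum_le_sum fun n _ => ?_
    split_ifs with h
    · obtain ⟨m, ⟨e, rfl⟩, hm⟩ := h
      set y := α / (d:ℝ) ^ 2 * (n : ℝ) ^ c - X / (d:ℝ) ^ 2 with hy
      have h3 : |y - round y| ≤ α / (d:ℝ) ^ 2 / 8 := by
        refine (round_le y (-(e:ℤ))).trans ?_
        have : y - ((-(e:ℤ) : ℤ) : ℝ)
            = (((d ^ 2 * e : ℕ) : ℝ) - (X - α * (n : ℝ) ^ c)) / (d:ℝ) ^ 2 := by
          rw [hy]; push_cast; field_simp; ring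
        rw [this, abs_div, abs_of_pos (by positivity : (0:ℝ) < (d:ℝ) ^ 2), div_right_comm]
        gcongr
      have h4 : |y - round y| / (α / (d:ℝ) ^ 2 / 4) ≤ 1 / 2 := by
        rw [div_le_iff₀ (by positivity)]
        linarith
      have h5 : 1 - |y - round y| / (α / (d:ℝ) ^ 2 / 4) ≤ tent (α / (d:ℝ) ^ 2 / 4) y :=
        le_max_right _ _
      linarith
    · have := tent_nonneg (α / (d:ℝ) ^ 2 / 4) (α / (d:ℝ) ^ 2 * (n : ℝ) ^ c - X / (d:ℝ) ^ 2)
      linarith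
  linarith

lemma card_near_multiple_le {c H α X : ℝ} (hc : 1 ≤ c) (hα : 0 < α) (hα1 : α ≤ 1)
    (hH0 : 0 ≤ H) (d n0 n1 : ℕ) (hn0 : 1 ≤ n0) (hn1 : (n1 : ℝ) ≤ H + 1) (hd : 1 ≤ d) :
    (#(near c α X n0 n1 fun m => d ^ 2 ∣ m) : ℝ)
        ≤ (α * H ^ c + 1) / (d : ℝ) ^ 2 + 1 := by
  have hd1 : (1:ℝ) ≤ (d:ℝ) := by exact_mod_cast hd
  have hd0 : (0:ℝ) < (d:ℝ) ^ 2 := by positivity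
  rcases Nat.lt_or_ge n0 n1 with hlt | hge
  swap
  · rw [near, Ico_eq_empty_of_le hge, filter_empty, card_empty]
    push_cast
    positivity
  have hH : (1:ℝ) ≤ H := by
    have : (n0:ℝ) + 1 ≤ n1 := by exact_mod_cast hlt
    have : (1:ℝ) ≤ n0 := by exact_mod_cast hn0
    linarith
  set S := near c α X n0 n1 fun m => d ^ 2 ∣ m with hS
  have hex : ∀ n ∈ S, ∃ e : ℤ, |((d:ℝ) ^ 2 * e) - (X - α * (n : ℝ) ^ c)| ≤ α / 8 := by
    intro n hn
    obtain ⟨m, ⟨e, rfl⟩, hm⟩ := (mem_near.1 hn).2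
    exact ⟨e, by push_cast at hm ⊢; exact hm⟩
  choose! f hf using hex
  set A := (X - α * H ^ c - α / 8) / (d:ℝ) ^ 2
  set B := (X + α / 8) / (d:ℝ) ^ 2
  have h1 : #S ≤ #(Icc ⌈A⌉ ⌊B⌋) := by
    refine card_le_card_of_injOn f ?_ ?_
    · intro n hn
      have hn' := mem_Ico.1 (mem_near.1 hn).1
      have h3 : (n:ℝ) + 1 ≤ n1 := by exact_mod_cast hn'.2
      have h4 : (n:ℝ) ^ c ≤ H ^ c := by gcongr; linarith
      have h5 : (0:ℝ) ≤ (n:ℝ) ^ c := by positivity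
      have h6 := abs_le.1 (hf n hn)
      have h7 : α * (n:ℝ) ^ c ≤ α * H ^ c := by gcongr
      have h8 : 0 ≤ α * (n:ℝ) ^ c := by positivity
      rw [coe_Icc, Set.mem_Icc, Int.ceil_le, Int.le_floor, div_le_iff₀ hd0, le_div_iff₀ hd0]
      constructor <;> linarith
    · intro n hn n' hn' he
      have h3 := (mem_Ico.1 (mem_near.1 hn).1).1
      have h4 := (mem_Ico.1 (mem_near.1 hn').1).1
      refine eq_of_near_rpow hc hα (by omega) (by omega) (hf n hn) ?_
      rw [he]
      exact hf n' hn'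
  have h2 : (#(Icc ⌈A⌉ ⌊B⌋) : ℝ) ≤ (α * H ^ c + 1) / (d : ℝ) ^ 2 + 1 := by
    rw [Int.card_Icc]
    have h3 : B - A ≤ (α * H ^ c + 1) / (d : ℝ) ^ 2 := by
      rw [← sub_div]
      gcongr
      linarith
    have h4 : ((⌊B⌋ + 1 - ⌈A⌉).toNat : ℝ) ≤ max (B - A + 1) 0 := by
      have : (((⌊B⌋ + 1 - ⌈A⌉).toNat : ℤ) : ℝ) = ((max (⌊B⌋ + 1 - ⌈A⌉) 0 : ℤ) : ℝ) := by
        rw [Int.toNat_eq_max]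
      rw [Int.cast_natCast] at this
      rw [this]
      push_cast
      gcongr
      · linarith [Int.floor_le B, Int.le_ceil A]
    refine h4.trans (max_le (by linarith) (by positivity))
  exact (Nat.cast_le.2 h1).trans h2

lemma card_near_large_square_le {c H α X y : ℝ} (hc : 1 ≤ c) (hα : 0 < α) (hα1 : α ≤ 1)
    (hH : 64 ≤ H) (hαH : α * H ^ c ≤ H) (hX : |X - H ^ 2| ≤ 2) (hy : 0 < y)
    (n0 n1 : ℕ) (hn0 : 1 ≤ n0) (hn1 : (n1 : ℝ) ≤ H + 1) :
    (#(near c α X n0 n1 fun m => ∃ d : ℕ, y < d ∧ d ^ 2 ∣ m) : ℝ) ≤ 2 * H ^ 2 / y ^ 2 := by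
  set S := near c α X n0 n1 fun m => ∃ d : ℕ, y < d ∧ d ^ 2 ∣ m with hS
  have hex : ∀ n ∈ S, ∃ e d : ℕ, y < d ∧
      |((d:ℝ) ^ 2 * e) - (X - α * (n : ℝ) ^ c)| ≤ α / 8 := by
    intro n hn
    obtain ⟨m, ⟨d, hd, ⟨e, rfl⟩⟩, hm⟩ := (mem_near.1 hn).2
    exact ⟨e, d, hd, by push_cast at hm ⊢; exact hm⟩
  choose! f g hg hf using hex
  rw [abs_le] at hX
  have hb : ∀ n ∈ S, H ^ 2 - H - 3 ≤ (g n : ℝ) ^ 2 * f n ∧ (g n : ℝ) ^ 2 * f n ≤ H ^ 2 + 3 := by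
    intro n hn
    have hn' := mem_Ico.1 (mem_near.1 hn).1
    have h3 : (n:ℝ) + 1 ≤ n1 := by exact_mod_cast hn'.2
    have h4 : (n:ℝ) ^ c ≤ H ^ c := by gcongr; linarith
    have h6 := abs_le.1 (hf n hn)
    have h7 : α * (n:ℝ) ^ c ≤ α * H ^ c := by gcongr
    have h8 : 0 ≤ α * (n:ℝ) ^ c := by positivity
    constructor <;> linarith
  have hf1 : ∀ n ∈ S, 1 ≤ f n := by
    intro n hn
    by_contra h
    have h0 : f n = 0 := by omega
    have := (hb n hn).1
    rw [h0] at this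
    norm_num at this
    nlinarith
  have hgf : ∀ n ∈ S, 0.7 * H ≤ (g n : ℝ) * f n := by
    intro n hn
    have h1 : (1:ℝ) ≤ f n := by exact_mod_cast hf1 n hn
    have h2 := (hb n hn).1
    refine le_of_sq_le_sq ?_ (by positivity)
    have h3 : (0:ℝ) ≤ (g n : ℝ) ^ 2 * f n := by positivity
    have h4 : ((g n : ℝ) * f n) ^ 2 = (g n : ℝ) ^ 2 * f n * f n := by ring
    rw [h4]
    nlinarith
  have h1 : #S ≤ #(Icc 1 ⌊2 * H ^ 2 / y ^ 2⌋₊) := by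
    refine card_le_card_of_injOn f ?_ ?_
    · intro n hn
      rw [coe_Icc, Set.mem_Icc]
      refine ⟨hf1 n hn, Nat.le_floor ?_⟩
      rw [le_div_iff₀ (by positivity)]
      have h2 := (hb n hn).2
      have h3 : y ^ 2 ≤ (g n : ℝ) ^ 2 := by
        have := (hg n hn).le
        gcongr
      have h4 : (f n : ℝ) * y ^ 2 ≤ f n * (g n : ℝ) ^ 2 := by gcongr
      nlinarith
    · intro n hn n' hn' he
      have h3 := (mem_Ico.1 (mem_near.1 hn).1).1
      have h4 := (mem_Ico.1 (mem_near.1 hn').1).1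
      have key : g n = g n' := by
        by_contra hne
        have a1 := hgf n hn
        have a2 := hgf n' hn'
        have b1 := hb n hn
        have b2 := hb n' hn'
        rw [he] at a1 b1
        have hf0 : (0:ℝ) ≤ f n' := by positivity
        rcases lt_or_gt_of_ne hne with h | h
        · have h5 : (g n : ℝ) + 1 ≤ g n' := by exact_mod_cast h
          nlinarith [mul_nonneg hf0 (mul_nonneg (sub_nonneg.2 h5)
            (by positivity : (0:ℝ) ≤ (g n:ℝ) + g n'))]
        · have h5 : (g n' : ℝ) + 1 ≤ g n := by exact_mod_cast h
          nlinarith [mul_nonneg hf0 (mul_nonneg (sub_nonneg.2 h5)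
            (by positivity : (0:ℝ) ≤ (g n:ℝ) + g n'))]
      refine eq_of_near_rpow hc hα (by omega) (by omega) (hf n hn) ?_
      rw [he, key]
      exact hf n' hn'
  rw [Nat.card_Icc, Nat.add_sub_cancel] at h1
  exact (Nat.cast_le.2 h1).trans (Nat.floor_le (by positivity))

lemma exists_card_near_square_le {c : ℝ} (hc : 1 < c) (hc2 : c ≤ 27 / 26) :
    ∃ C : ℝ, 0 < C ∧ ∀ (H α X D : ℝ) (n0 n1 : ℕ), 64 ≤ H → H / 4 ≤ n0 → (n1 : ℝ) ≤ H + 1 →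
      H ^ (-1 / 12 : ℝ) ≤ α → α ≤ 1 → α * H ^ c ≤ H → |X - H ^ 2| ≤ 2 →
      1 ≤ D → D ≤ H ^ (1 / 200 : ℝ) →
      (#(near c α X n0 n1 fun m => ∃ d : ℕ, D < d ∧ d ^ 2 ∣ m) : ℝ) ≤ C * (α * H / D) := by
  obtain ⟨C, hC, hs⟩ := card_near_multiple_le_tent hc hc2
  refine ⟨C + 11, by positivity, ?_⟩
  intro H α X D n0 n1 hH hn0 hn1 hα hα1 hαH hX hD hDH
  have hH0 : 0 < H := by linarith
  have hH1 : 1 ≤ H := by linarith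
  have hα0 : 0 < α := lt_of_lt_of_le (by positivity) hα
  have hD0 : 0 < D := by linarith
  have hn01 : 1 ≤ n0 := by
    have : (1:ℝ) ≤ n0 := by linarith
    exact_mod_cast this
  set M1 := ⌊H ^ (1 / 20 : ℝ)⌋₊
  set M2 := ⌊H ^ (3 / 5 : ℝ)⌋₊
  have hM1 : (M1 : ℝ) ≤ H ^ (1 / 20 : ℝ) := Nat.floor_le (by positivity)
  have hM2 : (M2 : ℝ) ≤ H ^ (3 / 5 : ℝ) := Nat.floor_le (by positivity)
  set S : ℕ → Finset ℕ := fun d => near c α X n0 n1 fun m => d ^ 2 ∣ m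
  set L := near c α X n0 n1 fun m => ∃ d : ℕ, H ^ (3 / 5 : ℝ) < d ∧ d ^ 2 ∣ m
  have hsub : (near c α X n0 n1 fun m => ∃ d : ℕ, D < d ∧ d ^ 2 ∣ m) ⊆
      (Ioc ⌊D⌋₊ M1).biUnion S ∪ ((Ioc M1 M2).biUnion S ∪ L) := by
    intro n hn
    obtain ⟨hn1, m, ⟨d, hd, hdm⟩, hm⟩ := mem_near.1 hn
    have hd1 : ⌊D⌋₊ < d := (Nat.floor_lt hD0.le).2 hd
    simp only [mem_union, mem_biUnion, mem_Ioc]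
    rcases Nat.lt_or_ge M1 d with h1 | h1
    · rcases Nat.lt_or_ge M2 d with h2 | h2
      · exact Or.inr (Or.inr (mem_near.2 ⟨hn1, m, ⟨d, (Nat.floor_lt (by positivity)).1 h2, hdm⟩, hm⟩))
      · exact Or.inr (Or.inl ⟨d, ⟨h1, h2⟩, mem_near.2 ⟨hn1, m, hdm, hm⟩⟩)
    · exact Or.inl ⟨d, ⟨hd1, h1⟩, mem_near.2 ⟨hn1, m, hdm, hm⟩⟩
  have hcard := (card_le_card hsub).trans ((card_union_le _ _).trans
    (add_le_add card_biUnion_le ((card_union_le _ _).trans (add_le_add_left card_biUnion_le _))))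
  have hcard' : (#(near c α X n0 n1 fun m => ∃ d : ℕ, D < d ∧ d ^ 2 ∣ m) : ℝ) ≤
      ∑ d ∈ Ioc ⌊D⌋₊ M1, (#(S d) : ℝ) + (∑ d ∈ Ioc M1 M2, (#(S d) : ℝ) + #L) := by
    exact_mod_cast hcard
  have hmain : H ^ (9 / 10 : ℝ) ≤ α * H / D := by
    rw [le_div_iff₀ hD0]
    calc H ^ (9 / 10 : ℝ) * D ≤ H ^ (9 / 10 : ℝ) * H ^ (1 / 200 : ℝ) := by gcongr
      _ = H ^ (181 / 200 : ℝ) := by rw [← Real.rpow_add hH0]; norm_num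
      _ ≤ H ^ (-1 / 12 + 1 : ℝ) := Real.rpow_le_rpow_of_exponent_le hH1 (by norm_num)
      _ = H ^ (-1 / 12 : ℝ) * H := by rw [Real.rpow_add hH0, Real.rpow_one]
      _ ≤ α * H := by gcongr
  have hpw : ∀ p : ℝ, p ≤ 9 / 10 → H ^ p ≤ α * H / D := fun p hp =>
    (Real.rpow_le_rpow_of_exponent_le hH1 hp).trans hmain
  have b1 : ∑ d ∈ Ioc ⌊D⌋₊ M1, (#(S d) : ℝ) ≤ (C + 4) * (α * H / D) := by
    calc ∑ d ∈ Ioc ⌊D⌋₊ M1, (#(S d) : ℝ)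
        ≤ ∑ d ∈ Ioc ⌊D⌋₊ M1, (2 * (α * H) * (1 / (d : ℝ) ^ 2) + C * H ^ (3 / 5 : ℝ)) := by
          refine sum_le_sum fun d hd => ?_
          rw [mem_Ioc] at hd
          have hd1 : (1:ℝ) ≤ d := by
            have : 1 ≤ d := by omega
            exact_mod_cast this
          have hd2 : (d:ℝ) ≤ H ^ (1 / 20 : ℝ) :=
            le_trans (by exact_mod_cast hd.2) hM1
          refine (hs H α X d n0 n1 hH hn0 hn1 ?_ (by omega) hα1).trans (le_of_eq (by ring))
          rw [le_div_iff₀ (by positivity)]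
          calc H ^ (-1 / 5 : ℝ) * (d:ℝ) ^ 2 ≤ H ^ (-1 / 5 : ℝ) * (H ^ (1 / 20 : ℝ)) ^ 2 := by gcongr
            _ = H ^ (-1 / 10 : ℝ) := by
              rw [← Real.rpow_natCast, ← Real.rpow_mul hH0.le, ← Real.rpow_add hH0]; norm_num
            _ ≤ H ^ (-1 / 12 : ℝ) := Real.rpow_le_rpow_of_exponent_le hH1 (by norm_num)
            _ ≤ α := hα
      _ = 2 * (α * H) * ∑ d ∈ Ioc ⌊D⌋₊ M1, 1 / (d : ℝ) ^ 2
          + (M1 - ⌊D⌋₊ : ℕ) * (C * H ^ (3 / 5 : ℝ)) := by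
          rw [sum_add_distrib, ← mul_sum, sum_const, Nat.card_Ioc, nsmul_eq_mul]
      _ ≤ 2 * (α * H) * (2 / D) + H ^ (1 / 20 : ℝ) * (C * H ^ (3 / 5 : ℝ)) := by
          gcongr
          · exact sum_Ioc_inv_sq_le hD M1
          · exact le_trans (by exact_mod_cast Nat.sub_le _ _) hM1
      _ = 4 * (α * H / D) + C * H ^ (13 / 20 : ℝ) := by
          rw [show (13 / 20 : ℝ) = 1 / 20 + 3 / 5 by norm_num, Real.rpow_add hH0]; ring
      _ ≤ 4 * (α * H / D) + C * (α * H / D) := by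
          gcongr
          exact hpw _ (by norm_num)
      _ = _ := by ring
  have b2 : ∑ d ∈ Ioc M1 M2, (#(S d) : ℝ) ≤ 5 * (α * H / D) := by
    calc ∑ d ∈ Ioc M1 M2, (#(S d) : ℝ)
        ≤ ∑ d ∈ Ioc M1 M2, ((α * H ^ c + 1) * (1 / (d : ℝ) ^ 2) + 1) := by
          refine sum_le_sum fun d hd => ?_
          rw [mem_Ioc] at hd
          refine (card_near_multiple_le hc.le hα0 hα1 hH0.le d n0 n1 hn01 hn1 (by omega)).trans
            (le_of_eq (by ring))
      _ = (α * H ^ c + 1) * ∑ d ∈ Ioc M1 M2, 1 / (d : ℝ) ^ 2 + (M2 - M1 : ℕ) := by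
          rw [sum_add_distrib, ← mul_sum, sum_const, Nat.card_Ioc, nsmul_eq_mul, mul_one]
      _ ≤ (α * H ^ c + 1) * (2 / H ^ (1 / 20 : ℝ)) + H ^ (3 / 5 : ℝ) := by
          gcongr
          · exact sum_Ioc_inv_sq_le (Real.one_le_rpow hH1 (by norm_num)) M2
          · exact le_trans (by exact_mod_cast Nat.sub_le _ _) hM2
      _ = 2 * (α * H ^ c / H ^ (1 / 20 : ℝ)) + 2 * H ^ (-(1 / 20) : ℝ) + H ^ (3 / 5 : ℝ) := by
          rw [Real.rpow_neg hH0.le]; ring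
      _ ≤ 2 * (α * H / D) + 2 * (α * H / D) + α * H / D := by
          refine add_le_add (add_le_add (mul_le_mul_of_nonneg_left ?_ zero_le_two)
            (mul_le_mul_of_nonneg_left (hpw _ (by norm_num)) zero_le_two)) (hpw _ (by norm_num))
          · rw [div_le_div_iff₀ (by positivity) hD0]
            calc α * H ^ c * D ≤ α * H ^ (27 / 26 : ℝ) * H ^ (1 / 200 : ℝ) := by gcongr
              _ = α * H ^ (27 / 26 + 1 / 200 : ℝ) := by rw [mul_assoc, ← Real.rpow_add hH0]
              _ ≤ α * H ^ (1 + 1 / 20 : ℝ) := by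
                refine mul_le_mul_of_nonneg_left ?_ hα0.le
                exact Real.rpow_le_rpow_of_exponent_le hH1 (by norm_num)
              _ = _ := by rw [Real.rpow_add hH0, Real.rpow_one, mul_assoc]
      _ = _ := by ring
  have b3 : (#L : ℝ) ≤ 2 * (α * H / D) := by
    refine (card_near_large_square_le hc.le hα0 hα1 hH hαH hX (by positivity) n0 n1 hn01 hn1).trans ?_
    calc 2 * H ^ 2 / (H ^ (3 / 5 : ℝ)) ^ 2 = 2 * (H ^ (4 / 5 : ℝ)) := by
          rw [mul_div_assoc, ← div_pow, ← Real.rpow_one_sub' hH0.le (by norm_num),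
            ← Real.rpow_natCast, ← Real.rpow_mul hH0.le]; norm_num
      _ ≤ _ := by gcongr; exact hpw _ (by norm_num)
  linarith

lemma add_rpow_bounds {c H α β m x : ℝ} (hc : 1 < c) (hc2 : c ≤ 27 / 26) (hH : 64 ≤ H)
    (hα : α = H ^ (2 - 2 * c) / c) (hβ : 3 / 4 ≤ β) (hβ2 : β ≤ 5 / 4) (hx : 0 ≤ x)
    (hxH : x ≤ H ^ c) (hm : |m - (H ^ 2 + α * β - α * x)| ≤ α / 8) :
    H ^ (2 * c) + β - 1 / 8 ≤ x + m ^ c ∧ x + m ^ c ≤ H ^ (2 * c) + β + 4 / 25 + 1 / 200 := by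
  have hH0 : 0 < H := by linarith
  have hH1 : 1 ≤ H := by linarith
  have hc0 : 0 < c := by linarith
  have hN0 : 0 < H ^ (2 * c) := by positivity
  set Nr := H ^ (2 * c) with hNr
  have hα0 : 0 < α := by rw [hα]; positivity
  set e := (m - (H ^ 2 + α * β - α * x)) / α with he
  have he1 : |e| ≤ 1 / 8 := by
    rw [he, abs_div, abs_of_pos hα0, div_le_iff₀ hα0]
    linarith
  rw [abs_le] at he1
  set w := x - β - e with hw
  have hmw : m = H ^ 2 - α * w := by
    rw [hw, he]; field_simp; ring
  have hαN : α * (c * Nr) = H ^ 2 := by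
    rw [hα, hNr, ← Real.rpow_natCast H 2,
      show ((2:ℕ):ℝ) = (2 - 2 * c) + 2 * c by push_cast; ring, Real.rpow_add hH0]
    field_simp
  set u := w / (c * Nr) with hu
  have hmu : m = H ^ 2 * (1 + -u) := by
    rw [hmw, hu, ← hαN]; field_simp
    ring
  have hHc : 64 ≤ H ^ c := hH.trans (by
    calc H = H ^ (1:ℝ) := (Real.rpow_one _).symm
      _ ≤ _ := Real.rpow_le_rpow_of_exponent_le hH1 hc.le)
  have hNsq : Nr = (H ^ c) ^ 2 := by
    rw [hNr, ← Real.rpow_natCast, ← Real.rpow_mul hH0.le]; congr 1; push_cast; ring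
  have hw2 : w ^ 2 ≤ Nr := by
    rw [hNsq]
    apply sq_le_sq'
    · linarith [he1.1, he1.2]
    · linarith [he1.1, he1.2]
  have hu1 : u ≤ 1 := by
    rw [hu, div_le_one (by positivity)]
    have : w ≤ Nr := by nlinarith
    nlinarith
  have hmc : m ^ c = Nr * (1 + -u) ^ c := by
    rw [hmu, Real.mul_rpow (by positivity) (by linarith), hNr]
    congr 1
    rw [← Real.rpow_natCast, ← Real.rpow_mul hH0.le]; norm_num
  have hcu : Nr * (c * u) = w := by rw [hu]; field_simp
  have lo : 1 + c * -u ≤ (1 + -u) ^ c := one_add_mul_self_le_rpow_one_add (by linarith) hc.le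
  have hi : (1 + -u) ^ c ≤ (1 + -u) * (1 + (c - 1) * -u) := by
    rcases eq_or_lt_of_le hu1 with h | h
    · rw [h]; norm_num; rw [Real.zero_rpow hc0.ne']
    · calc (1 + -u) ^ c = (1 + -u) * (1 + -u) ^ (c - 1) := by
            rw [← Real.rpow_one_add' (by linarith) (by linarith)]; congr 1; ring
        _ ≤ _ := by
            have := rpow_one_add_le_one_add_mul_self (s := -u) (p := c - 1) (by linarith)
              (by linarith) (by linarith)
            exact mul_le_mul_of_nonneg_left this (by linarith)
  have h2 : Nr * u ^ 2 ≤ 1 := by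
    have : Nr * u ^ 2 = w ^ 2 / (c ^ 2 * Nr) := by rw [hu]; field_simp
    rw [this, div_le_one (by positivity)]
    have : 1 ≤ c ^ 2 := one_le_pow₀ hc.le
    nlinarith
  constructor
  · have := mul_le_mul_of_nonneg_left lo hN0.le
    rw [hmc]
    nlinarith [he1.1, he1.2]
  · have := mul_le_mul_of_nonneg_left hi hN0.le
    rw [hmc]
    have h3 : Nr * ((1 + -u) * (1 + (c - 1) * -u)) = Nr - w + (c - 1) * (Nr * u ^ 2) := by
      rw [← hcu]; ring
    have h4 : (c - 1) * (Nr * u ^ 2) ≤ (1 / 26) * 1 := by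
      gcongr
      linarith
    linarith [he1.1, he1.2]

lemma floor_add_floor_eq {A B : ℝ} {N : ℤ} {k : ℝ} (h1 : N + k + 5 / 8 ≤ A + B)
    (h2 : A + B ≤ N + k + 23 / 25) (hk : k ≤ Int.fract A) (hk2 : Int.fract A < 1 / 2 + k) :
    ⌊A⌋ + ⌊B⌋ = N := by
  have h3 := Int.floor_add_fract A
  have h4 : ⌊B⌋ = N - ⌊A⌋ := by
    rw [Int.floor_eq_iff]
    push_cast
    constructor <;> linarith
  omega

lemma tent_sub_int (η y : ℝ) (k : ℤ) : tent η (y - k) = tent η y := by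
  unfold tent
  rw [round_sub_intCast]
  push_cast
  rw [sub_sub_sub_cancel_right]

lemma exists_dvd_one_add_mul {r d : ℕ} (h : Nat.Coprime d r) :
    ∃ q : ℤ, ((d : ℤ) ^ 2) ∣ 1 + r * q := by
  have h1 : IsCoprime ((d : ℤ) ^ 2) (r : ℤ) := (Nat.isCoprime_iff_coprime.2 h).pow_left
  obtain ⟨u, v, huv⟩ := h1
  exact ⟨-v, u, by linear_combination -huv⟩

lemma tent_le_tent_of_dvd {η y : ℝ} {d r : ℕ} {q i : ℤ} (hη : 0 < η) (hd : 1 ≤ d)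
    (hdr : Nat.Coprime d r) (hq : ((d : ℤ) ^ 2) ∣ 1 + r * q) (hi : ((d : ℤ) ^ 2) ∣ 1 + r * i)
    (hy : round y = i) : tent η y ≤ tent (η / (d : ℝ) ^ 2) ((y - q) / (d : ℝ) ^ 2) := by
  have h1 : IsCoprime ((d : ℤ) ^ 2) (r : ℤ) := (Nat.isCoprime_iff_coprime.2 hdr).pow_left
  have h2 : ((d : ℤ) ^ 2) ∣ i - q := by
    have h3 := dvd_sub hi hq
    rw [show 1 + (r:ℤ) * i - (1 + r * q) = r * (i - q) by ring] at h3
    exact h1.dvd_of_dvd_mul_left h3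
  obtain ⟨j, hj⟩ := h2
  have hd0 : (0:ℝ) < (d:ℝ) ^ 2 := by
    have : (0:ℝ) < d := by exact_mod_cast hd
    positivity
  rw [← tent_sub_int η y q]
  refine tent_le_tent_div (j := j) hη hd0 ?_
  rw [round_sub_intCast, hy, hj]
  push_cast
  ring

lemma sum_tent_le_or_exists {c α X D H : ℝ} {r : ℕ} (hα0 : 0 < α) (hα1 : α ≤ 1)
    (hr : 1 ≤ r) (hD : 1 ≤ D) (hH : 1 ≤ H) {n0 n1 : ℕ} (hn0 : 1 ≤ n0) (hn1 : (n1 : ℝ) ≤ H + 1) {J : Finset ℕ}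
    (hJ : J ⊆ Ico n0 n1) {φ φ2 : ℕ → ℝ} (hφ : ∀ n, φ n ≤ φ2 n) (hφ0 : ∀ n, 0 ≤ φ2 n)
    (hφ2 : ∀ n, φ2 n ≤ 2) (hz : ∀ n ∈ J, 2 ≤ X - α * (n : ℝ) ^ c) :
    (∃ n ∈ J, n.Prime ∧ 0 < φ n ∧ ∃ i : ℕ, Squarefree (1 + r * i) ∧
      round ((X - α * (n : ℝ) ^ c - 1) / r) = i ∧
      |((1 + r * i : ℕ) : ℝ) - (X - α * (n : ℝ) ^ c)| ≤ α / 8) ∨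
    ∃ b : ℕ → ℝ, ∑ n ∈ J, Λ n * (φ n * tent (α / r / 8) (α / r * (n : ℝ) ^ c - (X - 1) / r)) ≤
      ∑ d ∈ (Icc 2 ⌊D⌋₊).filter fun d => Nat.Coprime d r, ∑ n ∈ J, Λ n * (φ2 n *
        tent (α / r / (d : ℝ) ^ 2 / 8) (α / r / (d : ℝ) ^ 2 * (n : ℝ) ^ c - b d)) +
      2 * Real.log H * #(near c α X n0 n1 fun m => ∃ d : ℕ, D < d ∧ d ^ 2 ∣ m) +
      2 * ∑ n ∈ J.filter fun n => ¬ n.Prime, Λ n := by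
  rw [or_iff_not_imp_left]
  intro hno
  have hr0 : (0:ℝ) < r := by exact_mod_cast hr
  have hr1 : (1:ℝ) ≤ r := by exact_mod_cast hr
  have hD0 : 0 ≤ D := by linarith
  choose! q hq using fun (d : ℕ) (h : Nat.Coprime d r) => exists_dvd_one_add_mul h
  refine ⟨fun d => ((X - 1) / r - q d) / (d : ℝ) ^ 2, ?_⟩
  set T := near c α X n0 n1 fun m => ∃ d : ℕ, D < d ∧ d ^ 2 ∣ m with hT
  set E := (Icc 2 ⌊D⌋₊).filter fun d => Nat.Coprime d r with hE
  set V : ℕ → ℕ → ℝ := fun d n => tent (α / r / (d : ℝ) ^ 2 / 8)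
    (α / r / (d : ℝ) ^ 2 * (n : ℝ) ^ c - ((X - 1) / r - q d) / (d : ℝ) ^ 2) with hV
  set W : ℕ → ℝ := fun n => tent (α / r / 8) (α / r * (n : ℝ) ^ c - (X - 1) / r) with hW
  have hV0 : ∀ d n, 0 ≤ V d n := fun d n => tent_nonneg _ _
  have hW0 : ∀ n, 0 ≤ W n := fun n => tent_nonneg _ _
  have hη : 0 < α / r / 8 := by positivity
  have hW1 : ∀ n, W n ≤ 1 := fun n => tent_le_one hη _
  have hlam : ∀ n, (0:ℝ) ≤ Λ n := fun n => vonMangoldt_nonneg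
  have key : ∀ n ∈ J, Λ n * (φ n * W n) ≤ ∑ d ∈ E, Λ n * (φ2 n * V d n)
      + (if n ∈ T then 2 * Real.log H else 0) + (if ¬ n.Prime then 2 * Λ n else 0) := by
    intro n hn
    have hnI := mem_Ico.1 (hJ hn)
    have hn1' : (1:ℝ) ≤ n := by
      have : 1 ≤ n := by omega
      exact_mod_cast this
    have hnH : (n:ℝ) ≤ H := by
      have : (n:ℝ) + 1 ≤ n1 := by exact_mod_cast hnI.2
      linarith
    have t1 : 0 ≤ ∑ d ∈ E, Λ n * (φ2 n * V d n) :=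
      sum_nonneg fun d _ => mul_nonneg (hlam n) (mul_nonneg (hφ0 n) (hV0 d n))
    have t2 : (0:ℝ) ≤ if n ∈ T then 2 * Real.log H else 0 := by
      have := Real.log_nonneg hH
      split_ifs <;> positivity
    have t3 : (0:ℝ) ≤ if ¬ n.Prime then 2 * Λ n else 0 := by
      have := hlam n
      split_ifs <;> positivity
    have hle : Λ n * (φ n * W n) ≤ Λ n * (φ2 n * W n) :=
      mul_le_mul_of_nonneg_left (mul_le_mul_of_nonneg_right (hφ n) (hW0 n)) (hlam n)
    have hle2 : Λ n * (φ n * W n) ≤ 2 * Λ n := by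
      have : φ2 n * W n ≤ 2 * 1 := mul_le_mul (hφ2 n) (hW1 n) (hW0 n) zero_le_two
      have := mul_le_mul_of_nonneg_left this (hlam n)
      linarith
    by_cases hpr : n.Prime
    swap
    · rw [if_pos hpr] at t3 ⊢
      linarith
    by_cases hφn : 0 < φ n
    swap
    · have : φ n * W n ≤ 0 := mul_nonpos_of_nonpos_of_nonneg (not_lt.1 hφn) (hW0 n)
      have := mul_nonpos_of_nonneg_of_nonpos (hlam n) this
      linarith
    rcases eq_or_lt_of_le (hW0 n) with hWn | hWn
    · rw [← hWn, mul_zero, mul_zero]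
      linarith
    set z := X - α * (n : ℝ) ^ c with hzdef
    have hz2 := hz n hn
    set y := (z - 1) / r with hy
    have hWy : W n = tent (α / r / 8) y := by
      rw [hW, ← tent_neg]
      simp only
      congr 1
      rw [hy, hzdef]; ring
    rw [hWy] at hWn
    have hround := abs_sub_round_lt_of_tent_pos hη hWn
    set i := round y with hi
    have hyz : y * r = z - 1 := by rw [hy]; field_simp
    have hmz : |(1 + r * i : ℝ) - z| ≤ α / 8 := by
      have : (1 + r * i : ℝ) - z = -(r * (y - i)) := by linear_combination hyz
      rw [this, abs_neg, abs_mul, abs_of_pos hr0]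
      calc (r:ℝ) * |y - i| ≤ r * (α / r / 8) := by gcongr
        _ = α / 8 := by field_simp
    have hi0 : 0 ≤ i := by
      have h1 := (abs_le.1 hmz).1
      have : (0:ℝ) < r * i := by linarith
      have : (0:ℝ) < i := by
        by_contra h
        nlinarith
      exact_mod_cast this.le
    obtain ⟨k, hk⟩ := Int.eq_ofNat_of_zero_le hi0
    have hki : (i:ℝ) = k := by rw [hk]; norm_cast
    have hnsq : ¬ Squarefree (1 + r * k) := fun hsq => hno
      ⟨n, hn, hpr, hφn, k, hsq, hk, by
        push_cast
        rw [← hki]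
        exact hmz⟩
    rw [Nat.squarefree_iff_prime_squarefree] at hnsq
    push Not at hnsq
    obtain ⟨d, hdp, hdd⟩ := hnsq
    rw [← pow_two] at hdd
    have hcop : Nat.Coprime d r := by
      rw [Nat.Prime.coprime_iff_not_dvd hdp]
      intro hdr
      have h1 : d ∣ 1 + r * k := (dvd_pow_self d two_ne_zero).trans hdd
      have h2 : d ∣ 1 := (Nat.dvd_add_left (hdr.mul_right k)).1 h1
      exact hdp.one_lt.ne' (Nat.dvd_one.1 h2)
    by_cases hdD : (d:ℝ) ≤ D
    · have hdE : d ∈ E := by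
        rw [hE, mem_filter, mem_Icc]
        exact ⟨⟨hdp.two_le, Nat.le_floor hdD⟩, hcop⟩
      have h1 : W n ≤ V d n := by
        have h2 := tent_le_tent_of_dvd hη hdp.one_lt.le hcop (hq d hcop) (i := i)
          (by rw [hk]; exact_mod_cast hdd) hi.symm
        rw [hWy]
        refine h2.trans (le_of_eq ?_)
        rw [hV, ← tent_neg]
        simp only
        congr 1
        · ring
        · rw [hy, hzdef]; ring
      have h3 : Λ n * (φ2 n * V d n) ≤ ∑ d ∈ E, Λ n * (φ2 n * V d n) :=
        single_le_sum (f := fun d => Λ n * (φ2 n * V d n))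
          (fun d _ => mul_nonneg (hlam n) (mul_nonneg (hφ0 n) (hV0 d n))) hdE
      have h4 : Λ n * (φ2 n * W n) ≤ Λ n * (φ2 n * V d n) :=
        mul_le_mul_of_nonneg_left (mul_le_mul_of_nonneg_left h1 (hφ0 n)) (hlam n)
      linarith
    · have hnT : n ∈ T := by
        rw [hT, mem_near]
        refine ⟨hJ hn, 1 + r * k, ⟨d, not_le.1 hdD, hdd⟩, ?_⟩
        push_cast
        rw [← hki]
        exact hmz
      have h5 : Λ n ≤ Real.log H :=
        vonMangoldt_le_log.trans (Real.log_le_log (by linarith) hnH)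
      rw [if_pos hnT]
      linarith
  refine (sum_le_sum key).trans ?_
  rw [sum_add_distrib, sum_add_distrib, sum_comm]
  refine add_le_add (add_le_add le_rfl ?_) ?_
  · rw [← sum_filter, sum_const, nsmul_eq_mul, mul_comm]
    have := Real.log_nonneg hH
    refine mul_le_mul_of_nonneg_left ?_ (by positivity)
    have : #(J.filter fun n => n ∈ T) ≤ #T := card_le_card fun n hn => (mem_filter.1 hn).2
    exact_mod_cast this
  · rw [← sum_filter, mul_sum]

open Filter Topology

lemma eventually_mul_log_sq_le (C : ℝ) {δ : ℝ} (hδ : 0 < δ) :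
    ∀ᶠ H : ℝ in atTop, C * Real.log H ^ 2 ≤ H ^ δ := by
  have h := (isLittleO_log_rpow_rpow_atTop 2 hδ).bound
    (show (0:ℝ) < 1 / (|C| + 1) by positivity)
  filter_upwards [h, eventually_ge_atTop 1] with H hH hH1
  have h1 : 0 ≤ Real.log H := Real.log_nonneg hH1
  rw [Real.norm_of_nonneg (by positivity), Real.norm_of_nonneg (by positivity),
    Real.rpow_two, one_div, inv_mul_eq_div, le_div_iff₀ (by positivity)] at hH
  have h2 : C ≤ |C| + 1 := by linarith [le_abs_self C]
  calc C * Real.log H ^ 2 ≤ (|C| + 1) * Real.log H ^ 2 := by gcongr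
    _ ≤ _ := by linarith

lemma eventually_mul_log_le (C : ℝ) {δ : ℝ} (hδ : 0 < δ) :
    ∀ᶠ H : ℝ in atTop, C * Real.log H ≤ H ^ δ := by
  filter_upwards [eventually_mul_log_sq_le |C| hδ,
    Real.tendsto_log_atTop.eventually_ge_atTop 1] with H h1 h2
  refine le_trans ?_ h1
  calc C * Real.log H ≤ |C| * Real.log H := by gcongr; exact le_abs_self C
    _ ≤ |C| * Real.log H ^ 2 := by gcongr; nlinarith

lemma eventually_const_le (C : ℝ) {δ : ℝ} (hδ : 0 < δ) :
    ∀ᶠ H : ℝ in atTop, C ≤ H ^ δ :=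
  (tendsto_rpow_atTop hδ).eventually_ge_atTop C

lemma eventually_norm_sum_tent_le {c ω : ℝ} (hc : 1 < c) (hc2 : c ≤ 27 / 26) (hω : 0 < ω)
    (hω2 : ω ≤ 1 / 10000) :
    ∀ᶠ H : ℝ in atTop, ∀ (h a b : ℝ) (n0 n1 : ℕ), H / 4 ≤ n0 → (n1 : ℝ) ≤ H + 1 →
      |h| ≤ 2 → H ^ (-153 / 2000 : ℝ) ≤ a → a ≤ 1 →
      (h ≠ 0 → ∀ k : ℤ, H ^ (ω - c) ≤ |h + k * a|) →
      ‖∑ n ∈ Ico n0 n1, (Λ n : ℂ) * ee (h * (n : ℝ) ^ c) *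
          (tent (a / 8) (a * (n : ℝ) ^ c - b) : ℂ)
        - (if h = 0 then (a / 8 : ℂ) * ∑ n ∈ Ico n0 n1, (Λ n : ℂ) else 0)‖
      ≤ a * H ^ (if h = 0 then 9997 / 10000 else 1 - ω / 8) := by
  obtain ⟨C, hC, hs⟩ := exists_norm_sum_tent_le hc hc2 hω (by linarith)
  filter_upwards [eventually_mul_log_sq_le C (δ := 1 / 10000) (by norm_num),
    eventually_mul_log_sq_le (2 * C) (δ := ω / 8) (by positivity), eventually_ge_atTop 64,
    eventually_const_le 2 (δ := 1 / 10) (by norm_num)] with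
    H h1 h2 hH h3
  intro h a b n0 n1 hn0 hn1 hh ha ha1 hk
  have hH0 : 0 < H := by linarith
  have hH1 : 1 ≤ H := by linarith
  have ha0 : 0 < a := lt_of_lt_of_le (by positivity) ha
  have ha5 : 2 * H ^ (-1 / 5 : ℝ) ≤ a := by
    refine le_trans ?_ ha
    calc 2 * H ^ (-1 / 5 : ℝ) ≤ H ^ (1 / 10 : ℝ) * H ^ (-1 / 5 : ℝ) := by gcongr
      _ = H ^ (-1 / 10 : ℝ) := by rw [← Real.rpow_add hH0]; norm_num
      _ ≤ _ := Real.rpow_le_rpow_of_exponent_le hH1 (by norm_num)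
  have := hs H h a b n0 n1 hH hn0 hn1 hh ha5 ha1 hk
  · have hmain : H ^ (12 / 13 : ℝ) * H ^ (1 / 10000 : ℝ) ≤ a * H ^ (9997 / 10000 : ℝ) := by
      calc H ^ (12 / 13 : ℝ) * H ^ (1 / 10000 : ℝ) = H ^ (12 / 13 + 1 / 10000 : ℝ) := by
            rw [Real.rpow_add hH0]
        _ ≤ H ^ (-153 / 2000 + 9997 / 10000 : ℝ) :=
            Real.rpow_le_rpow_of_exponent_le hH1 (by norm_num)
        _ = H ^ (-153 / 2000 : ℝ) * H ^ (9997 / 10000 : ℝ) := by rw [Real.rpow_add hH0]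
        _ ≤ _ := by gcongr
    by_cases h0 : h = 0
    · simp only [h0, if_true, add_zero] at this ⊢
      refine this.trans ?_
      calc C * Real.log H ^ 2 * H ^ (12 / 13 : ℝ)
          ≤ H ^ (1 / 10000 : ℝ) * H ^ (12 / 13 : ℝ) := by gcongr
        _ ≤ _ := by linarith
    · simp only [h0, if_false] at this ⊢
      refine this.trans ?_
      have e1 : H ^ (12 / 13 : ℝ) ≤ a * H ^ (1 - ω / 4) := by
        calc H ^ (12 / 13 : ℝ) ≤ H ^ (-153 / 2000 + (1 - ω / 4) : ℝ) :=
            Real.rpow_le_rpow_of_exponent_le hH1 (by linarith)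
          _ = H ^ (-153 / 2000 : ℝ) * H ^ (1 - ω / 4) := by rw [Real.rpow_add hH0]
          _ ≤ _ := by gcongr
      calc C * Real.log H ^ 2 * (H ^ (12 / 13 : ℝ) + a * H ^ (1 - ω / 4))
          ≤ C * Real.log H ^ 2 * (a * H ^ (1 - ω / 4) + a * H ^ (1 - ω / 4)) := by gcongr
        _ = 2 * C * Real.log H ^ 2 * (a * H ^ (1 - ω / 4)) := by ring
        _ ≤ H ^ (ω / 8) * (a * H ^ (1 - ω / 4)) := by gcongr
        _ = a * (H ^ (ω / 8) * H ^ (1 - ω / 4)) := by ring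
        _ = _ := by rw [← Real.rpow_add hH0]; congr 2; ring

lemma eventually_sum_vonMangoldt_ge :
    ∀ᶠ H : ℝ in atTop, 3 / 10 * H ≤ ∑ n ∈ Ico ⌈H / 4⌉₊ (⌊H⌋₊ + 1), Λ n := by
  filter_upwards [eventually_mul_log_le 400 (δ := 1 / 2) (by norm_num),
    eventually_ge_atTop 1000] with H h1 hH
  have hH0 : 0 < H := by linarith
  have hle : ∑ n ∈ Ico 1 ⌈H / 4⌉₊, Λ n ≤ Chebyshev.psi (H / 4) := by
    rw [Chebyshev.psi_eq_sum_Icc]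
    refine sum_le_sum_of_subset_of_nonneg ?_ fun _ _ _ => vonMangoldt_nonneg
    intro n hn
    rw [mem_Ico] at hn
    rw [mem_Icc]
    exact ⟨Nat.zero_le _, Nat.le_floor (Nat.lt_ceil.1 hn.2).le⟩
  have hge : Chebyshev.psi H ≤ ∑ n ∈ Ico 1 (⌊H⌋₊ + 1), Λ n := by
    rw [Chebyshev.psi_eq_sum_Icc]
    refine le_of_eq ?_
    symm
    refine sum_subset ?_ ?_
    · intro n hn
      rw [mem_Ico] at hn
      rw [mem_Icc]
      omega
    · intro n hn hn'
      rw [mem_Icc] at hn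
      rw [mem_Ico] at hn'
      have : n = 0 := by omega
      rw [this]; simp
  have hsplit := sum_Ico_consecutive (fun n => Λ n) (m := 1) (n := ⌈H / 4⌉₊) (k := ⌊H⌋₊ + 1)
    (Nat.one_le_ceil_iff.2 (by positivity)) (by
      refine Nat.ceil_le.2 ?_
      have := Nat.lt_floor_add_one H
      push_cast
      linarith)
  have c1 := Chebyshev.psi_ge' hH0.le
  have c2 := Chebyshev.psi_le (x := H / 4) (by linarith)
  have hlog4 : Real.log 4 = 2 * Real.log 2 := by
    rw [show (4:ℝ) = 2 ^ 2 by norm_num, Real.log_pow]; push_cast; ring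
  have l2 := Real.log_two_gt_d9
  have l2' := Real.log_two_lt_d9
  have hsq : √(H / 4) ≤ √H := Real.sqrt_le_sqrt (by linarith)
  have hss : √H * √H = H := Real.mul_self_sqrt hH0.le
  have hlogH : 0 ≤ Real.log H := Real.log_nonneg (by linarith)
  have hlog1 : Real.log (H / 4) ≤ Real.log H := Real.log_le_log (by positivity) (by linarith)
  have hlog2 : Real.log (H + 2) ≤ 2 * Real.log H := by
    rw [← Nat.cast_two (R := ℝ), ← Real.log_pow]
    exact Real.log_le_log (by positivity) (by push_cast; nlinarith)
  rw [← Real.sqrt_eq_rpow] at h1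
  have hs1 : 1 ≤ √H := Real.one_le_sqrt.2 (by linarith)
  have e1 : 2 * √(H / 4) * Real.log (H / 4) ≤ 2 * √H * Real.log H := by
    have : 0 ≤ Real.log (H / 4) := Real.log_nonneg (by linarith)
    gcongr
  have e2 : √H * Real.log H ≤ H / 400 := by nlinarith
  have e3 : Real.log H ≤ H / 400 := by nlinarith
  rw [hlog4] at c2
  nlinarith

lemma sum_vonMangoldt_not_prime_le {H : ℝ} (hH : 1 ≤ H) {n0 n1 : ℕ} (hn1 : (n1 : ℝ) ≤ H + 1)
    {J : Finset ℕ} (hJ : J ⊆ Ico n0 n1) :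
    ∑ n ∈ J.filter fun n => ¬ n.Prime, Λ n ≤ 2 * √H * Real.log H := by
  refine le_trans ?_ (Chebyshev.psi_sub_theta_le hH)
  rw [Chebyshev.psi_sub_theta_eq_sum_not_prime]
  have : (J.filter fun n => ¬ n.Prime).filter (fun n => n ≠ 0) ⊆ (Ioc 0 ⌊H⌋₊).filter fun n => ¬ n.Prime := by
    intro n hn
    simp only [mem_filter] at hn ⊢
    have hnI := mem_Ico.1 (hJ hn.1.1)
    have h1 : (n:ℝ) + 1 ≤ n1 := by exact_mod_cast hnI.2
    exact ⟨mem_Ioc.2 ⟨by omega, Nat.le_floor (by linarith)⟩, hn.1.2⟩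
  refine le_trans (le_of_eq ?_) (sum_le_sum_of_subset_of_nonneg this fun _ _ _ => vonMangoldt_nonneg)
  symm
  refine sum_filter_of_ne ?_
  intro n _ hn h0
  rw [h0] at hn
  simp at hn

lemma alpha_bounds {c H : ℝ} (hc : 1 < c) (hc2 : c < 82 / 79) (hH : 64 ≤ H) :
    H ^ (-6 / 79 : ℝ) / 2 ≤ H ^ (2 - 2 * c) / c ∧ H ^ (2 - 2 * c) / c ≤ 1 ∧
      H ^ (2 - 2 * c) / c * H ^ c ≤ H := by
  have hH1 : 1 ≤ H := by linarith
  have hH0 : 0 < H := by linarith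
  have h1 : H ^ (2 - 2 * c) ≤ 1 := Real.rpow_le_one_of_one_le_of_nonpos hH1 (by linarith)
  refine ⟨?_, ?_, ?_⟩
  · apply div_le_div₀ (by positivity) ?_ (by linarith) (by linarith)
    exact Real.rpow_le_rpow_of_exponent_le hH1 (by linarith)
  · rw [div_le_one (by linarith)]
    linarith
  · rw [div_mul_eq_mul_div, div_le_iff₀ (by linarith), ← Real.rpow_add hH0]
    calc H ^ (2 - 2 * c + c) ≤ H ^ (1:ℝ) := Real.rpow_le_rpow_of_exponent_le hH1 (by linarith)
      _ = H := Real.rpow_one H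
      _ ≤ H * c := by nlinarith

lemma le_div_of_alpha_ge {H α R : ℝ} (hH : 64 ≤ H) (h2 : 2 ≤ H ^ (1 / 20000 : ℝ))
    (hα : H ^ (-6 / 79 : ℝ) / 2 ≤ α) (hR : 1 ≤ R) (hR2 : R ≤ H ^ (1 / 2000 : ℝ)) :
    H ^ (-153 / 2000 : ℝ) ≤ α / R := by
  have hH1 : 1 ≤ H := by linarith
  have hH0 : 0 < H := by linarith
  rw [le_div_iff₀ (by linarith)]
  refine le_trans ?_ hα
  rw [le_div_iff₀ two_pos]
  calc H ^ (-153 / 2000 : ℝ) * R * 2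
      ≤ H ^ (-153 / 2000 : ℝ) * H ^ (1 / 2000 : ℝ) * H ^ (1 / 20000 : ℝ) := by gcongr
    _ = H ^ (-153 / 2000 + 1 / 2000 + 1 / 20000 : ℝ) := by
        rw [Real.rpow_add hH0, Real.rpow_add hH0]
    _ ≤ _ := Real.rpow_le_rpow_of_exponent_le hH1 (by norm_num)

lemma abs_sum_cos_le (J : Finset ℕ) (Λ' T x : ℕ → ℝ) (s : ℝ) :
    |∑ n ∈ J, Λ' n * (Real.cos (2 * Real.pi * (x n - s)) * T n)| ≤
      ‖∑ n ∈ J, (Λ' n : ℂ) * ee (x n) * (T n : ℂ)‖ := by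
  have h : ∑ n ∈ J, Λ' n * (Real.cos (2 * Real.pi * (x n - s)) * T n) =
      (ee (-s) * ∑ n ∈ J, (Λ' n : ℂ) * ee (x n) * (T n : ℂ)).re := by
    rw [mul_sum, Complex.re_sum]
    refine sum_congr rfl fun n _ => ?_
    have : ee (-s) * ((Λ' n : ℂ) * ee (x n) * (T n : ℂ)) =
        ((Λ' n * T n : ℝ) : ℂ) * ee (x n - s) := by
      rw [sub_eq_add_neg, ee_add]; push_cast; ring
    rw [this, Complex.re_ofReal_mul, ee_re]
    ring
  rw [h]
  refine (Complex.abs_re_le_norm _).trans ?_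
  rw [norm_mul, norm_ee, one_mul]

lemma abs_sum_trig_tent_le {c ω H : ℝ} (hω : 0 < ω) (hω2 : ω ≤ 1 / 10000) (hH : 1 ≤ H)
    {n0 n1 : ℕ} {a b : ℝ} (ha : 0 ≤ a)
    (hmain : ∀ h : ℝ, (h = 0 ∨ h = 1 ∨ h = 2) →
      ‖∑ n ∈ Ico n0 n1, (Λ n : ℂ) * ee (h * (n : ℝ) ^ c) *
          (tent (a / 8) (a * (n : ℝ) ^ c - b) : ℂ)
        - (if h = 0 then (a / 8 : ℂ) * ∑ n ∈ Ico n0 n1, (Λ n : ℂ) else 0)‖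
      ≤ a * H ^ (if h = 0 then 9997 / 10000 else 1 - ω / 8))
    {A0 A1 A2 : ℝ} (h0 : |A0| ≤ 1) (h1 : |A1| ≤ 1) (h2 : |A2| ≤ 1) :
    |∑ n ∈ Ico n0 n1, Λ n * ((A0 + A1 * Real.cos (2 * Real.pi * (1 * (n : ℝ) ^ c - 1 / 4)) +
        A2 * Real.cos (2 * Real.pi * (2 * (n : ℝ) ^ c - 1 / 2))) *
          tent (a / 8) (a * (n : ℝ) ^ c - b)) - A0 * (a / 8 * ∑ n ∈ Ico n0 n1, Λ n)| ≤
      3 * (a * H ^ (1 - ω / 8)) := by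
  set T : ℕ → ℝ := fun n => tent (a / 8) (a * (n : ℝ) ^ c - b) with hT
  set P := ∑ n ∈ Ico n0 n1, Λ n with hP
  set E := a * H ^ (1 - ω / 8) with hE
  set S0 := ∑ n ∈ Ico n0 n1, Λ n * T n with hS0
  set S1 := ∑ n ∈ Ico n0 n1, Λ n * (Real.cos (2 * Real.pi * (1 * (n : ℝ) ^ c - 1 / 4)) * T n) with hS1
  set S2 := ∑ n ∈ Ico n0 n1, Λ n * (Real.cos (2 * Real.pi * (2 * (n : ℝ) ^ c - 1 / 2)) * T n) with hS2
  have b0 : |S0 - a / 8 * P| ≤ E := by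
    have := hmain 0 (Or.inl rfl)
    simp only [if_true, zero_mul, ee_zero, mul_one] at this
    have e : (∑ n ∈ Ico n0 n1, (Λ n : ℂ) * (tent (a / 8) (a * (n : ℝ) ^ c - b) : ℂ))
        - (a / 8 : ℂ) * ∑ n ∈ Ico n0 n1, (Λ n : ℂ) = ((S0 - a / 8 * P : ℝ) : ℂ) := by
      rw [hS0, hP]; push_cast; rfl
    rw [e, Complex.norm_real, Real.norm_eq_abs] at this
    refine this.trans ?_
    rw [hE]
    gcongr
    linarith
  have b1 : |S1| ≤ E := by
    have := hmain 1 (by norm_num)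
    simp only [one_ne_zero, if_false, sub_zero] at this
    exact (abs_sum_cos_le _ _ _ (fun n => 1 * (n : ℝ) ^ c) _).trans this
  have b2 : |S2| ≤ E := by
    have := hmain 2 (by norm_num)
    simp only [two_ne_zero, if_false, sub_zero] at this
    exact (abs_sum_cos_le _ _ _ (fun n => 2 * (n : ℝ) ^ c) _).trans this
  have e : ∑ n ∈ Ico n0 n1, Λ n * ((A0 + A1 * Real.cos (2 * Real.pi * (1 * (n : ℝ) ^ c - 1 / 4)) +
        A2 * Real.cos (2 * Real.pi * (2 * (n : ℝ) ^ c - 1 / 2))) * T n) - A0 * (a / 8 * P)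
      = A0 * (S0 - a / 8 * P) + A1 * S1 + A2 * S2 := by
    have : ∑ n ∈ Ico n0 n1, Λ n * ((A0 + A1 * Real.cos (2 * Real.pi * (1 * (n : ℝ) ^ c - 1 / 4)) +
        A2 * Real.cos (2 * Real.pi * (2 * (n : ℝ) ^ c - 1 / 2))) * T n)
        = A0 * S0 + A1 * S1 + A2 * S2 := by
      rw [hS0, hS1, hS2, mul_sum, mul_sum, mul_sum, ← sum_add_distrib, ← sum_add_distrib]
      exact sum_congr rfl fun n _ => by ring
    rw [this]; ring
  rw [e]
  have hE0 : 0 ≤ E := by positivity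
  have m : ∀ A S : ℝ, |A| ≤ 1 → |S| ≤ E → |A * S| ≤ E := fun A S hA hS => by
    rw [abs_mul]
    calc |A| * |S| ≤ 1 * E := mul_le_mul hA hS (abs_nonneg _) zero_le_one
      _ = E := one_mul E
  have a1 := abs_add_le (A0 * (S0 - a / 8 * P) + A1 * S1) (A2 * S2)
  have a2 := abs_add_le (A0 * (S0 - a / 8 * P)) (A1 * S1)
  linarith [m _ _ h0 b0, m _ _ h1 b1, m _ _ h2 b2]

lemma sum_Icc_two_inv_sq_le (M : ℕ) : ∑ d ∈ Icc 2 M, 1 / (d : ℝ) ^ 2 ≤ 13 / 20 := by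
  have h := sum_le_hasSum (insert 1 (Icc 2 M)) (fun _ _ => by positivity) hasSum_zeta_two
  rw [sum_insert (by simp)] at h
  have h2 : Real.pi ^ 2 ≤ 3.1416 ^ 2 := by
    have := Real.pi_lt_d4
    have := Real.pi_pos
    gcongr
  norm_num at h h2 ⊢
  linarith

lemma fract_lt_half_of_cos_pos {x : ℝ} (h : 0 < Real.cos (2 * Real.pi * (1 * x - 1 / 4))) :
    Int.fract x < 1 / 2 := by
  by_contra! h2
  have h3 : Real.cos (2 * Real.pi * (1 * x - 1 / 4)) = Real.cos (2 * Real.pi * (Int.fract x - 1 / 4)) := by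
    rw [← Real.cos_sub_int_mul_two_pi _ ⌊x⌋]
    congr 1
    have := Int.floor_add_fract x
    linear_combination (-2 * Real.pi) * this
  rw [h3] at h
  have h4 := Int.fract_lt_one x
  have hpi := Real.pi_pos
  have := Real.cos_nonpos_of_pi_div_two_le_of_le (x := 2 * Real.pi * (Int.fract x - 1 / 4))
    (by nlinarith) (by nlinarith)
  linarith

set_option maxHeartbeats 1000000 in
lemma eventually_exists_of_nonresonant {c : ℝ} (hc : 1 < c) (hc2 : c < 82 / 79) :
    ∀ᶠ H : ℝ in atTop, ∀ N : ℤ, H ^ (2 * c) = N →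
      (∀ h : ℝ, (h = 1 ∨ h = 2) → ∀ d : ℕ, 1 ≤ d → (d : ℝ) ≤ H ^ (1 / 100000 : ℝ) → ∀ k : ℤ,
        H ^ (1 / 100000 - c) ≤ |h + k * (H ^ (2 - 2 * c) / c / (d : ℝ) ^ 2)|) →
      ∃ p m : ℕ, p.Prime ∧ Squarefree m ∧ ⌊(p : ℝ) ^ c⌋ + ⌊(m : ℝ) ^ c⌋ = N := by
  have hc3 : c ≤ 27 / 26 := by linarith
  obtain ⟨Ct, hCt, htail⟩ := exists_card_near_square_le hc hc3
  filter_upwards [eventually_norm_sum_tent_le hc hc3 (ω := 1 / 100000) (by norm_num) (by norm_num),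
    eventually_sum_vonMangoldt_ge, eventually_ge_atTop 64,
    eventually_const_le 2 (δ := 1 / 20000) (by norm_num),
    eventually_const_le 100000 (δ := 1 / 100000 / 8) (by norm_num),
    eventually_mul_log_le (2 * Ct * 10000) (δ := 1 / 100000) (by norm_num),
    eventually_mul_log_le 40000 (δ := 2 / 5) (by norm_num)] with
    H hG hP hH h20 hs1 hs2 hs3
  intro N hN hres
  by_contra hcon
  have hH0 : 0 < H := by linarith
  have hH1 : 1 ≤ H := by linarith
  obtain ⟨hαl, hα1, hαH⟩ := alpha_bounds hc hc2 hH
  set α := H ^ (2 - 2 * c) / c with hα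
  have hα0 : 0 < α := lt_of_lt_of_le (by positivity) hαl
  set n0 := ⌈H / 4⌉₊ with hn0def
  set n1 := ⌊H⌋₊ + 1 with hn1def
  have hn0 : H / 4 ≤ n0 := Nat.le_ceil _
  have hn1 : (n1 : ℝ) ≤ H + 1 := by
    rw [hn1def]; push_cast; linarith [Nat.floor_le hH0.le]
  have hn01 : 1 ≤ n0 := Nat.one_le_ceil_iff.2 (by positivity)
  set X := H ^ 2 + α * (3 / 4) with hX
  set D := H ^ (1 / 100000 : ℝ) with hD
  have hD1 : 1 ≤ D := Real.one_le_rpow hH1 (by norm_num)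
  set u1 : ℕ → ℝ := fun n => Real.cos (2 * Real.pi * (1 * (n : ℝ) ^ c - 1 / 4)) with hu1
  set u2 : ℕ → ℝ := fun n => Real.cos (2 * Real.pi * (2 * (n : ℝ) ^ c - 1 / 2)) with hu2
  have hdouble : ∀ n, u2 n = 2 * u1 n ^ 2 - 1 := by
    intro n
    rw [hu1, hu2]
    simp only
    rw [← Real.cos_two_mul]
    congr 1; ring
  have hu1b : ∀ n, -1 ≤ u1 n ∧ u1 n ≤ 1 := fun n => ⟨Real.neg_one_le_cos _, Real.cos_le_one _⟩
  set φ : ℕ → ℝ := fun n => 1 / 2 + 1 * u1 n + 1 / 2 * u2 n with hφ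
  set φ2 : ℕ → ℝ := fun n => 3 / 4 + 1 * u1 n + 1 / 4 * u2 n with hφ2
  have hpow : ∀ n ∈ Ico n0 n1, (n : ℝ) ^ c ≤ H ^ c := by
    intro n hn
    rw [mem_Ico] at hn
    have : (n:ℝ) + 1 ≤ n1 := by exact_mod_cast hn.2
    gcongr
    linarith
  have hz : ∀ n ∈ Ico n0 n1, 2 ≤ X - α * (n : ℝ) ^ c := by
    intro n hn
    have := mul_le_mul_of_nonneg_left (hpow n hn) hα0.le
    rw [hX]
    nlinarith
  have htrig : ∀ (d : ℕ) (b : ℝ), 1 ≤ d → (d : ℝ) ≤ D → ∀ A0 A1 A2 : ℝ, |A0| ≤ 1 → |A1| ≤ 1 →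
      |A2| ≤ 1 → |∑ n ∈ Ico n0 n1, Λ n * ((A0 + A1 * u1 n + A2 * u2 n) *
          tent (α / (d:ℝ) ^ 2 / 8) (α / (d:ℝ) ^ 2 * (n : ℝ) ^ c - b)) -
          A0 * (α / (d:ℝ) ^ 2 / 8 * ∑ n ∈ Ico n0 n1, Λ n)| ≤
      3 * (α / (d:ℝ) ^ 2 * H ^ (1 - (1 / 100000) / 8 : ℝ)) := by
    intro d b hd hdD A0 A1 A2 hA0 hA1 hA2
    have hd1 : (1:ℝ) ≤ d := by exact_mod_cast hd
    have hd2 : (1:ℝ) ≤ (d:ℝ) ^ 2 := one_le_pow₀ hd1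
    have hd3 : (d:ℝ) ^ 2 ≤ H ^ (1 / 2000 : ℝ) := by
      calc (d:ℝ) ^ 2 ≤ D ^ 2 := by gcongr
        _ = H ^ (1 / 50000 : ℝ) := by
          rw [hD, ← Real.rpow_natCast, ← Real.rpow_mul hH0.le]; norm_num
        _ ≤ _ := Real.rpow_le_rpow_of_exponent_le hH1 (by norm_num)
    refine abs_sum_trig_tent_le (by norm_num) (by norm_num) hH1 (by positivity) ?_ hA0 hA1 hA2
    intro h hh
    refine hG h _ b n0 n1 hn0 hn1 ?_ (le_div_of_alpha_ge hH h20 hαl hd2 hd3)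
      ((div_le_one (by positivity)).2 (hα1.trans hd2)) ?_
    · rcases hh with rfl | rfl | rfl <;> norm_num
    · intro h0 k
      exact hres h (hh.resolve_left h0) d hd hdD k
  have hsieve := sum_tent_le_or_exists (c := c) (X := X) (D := D) (H := H) (r := 1) hα0 hα1 le_rfl hD1 hH1
    hn01 hn1 (Subset.refl (Ico n0 n1)) (φ := φ) (φ2 := φ2)
    (fun n => by
      have := hu1b n
      simp only [hφ, hφ2]; rw [hdouble n]; nlinarith)
    (fun n => by simp only [hφ2]; rw [hdouble n]; nlinarith [sq_nonneg (1 + u1 n)])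
    (fun n => by
      have := hu1b n
      simp only [hφ2]; rw [hdouble n]; nlinarith) hz
  rcases hsieve with ⟨n, hn, hnp, hφn, i, hsq, -, hi⟩ | ⟨b, hb⟩
  · refine hcon ⟨n, 1 + 1 * i, hnp, hsq, ?_⟩
    have hcos : 0 < u1 n := by
      have h1 := hu1b n
      simp only [hφ] at hφn
      rw [hdouble n] at hφn
      by_contra h2
      nlinarith
    have hfr := fract_lt_half_of_cos_pos hcos
    have hb := add_rpow_bounds (β := 3 / 4) hc hc3 hH hα le_rfl (by norm_num)
      (by positivity : 0 ≤ (n:ℝ) ^ c) (hpow n hn) (m := ((1 + 1 * i : ℕ) : ℝ)) (by rw [← hX]; exact hi)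
    rw [hN] at hb
    exact floor_add_floor_eq (k := 0) (by linarith [hb.1]) (by linarith [hb.2])
      (Int.fract_nonneg _) (by linarith)
  · set P := ∑ n ∈ Ico n0 n1, Λ n with hPdef
    set Er := H ^ (1 - (1 / 100000) / 8 : ℝ) with hEr
    have hP0 : 0 ≤ P := by linarith
    have hEr0 : 0 ≤ Er := by positivity
    have hlo := (abs_le.1 (htrig 1 ((X - 1) / 1) le_rfl (by simpa using hD1) (1 / 2) 1 (1 / 2)
      (by norm_num [abs_le]) (by norm_num) (by norm_num [abs_le]))).1
    simp only [Nat.cast_one, one_pow, div_one] at hlo hb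
    have hup : ∑ d ∈ (Icc 2 ⌊D⌋₊).filter fun d => Nat.Coprime d 1, ∑ n ∈ Ico n0 n1, Λ n * (φ2 n *
        tent (α / (d : ℝ) ^ 2 / 8) (α / (d : ℝ) ^ 2 * (n : ℝ) ^ c - b d)) ≤
        13 / 20 * (3 / 4 * (α / 8 * P) + 3 * (α * Er)) := by
      have hfil : ((Icc 2 ⌊D⌋₊).filter fun d => Nat.Coprime d 1) = Icc 2 ⌊D⌋₊ :=
        filter_true_of_mem fun d _ => Nat.coprime_one_right d
      rw [hfil]
      calc _ ≤ ∑ d ∈ Icc 2 ⌊D⌋₊, 1 / (d:ℝ) ^ 2 * (3 / 4 * (α / 8 * P) + 3 * (α * Er)) := by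
            refine sum_le_sum fun d hd => ?_
            rw [mem_Icc] at hd
            have hdD : (d:ℝ) ≤ D := le_trans (by exact_mod_cast hd.2) (Nat.floor_le (by positivity))
            have := (abs_le.1 (htrig d (b d) (by omega) hdD (3 / 4) 1 (1 / 4)
              (by norm_num [abs_le]) (by norm_num) (by norm_num [abs_le]))).2
            have e : 1 / (d:ℝ) ^ 2 * (3 / 4 * (α / 8 * P) + 3 * (α * Er))
              = 3 / 4 * (α / (d:ℝ) ^ 2 / 8 * P) + 3 * (α / (d:ℝ) ^ 2 * Er) := by ring
            rw [e]
            linarith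
        _ = (∑ d ∈ Icc 2 ⌊D⌋₊, 1 / (d:ℝ) ^ 2) * (3 / 4 * (α / 8 * P) + 3 * (α * Er)) := by
            rw [sum_mul]
        _ ≤ _ := by
            gcongr
            exact sum_Icc_two_inv_sq_le _
    have ht := htail H α X D n0 n1 hH hn0 hn1 (by
        have := le_div_of_alpha_ge hH h20 hαl le_rfl (Real.one_le_rpow hH1 (by norm_num))
        rw [div_one] at this
        exact le_trans (Real.rpow_le_rpow_of_exponent_le hH1 (by norm_num)) this) hα1 hαH
        (by rw [hX, add_sub_cancel_left, abs_of_pos (by positivity)]; linarith) hD1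
        (Real.rpow_le_rpow_of_exponent_le hH1 (by norm_num))
    have hpp := sum_vonMangoldt_not_prime_le hH1 hn1 (Subset.refl (Ico n0 n1))
    have hαH0 : 0 < α * H := by positivity
    have hlog : 0 ≤ Real.log H := Real.log_nonneg hH1
    have q1 : α * Er ≤ α * H / 100000 := by
      rw [mul_div_assoc]
      refine mul_le_mul_of_nonneg_left ?_ hα0.le
      rw [hEr, Real.rpow_sub hH0, Real.rpow_one]
      gcongr
    have q2 : 2 * Real.log H * #(near c α X n0 n1 fun m => ∃ d : ℕ, D < d ∧ d ^ 2 ∣ m)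
        ≤ α * H / 10000 := by
      calc _ ≤ 2 * Real.log H * (Ct * (α * H / D)) := by gcongr
        _ = (2 * Ct * 10000 * Real.log H) * (α * H / D) / 10000 := by ring
        _ ≤ D * (α * H / D) / 10000 := by gcongr
        _ = _ := by
          have : D ≠ 0 := by positivity
          field_simp
    have q3 : 2 * ∑ n ∈ (Ico n0 n1).filter fun n => ¬ n.Prime, Λ n ≤ α * H / 10000 := by
      have : √H * H ^ (2 / 5 : ℝ) ≤ α * H := by
        have h1 := le_div_of_alpha_ge hH h20 hαl le_rfl (Real.one_le_rpow hH1 (by norm_num))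
        rw [div_one] at h1
        calc √H * H ^ (2 / 5 : ℝ) = H ^ (9 / 10 : ℝ) := by
              rw [Real.sqrt_eq_rpow, ← Real.rpow_add hH0]; norm_num
          _ ≤ H ^ (-153 / 2000 + 1 : ℝ) := Real.rpow_le_rpow_of_exponent_le hH1 (by norm_num)
          _ = H ^ (-153 / 2000 : ℝ) * H := by rw [Real.rpow_add hH0, Real.rpow_one]
          _ ≤ _ := by gcongr
      calc _ ≤ 2 * (2 * √H * Real.log H) := by gcongr
        _ = √H * (40000 * Real.log H) / 10000 := by ring
        _ ≤ √H * H ^ (2 / 5 : ℝ) / 10000 := by gcongr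
        _ ≤ _ := by gcongr
    have hPα : 3 / 10 * (α * H) ≤ α * P := by nlinarith
    linarith

lemma abs_one_add_rpow_sub_one_le {s p : ℝ} (hs : -1 < s) (hp : 0 ≤ p) (hp1 : p ≤ 1) :
    |(1 + s) ^ p - 1| ≤ |s| := by
  have h0 : 0 < 1 + s := by linarith
  rw [abs_le]
  rcases le_total 0 s with h | h
  · rw [abs_of_nonneg h]
    have h1 := rpow_one_add_le_one_add_mul_self hs.le hp hp1
    have h2 : 1 ≤ (1 + s) ^ p := Real.one_le_rpow (by linarith) hp
    constructor
    · linarith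
    · nlinarith
  · rw [abs_of_nonpos h]
    have h1 : (1 + s) ^ p ≤ 1 := Real.rpow_le_one h0.le (by linarith) hp
    have h2 : (1 + s) ^ (1:ℝ) ≤ (1 + s) ^ p :=
      Real.rpow_le_rpow_of_exponent_ge h0 (by linarith) hp1
    rw [Real.rpow_one] at h2
    constructor <;> linarith

/-- The difference between `(1 + r t) ^ c` and the linear function `k t`. -/
noncomputable def defect (c r k t : ℝ) : ℝ := (1 + r * t) ^ c - k * t

lemma abs_defect_sub_le {c H α r k δ i j : ℝ} (hc : 1 < c) (hc2 : c ≤ 27 / 26) (hH : 64 ≤ H)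
    (hα : α = H ^ (2 - 2 * c) / c) (hαH : α * H ^ c ≤ H) (hr : 1 ≤ r) (hδ : |r - k * α| ≤ δ)
    (hi : |1 + r * i - H ^ 2| ≤ 2 * (α * H ^ c)) (hj : |1 + r * j - H ^ 2| ≤ 2 * (α * H ^ c)) :
    |defect c r k i - defect c r k j| ≤ 4 * (H ^ c * δ) + 8 := by
  have hH0 : 0 < H := by linarith
  have hc0 : 0 < c := by linarith
  have hα0 : 0 < α := by rw [hα]; positivity
  have hδ0 : 0 ≤ δ := (abs_nonneg _).trans hδ
  have hr0 : 0 < r := by linarith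
  wlog hlt : j < i generalizing i j
  · rcases eq_or_lt_of_le (not_lt.1 hlt) with h | h
    · rw [h, sub_self, abs_zero]
      positivity
    · rw [abs_sub_comm]
      exact this hj hi h
  have hi' := abs_le.1 hi
  have hj' := abs_le.1 hj
  have hj0 : 0 < 1 + r * j := by nlinarith
  have hlt' : 1 + r * j < 1 + r * i := by nlinarith
  obtain ⟨ξ, hξ, hmvt⟩ := rpow_mvt c hj0 hlt'
  have hinv : c * (H ^ 2) ^ (c - 1) = 1 / α := by
    rw [hα, ← Real.rpow_natCast, ← Real.rpow_mul hH0.le, one_div_div, eq_div_iff (by positivity),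
      mul_assoc, ← Real.rpow_add hH0]
    rw [show ((2:ℕ):ℝ) * (c - 1) + (2 - 2 * c) = 0 by push_cast; ring, Real.rpow_zero, mul_one]
  set s := ξ / H ^ 2 - 1 with hs
  have hξs : ξ = H ^ 2 * (1 + s) := by rw [hs]; field_simp; ring
  have hs1 : |s| ≤ 2 * (α * H ^ c) / H ^ 2 := by
    have : s = (ξ - H ^ 2) / H ^ 2 := by rw [hs]; field_simp
    rw [this, abs_div, abs_of_pos (by positivity : 0 < H ^ 2)]
    gcongr
    rw [abs_le]
    constructor <;> linarith [hξ.1, hξ.2]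
  have hs2 : -1 < s := by
    have : 0 < H ^ 2 * (1 + s) := by rw [← hξs]; linarith [hξ.1]
    have := pos_of_mul_pos_right this (by positivity)
    linarith
  have hpw := abs_one_add_rpow_sub_one_le hs2 (p := c - 1) (by linarith) (by linarith)
  have hdiff : defect c r k i - defect c r k j =
      1 / α * (r * (1 + s) ^ (c - 1) - k * α) * (i - j) := by
    have h1 : c * ξ ^ (c - 1) = 1 / α * (1 + s) ^ (c - 1) := by
      rw [hξs, Real.mul_rpow (by positivity) (by linarith), ← mul_assoc, hinv]
    unfold defect
    rw [h1] at hmvt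
    have : 1 / α * (k * α) = k := by field_simp
    linear_combination hmvt + (i - j) * this
  have hin : |r * (1 + s) ^ (c - 1) - k * α| ≤ δ + r * (2 * (α * H ^ c) / H ^ 2) := by
    have : r * (1 + s) ^ (c - 1) - k * α = (r - k * α) + r * ((1 + s) ^ (c - 1) - 1) := by ring
    rw [this]
    refine (abs_add_le _ _).trans ?_
    rw [abs_mul, abs_of_pos hr0]
    gcongr
    exact hpw.trans hs1
  have hij : i - j ≤ 4 * (α * H ^ c) / r := by
    rw [le_div_iff₀ hr0]
    nlinarith
  rw [hdiff, abs_mul, abs_mul, abs_of_pos (by positivity : 0 < 1 / α), abs_of_pos (sub_pos.2 hlt)]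
  have hαc : α * (H ^ c * H ^ c) / H ^ 2 ≤ 1 := by
    have : α * (H ^ c * H ^ c) / H ^ 2 = 1 / c := by
      rw [hα, ← Real.rpow_natCast, ← Real.rpow_add hH0, div_mul_eq_mul_div, ← Real.rpow_add hH0]
      rw [show (2 - 2 * c + (c + c)) = ((2:ℕ):ℝ) by push_cast; ring]
      field_simp
    rw [this, div_le_one hc0]
    exact hc.le
  calc 1 / α * |r * (1 + s) ^ (c - 1) - k * α| * (i - j)
      ≤ 1 / α * (δ + r * (2 * (α * H ^ c) / H ^ 2)) * (4 * (α * H ^ c) / r) := by gcongr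
    _ = 4 * (H ^ c * δ) / r + 8 * (α * (H ^ c * H ^ c) / H ^ 2) := by field_simp; ring
    _ ≤ 4 * (H ^ c * δ) + 8 * 1 := by
        gcongr
        exact div_le_self (by positivity) hr
    _ = _ := by ring

lemma convexOn_defect {c r : ℝ} (k : ℝ) (hc : 1 ≤ c) (hr : 0 ≤ r) :
    ConvexOn ℝ (Set.Ici 0) (defect c r k) := by
  have h1 : ConvexOn ℝ (Set.Ici 0) fun t : ℝ => (1 + r * t) ^ c := by
    have h := (convexOn_rpow hc).comp_affineMap (AffineMap.lineMap (1:ℝ) (1 + r))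
    refine (h.subset ?_ (convex_Ici 0)).congr ?_
    · intro t ht
      simp only [Set.mem_preimage, Set.mem_Ici, AffineMap.lineMap_apply] at ht ⊢
      simp
      positivity
    · intro t ht
      simp [AffineMap.lineMap_apply]
      congr 1; ring
  have h2 : ConcaveOn ℝ (Set.Ici (0:ℝ)) fun t : ℝ => k * t :=
    ⟨convex_Ici 0, fun x _ y _ a b _ _ _ => by simp only [smul_eq_mul]; exact le_of_eq (by ring)⟩
  exact h1.sub h2

lemma abs_sum_filter_floor_eq_le {f v : ℕ → ℝ} {E : ℝ} {n0 n1 : ℕ} (hE : 0 ≤ E)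
    (hf : ∀ p q, n0 ≤ p → q ≤ n1 → |∑ n ∈ Ico p q, f n| ≤ E)
    (hv : ∀ x y z, n0 ≤ x → x ≤ y → y ≤ z → z < n1 → v y ≤ max (v x) (v z)) (κ : ℤ) :
    |∑ n ∈ (Ico n0 n1).filter fun n => ⌊v n⌋ = κ, f n| ≤ 2 * E := by
  have key : ∀ t : ℤ, |∑ n ∈ (Ico n0 n1).filter fun n => v n < t, f n| ≤ E := by
    intro t
    set s := (Ico n0 n1).filter fun n => v n < t with hs
    obtain ⟨p, q, hpq⟩ := exists_eq_Ico_of_convex s (by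
      intro x hx z hz y hxy hyz
      simp only [hs, mem_filter, mem_Ico] at hx hz ⊢
      refine ⟨by omega, (hv x y z hx.1.1 hxy hyz hz.1.2).trans_lt ?_⟩
      exact max_lt hx.2 hz.2)
    rw [hpq]
    rcases lt_or_ge p q with h | h
    · have hp : p ∈ s := by rw [hpq, mem_Ico]; omega
      have hq : q - 1 ∈ s := by rw [hpq, mem_Ico]; omega
      simp only [hs, mem_filter, mem_Ico] at hp hq
      exact hf p q (by omega) (by omega)
    · rw [Ico_eq_empty_of_le h, sum_empty, abs_zero]
      exact hE
  have hsplit : ∑ n ∈ (Ico n0 n1).filter fun n => ⌊v n⌋ = κ, f n =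
      (∑ n ∈ (Ico n0 n1).filter fun n => v n < ((κ + 1 : ℤ) : ℝ), f n) -
        ∑ n ∈ (Ico n0 n1).filter fun n => v n < κ, f n := by
    have hsub : ((Ico n0 n1).filter fun n => v n < κ) ⊆
        (Ico n0 n1).filter fun n => v n < ((κ + 1 : ℤ) : ℝ) := by
      refine monotone_filter_right _ fun n _ hn => ?_
      push_cast
      linarith
    rw [eq_sub_iff_add_eq, ← sum_sdiff hsub]
    congr 2
    ext n
    simp only [mem_filter, Finset.mem_sdiff, Int.floor_eq_iff]
    push_cast
    constructor
    · rintro ⟨h1, h2, h3⟩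
      exact ⟨⟨h1, h3⟩, fun h => absurd h.2 (not_lt.2 h2)⟩
    · rintro ⟨⟨h1, h2⟩, h3⟩
      exact ⟨h1, not_lt.1 fun h => h3 ⟨h1, h⟩, h2⟩
  rw [hsplit]
  have h1 := abs_le.1 (key (κ + 1))
  have h2 := abs_le.1 (key κ)
  rw [abs_le]
  constructor <;> linarith

lemma exists_sum_le_mul_sum_filter_floor_eq {I : Finset ℕ} {v w : ℕ → ℝ} {W : ℝ}
    (hI : I.Nonempty) (hw : ∀ n ∈ I, 0 ≤ w n) (hv : ∀ x ∈ I, ∀ y ∈ I, |v x - v y| ≤ W) :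
    ∃ κ : ℤ, ∑ n ∈ I, w n ≤ (2 * W + 2) * ∑ n ∈ I.filter fun n => ⌊v n⌋ = κ, w n := by
  obtain ⟨a, ha⟩ := hI
  have hW : 0 ≤ W := (abs_nonneg _).trans (hv a ha a ha)
  set t := Icc ⌊v a - W⌋ ⌊v a + W⌋ with ht
  have hmaps : ∀ n ∈ I, ⌊v n⌋ ∈ t := by
    intro n hn
    have := abs_le.1 (hv n hn a ha)
    rw [ht, mem_Icc]
    exact ⟨Int.floor_mono (by linarith), Int.floor_mono (by linarith)⟩
  have hne : t.Nonempty := ⟨_, hmaps a ha⟩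
  have hcard : (#t : ℝ) ≤ 2 * W + 2 := by
    rw [ht, Int.card_Icc]
    have h1 : ⌊v a - W⌋ ≤ ⌊v a + W⌋ := Int.floor_mono (by linarith)
    have h2 : (((⌊v a + W⌋ + 1 - ⌊v a - W⌋).toNat : ℤ) : ℝ) =
        ((⌊v a + W⌋ + 1 - ⌊v a - W⌋ : ℤ) : ℝ) := by
      rw [Int.toNat_of_nonneg (by omega)]
    rw [Int.cast_natCast] at h2
    rw [h2]
    push_cast
    linarith [Int.floor_le (v a + W), Int.lt_floor_add_one (v a - W)]
  have hpos : (0 : ℝ) < #t := by exact_mod_cast hne.card_pos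
  obtain ⟨κ, -, hκ⟩ := exists_le_sum_fiber_of_maps_to_of_nsmul_le_sum (w := w)
    (b := (∑ n ∈ I, w n) / #t) hmaps hne (by rw [nsmul_eq_mul, mul_div_cancel₀ _ hpos.ne'])
  refine ⟨κ, ?_⟩
  rw [div_le_iff₀ hpos, mul_comm] at hκ
  refine hκ.trans (mul_le_mul_of_nonneg_right hcard (sum_nonneg fun n hn => hw n ?_))
  exact (mem_filter.1 hn).1

lemma abs_one_add_mul_round_sub_le {r : ℝ} (hr : 0 < r) (y : ℝ) :
    |1 + r * round ((y - 1) / r) - y| ≤ r / 2 := by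
  have h := abs_sub_round ((y - 1) / r)
  have e : 1 + r * round ((y - 1) / r) - y = -(r * ((y - 1) / r - round ((y - 1) / r))) := by
    field_simp; ring
  rw [e, abs_neg, abs_mul, abs_of_pos hr]
  nlinarith

lemma round_eq_of_abs_lt {r y : ℝ} {i : ℤ} (hr : 1 ≤ r) (h : |1 + r * i - y| < 1 / 2) :
    round ((y - 1) / r) = i := by
  have hr0 : 0 < r := by linarith
  rw [round_eq, Int.floor_eq_iff]
  have h' := abs_lt.1 h
  constructor
  · rw [← sub_le_iff_le_add, le_div_iff₀ hr0]
    nlinarith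
  · rw [← lt_sub_iff_add_lt, div_lt_iff₀ hr0]
    nlinarith

lemma defect_round_le_max {c r k α Y : ℝ} (hc : 1 ≤ c) (hr : 0 < r) (hα : 0 ≤ α) {x y z : ℕ}
    (hxy : x ≤ y) (hyz : y ≤ z) (hz : 1 ≤ Y - α * (z : ℝ) ^ c) :
    defect c r k (round ((Y - α * (y : ℝ) ^ c - 1) / r)) ≤
      max (defect c r k (round ((Y - α * (x : ℝ) ^ c - 1) / r)))
        (defect c r k (round ((Y - α * (z : ℝ) ^ c - 1) / r))) := by
  have hmono : ∀ {a b : ℝ}, a ≤ b → round a ≤ round b := fun h => by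
    rw [round_eq, round_eq]
    exact Int.floor_mono (by linarith)
  have h1 : round ((Y - α * (z : ℝ) ^ c - 1) / r) ≤ round ((Y - α * (y : ℝ) ^ c - 1) / r) :=
    hmono (by gcongr)
  have h2 : round ((Y - α * (y : ℝ) ^ c - 1) / r) ≤ round ((Y - α * (x : ℝ) ^ c - 1) / r) :=
    hmono (by gcongr)
  have h0 : 0 ≤ round ((Y - α * (z : ℝ) ^ c - 1) / r) := by
    rw [← round_zero (α := ℝ)]
    exact hmono (div_nonneg (by linarith) hr.le)
  rw [max_comm]
  refine (convexOn_defect k hc hr.le).le_max_of_mem_Icc ?_ ?_ ⟨?_, ?_⟩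
  · exact Set.mem_Ici.2 (by exact_mod_cast h0)
  · exact Set.mem_Ici.2 (by exact_mod_cast h0.trans (h1.trans h2))
  · exact_mod_cast h1
  · exact_mod_cast h2

lemma fract_bounds_of_even {x : ℝ} (h : Even ⌊2 * x⌋) : 0 ≤ Int.fract x ∧ Int.fract x < 1 / 2 := by
  obtain ⟨j, hj⟩ := h
  rw [Int.floor_eq_iff] at hj
  push_cast at hj
  have : ⌊x⌋ = j := by rw [Int.floor_eq_iff]; constructor <;> linarith
  rw [Int.fract, this]
  constructor <;> linarith

lemma fract_bounds_of_odd {x : ℝ} (h : Odd ⌊2 * x⌋) : 1 / 2 ≤ Int.fract x ∧ Int.fract x < 1 := by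
  obtain ⟨j, hj⟩ := h
  rw [Int.floor_eq_iff] at hj
  push_cast at hj
  have : ⌊x⌋ = j := by rw [Int.floor_eq_iff]; constructor <;> linarith
  rw [Int.fract, this]
  constructor <;> linarith

/-- If twice the defect at the index `i` nearest to `n` has floor `κ`, then the parity of `κ` says in
which half of the unit interval the fractional part of `(1 + r i) ^ c` lies. -/
lemma floor_add_floor_eq_of_defect {c H α β r : ℝ} {N k i κ : ℤ} {n : ℕ} (hc : 1 < c)
    (hc2 : c ≤ 27 / 26) (hH : 64 ≤ H) (hα : α = H ^ (2 - 2 * c) / c) (hα1 : α ≤ 1 / 4) (hr : 1 ≤ r)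
    (hN : H ^ (2 * c) = N) (hβ : β = if Even κ then 3 / 4 else 5 / 4) (hn : (n : ℝ) ^ c ≤ H ^ c)
    (hκ : ⌊2 * defect c r k (round ((H ^ 2 - α * (n : ℝ) ^ c - 1) / r))⌋ = κ)
    (hi : |1 + r * i - (H ^ 2 + α * β - α * (n : ℝ) ^ c)| ≤ α / 8) :
    ⌊(n : ℝ) ^ c⌋ + ⌊(1 + r * i) ^ c⌋ = N := by
  have hH0 : 0 < H := by linarith
  have hα0 : 0 < α := by rw [hα]; positivity
  have hβ1 : 3 / 4 ≤ β ∧ β ≤ 5 / 4 := by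
    rw [hβ]; split_ifs <;> norm_num
  have hi' := abs_le.1 hi
  have hround : round ((H ^ 2 - α * (n : ℝ) ^ c - 1) / r) = i := by
    refine round_eq_of_abs_lt hr ?_
    rw [abs_lt]
    constructor <;> nlinarith
  rw [hround] at hκ
  have hfr : Int.fract (defect c r k i) = Int.fract ((1 + r * i) ^ c) := by
    rw [defect, ← Int.cast_mul, Int.fract_sub_intCast]
  have hb := add_rpow_bounds hc hc2 hH hα hβ1.1 hβ1.2 (by positivity : 0 ≤ (n : ℝ) ^ c) hn hi
  rw [hN] at hb
  rw [add_comm]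
  by_cases he : Even κ
  · rw [if_pos he] at hβ
    have hf := fract_bounds_of_even (hκ ▸ he)
    rw [hfr] at hf
    rw [hβ] at hb
    exact floor_add_floor_eq (k := 0) (by linarith [hb.1]) (by linarith [hb.2]) hf.1 (by linarith)
  · rw [if_neg he] at hβ
    have hf := fract_bounds_of_odd (hκ ▸ Int.not_even_iff_odd.1 he)
    rw [hfr] at hf
    rw [hβ] at hb
    exact floor_add_floor_eq (k := 1 / 2) (by linarith [hb.1]) (by linarith [hb.2]) hf.1
      (by linarith)

lemma eventually_alpha_le {c : ℝ} (hc : 1 < c) :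
    ∀ᶠ H : ℝ in atTop, H ^ (2 - 2 * c) / c ≤ 1 / 4 := by
  filter_upwards [eventually_const_le 4 (δ := 2 * c - 2) (by linarith), eventually_gt_atTop 0]
    with H h hH
  rw [show 2 - 2 * c = -(2 * c - 2) by ring, Real.rpow_neg hH.le]
  have : (H ^ (2 * c - 2))⁻¹ ≤ 4⁻¹ := inv_anti₀ (by norm_num) h
  rw [div_le_iff₀ (by linarith)]
  linarith

set_option maxHeartbeats 1000000 in
lemma eventually_exists_of_resonant {c : ℝ} (hc : 1 < c) (hc2 : c < 82 / 79) :
    ∀ᶠ H : ℝ in atTop, ∀ N : ℤ, H ^ (2 * c) = N →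
      ∀ r : ℕ, 1 ≤ r → (r : ℝ) ≤ 2 * H ^ (2 / 100000 : ℝ) → ∀ k : ℤ,
        |(r : ℝ) - k * (H ^ (2 - 2 * c) / c)| ≤ H ^ (3 / 100000 - c) →
      ∃ p m : ℕ, p.Prime ∧ Squarefree m ∧ ⌊(p : ℝ) ^ c⌋ + ⌊(m : ℝ) ^ c⌋ = N := by
  have hc3 : c ≤ 27 / 26 := by linarith
  obtain ⟨Ct, hCt, htail⟩ := exists_card_near_square_le hc hc3
  filter_upwards [eventually_norm_sum_tent_le hc hc3 (ω := 1 / 100000) (by norm_num) (by norm_num),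
    eventually_sum_vonMangoldt_ge, eventually_ge_atTop 64,
    eventually_const_le 2 (δ := 1 / 20000) (by norm_num),
    eventually_const_le 50 (δ := 1 / 100000) (by norm_num),
    eventually_const_le 10000 (δ := 26 / 100000) (by norm_num),
    eventually_mul_log_le (2 * Ct * 10000) (δ := 1 / 100000) (by norm_num),
    eventually_mul_log_le 40000 (δ := 2 / 5) (by norm_num), eventually_alpha_le hc] with
    H hG hP hH h20 h50 hs1 hs2 hs3 hα4
  intro N hN r hr hrH k hk
  by_contra hcon
  have hH0 : 0 < H := by linarith
  have hH1 : 1 ≤ H := by linarith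
  obtain ⟨hαl, hα1, hαH⟩ := alpha_bounds hc hc2 hH
  set α := H ^ (2 - 2 * c) / c with hα
  have hα0 : 0 < α := lt_of_lt_of_le (by positivity) hαl
  have hαlow := le_div_of_alpha_ge hH h20 hαl le_rfl (Real.one_le_rpow hH1 (by norm_num))
  rw [div_one] at hαlow
  have hr1 : (1 : ℝ) ≤ r := by exact_mod_cast hr
  have hr0 : (0 : ℝ) < r := by linarith
  set n0 := ⌈H / 4⌉₊ with hn0def
  set n1 := ⌊H⌋₊ + 1 with hn1def
  have hn0 : H / 4 ≤ n0 := Nat.le_ceil _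
  have hn1 : (n1 : ℝ) ≤ H + 1 := by
    rw [hn1def]; push_cast; linarith [Nat.floor_le hH0.le]
  have hn01 : 1 ≤ n0 := Nat.one_le_ceil_iff.2 (by positivity)
  have hpow : ∀ n ∈ Ico n0 n1, (n : ℝ) ^ c ≤ H ^ c := by
    intro n hn
    rw [mem_Ico] at hn
    have : (n:ℝ) + 1 ≤ n1 := by exact_mod_cast hn.2
    gcongr
    linarith
  have hy : ∀ n ∈ Ico n0 n1, 2 ≤ H ^ 2 - α * (n : ℝ) ^ c := by
    intro n hn
    have := mul_le_mul_of_nonneg_left (hpow n hn) hα0.le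
    nlinarith
  set v : ℕ → ℝ := fun n => 2 * defect c r k (round ((H ^ 2 - α * (n : ℝ) ^ c - 1) / r)) with hv
  have hsmall : H ^ (1 / 100000 : ℝ) ≤ H ^ (1 / 20000 : ℝ) :=
    Real.rpow_le_rpow_of_exponent_le hH1 (by norm_num)
  have hrα : (r : ℝ) ≤ α * H ^ c := by
    calc (r : ℝ) ≤ H ^ (1 / 20000 : ℝ) * H ^ (2 / 100000 : ℝ) := by
          refine hrH.trans ?_
          gcongr
      _ = H ^ (1 / 20000 + 2 / 100000 : ℝ) := by rw [← Real.rpow_add hH0]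
      _ ≤ H ^ (-153 / 2000 + c : ℝ) := Real.rpow_le_rpow_of_exponent_le hH1 (by linarith)
      _ = H ^ (-153 / 2000 : ℝ) * H ^ c := by rw [Real.rpow_add hH0]
      _ ≤ _ := by gcongr
  have hround : ∀ n ∈ Ico n0 n1,
      |1 + (r : ℝ) * round ((H ^ 2 - α * (n : ℝ) ^ c - 1) / r) - H ^ 2| ≤ 2 * (α * H ^ c) := by
    intro n hn
    have h1 := abs_le.1 (abs_one_add_mul_round_sub_le hr0 (H ^ 2 - α * (n : ℝ) ^ c))
    have h2 := mul_le_mul_of_nonneg_left (hpow n hn) hα0.le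
    have h3 : 0 ≤ α * (n : ℝ) ^ c := by positivity
    rw [abs_le]
    constructor <;> linarith
  have hvar : ∀ x ∈ Ico n0 n1, ∀ y ∈ Ico n0 n1,
      |v x - v y| ≤ 2 * (4 * H ^ (3 / 100000 : ℝ) + 8) := by
    intro x hx y hy
    have h := abs_defect_sub_le hc hc3 hH hα hαH hr1 hk (hround x hx) (hround y hy)
    rw [← Real.rpow_add hH0, show c + (3 / 100000 - c) = 3 / 100000 by ring] at h
    simp only [hv]
    rw [← mul_sub, abs_mul, abs_of_pos (by norm_num : (0:ℝ) < 2)]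
    gcongr
  have hPne : (Ico n0 n1).Nonempty := by
    rw [nonempty_Ico]
    by_contra h
    rw [Ico_eq_empty_of_le (not_lt.1 h), sum_empty] at hP
    linarith
  obtain ⟨κ, hκ⟩ := exists_sum_le_mul_sum_filter_floor_eq (w := fun n => Λ n) hPne
    (fun n _ => vonMangoldt_nonneg) hvar
  set J := (Ico n0 n1).filter fun n => ⌊v n⌋ = κ with hJ
  have hJs : J ⊆ Ico n0 n1 := filter_subset _ _
  set P := ∑ n ∈ J, Λ n with hPdef
  have hP0 : 0 ≤ P := sum_nonneg fun n _ => vonMangoldt_nonneg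
  have hPlow : 3 / 10 * H ^ (1 - 4 / 100000 : ℝ) ≤ P := by
    have h1 : 2 * (2 * (4 * H ^ (3 / 100000 : ℝ) + 8)) + 2 ≤ H ^ (4 / 100000 : ℝ) := by
      have h2 : 1 ≤ H ^ (3 / 100000 : ℝ) := Real.one_le_rpow hH1 (by norm_num)
      calc 2 * (2 * (4 * H ^ (3 / 100000 : ℝ) + 8)) + 2 ≤ 50 * H ^ (3 / 100000 : ℝ) := by linarith
        _ ≤ H ^ (1 / 100000 : ℝ) * H ^ (3 / 100000 : ℝ) := by gcongr
        _ = _ := by rw [← Real.rpow_add hH0]; norm_num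
    have h3 : 3 / 10 * H ≤ H ^ (4 / 100000 : ℝ) * P :=
      hP.trans (hκ.trans (mul_le_mul_of_nonneg_right h1 hP0))
    rw [Real.rpow_sub hH0, Real.rpow_one, ← mul_div_assoc, div_le_iff₀ (by positivity)]
    linarith
  set E := H ^ (9997 / 10000 : ℝ) with hE
  have hE0 : 0 ≤ E := by positivity
  have htent : ∀ R b : ℝ, 1 ≤ R → R ≤ H ^ (1 / 2000 : ℝ) →
      |∑ n ∈ J, Λ n * tent (α / R / 8) (α / R * (n : ℝ) ^ c - b) - α / R / 8 * P| ≤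
        2 * (α / R * E) := by
    intro R b hR hR2
    have h := abs_sum_filter_floor_eq_le (n0 := n0) (n1 := n1) (v := v) (E := α / R * E)
      (f := fun n => Λ n * (tent (α / R / 8) (α / R * (n : ℝ) ^ c - b) - α / R / 8))
      (by positivity) (by
        intro p q hp hq
        have h := hG 0 (α / R) b p q (hn0.trans (by exact_mod_cast hp))
          (le_trans (by exact_mod_cast hq) hn1) (by norm_num)
          (le_div_of_alpha_ge hH h20 hαl hR hR2)
          ((div_le_one (by positivity)).2 (hα1.trans hR)) (fun h => absurd rfl h)
        simp only [if_true, zero_mul] at h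
        rw [← Real.norm_eq_abs, ← Complex.norm_real]
        convert h using 2
        push_cast
        rw [mul_sum, ← sum_sub_distrib]
        refine sum_congr rfl fun n _ => ?_
        have : ee 0 = 1 := by simp [ee]
        rw [this]
        ring) (by
        intro x y z hx hxy hyz hz
        have := defect_round_le_max (k := k) hc.le hr0 hα0.le hxy hyz
          (le_trans (by norm_num) (hy z (mem_Ico.2 ⟨by omega, hz⟩)))
        simp only [hv]
        rw [← mul_max_of_nonneg _ _ (by norm_num : (0:ℝ) ≤ 2)]
        gcongr) κ
    rw [← hJ] at h
    convert h using 2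
    rw [hPdef, mul_sum, ← sum_sub_distrib]
    exact sum_congr rfl fun n _ => by ring
  obtain ⟨β, hβ⟩ : ∃ β : ℝ, β = if Even κ then 3 / 4 else 5 / 4 := ⟨_, rfl⟩
  have hβ1 : 3 / 4 ≤ β ∧ β ≤ 5 / 4 := by
    rw [hβ]; split_ifs <;> norm_num
  set X := H ^ 2 + α * β with hX
  set D := H ^ (7 / 100000 : ℝ) with hD
  have hD1 : 1 ≤ D := Real.one_le_rpow hH1 (by norm_num)
  have hz : ∀ n ∈ J, 2 ≤ X - α * (n : ℝ) ^ c := by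
    intro n hn
    have h1 := hy n (hJs hn)
    have h2 : 0 ≤ α * β := mul_nonneg hα0.le (by linarith)
    rw [hX]
    linarith
  have hrR : ∀ d : ℕ, (d : ℝ) ≤ D → (r : ℝ) * (d : ℝ) ^ 2 ≤ H ^ (1 / 2000 : ℝ) := by
    intro d hd
    calc (r : ℝ) * (d : ℝ) ^ 2 ≤ H ^ (1 / 20000 : ℝ) * H ^ (2 / 100000 : ℝ) * D ^ 2 := by
          gcongr
          refine hrH.trans ?_
          gcongr
      _ = H ^ (1 / 20000 + 2 / 100000 + 14 / 100000 : ℝ) := by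
          rw [hD, ← Real.rpow_natCast (H ^ (7 / 100000 : ℝ)), ← Real.rpow_mul hH0.le,
            ← Real.rpow_add hH0, ← Real.rpow_add hH0]
          norm_num
      _ ≤ _ := Real.rpow_le_rpow_of_exponent_le hH1 (by norm_num)
  have hsieve := sum_tent_le_or_exists (c := c) (X := X) (D := D) (H := H) (r := r) hα0 hα1 hr hD1
    hH1 hn01 hn1 hJs (φ := fun _ => 1) (φ2 := fun _ => 1) (fun _ => le_rfl) (fun _ => zero_le_one)
    (fun _ => one_le_two) hz
  rcases hsieve with ⟨n, hn, hnp, -, i, hsq, -, hi⟩ | ⟨b, hb⟩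
  · refine hcon ⟨n, 1 + r * i, hnp, hsq, ?_⟩
    have := floor_add_floor_eq_of_defect (i := i) hc hc3 hH hα hα4 hr1 hN hβ (hpow n (hJs hn))
      (mem_filter.1 hn).2 (by push_cast at hi ⊢; exact hi)
    push_cast at this ⊢
    exact this
  · set A := α / (r : ℝ) with hA
    have hA0 : 0 < A := by positivity
    simp only [one_mul] at hb
    have hlo := (abs_le.1 (htent r ((X - 1) / r) hr1 (by simpa using hrR 1 (by simpa using hD1)))).1
    have hup : ∑ d ∈ (Icc 2 ⌊D⌋₊).filter fun d => Nat.Coprime d r, ∑ n ∈ J, Λ n *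
        tent (A / (d : ℝ) ^ 2 / 8) (A / (d : ℝ) ^ 2 * (n : ℝ) ^ c - b d) ≤
        13 / 20 * (A / 8 * P + 2 * (A * E)) := by
      calc _ ≤ ∑ d ∈ (Icc 2 ⌊D⌋₊).filter fun d => Nat.Coprime d r,
              1 / (d:ℝ) ^ 2 * (A / 8 * P + 2 * (A * E)) := by
            refine sum_le_sum fun d hd => ?_
            rw [mem_filter, mem_Icc] at hd
            have hdD : (d:ℝ) ≤ D :=
              le_trans (by exact_mod_cast hd.1.2) (Nat.floor_le (by positivity))
            have hd1 : (1:ℝ) ≤ d := by exact_mod_cast (by omega : 1 ≤ d)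
            have := (abs_le.1 (htent (r * (d:ℝ) ^ 2) (b d)
              (one_le_mul_of_one_le_of_one_le hr1 (one_le_pow₀ hd1)) (hrR d hdD))).2
            rw [← div_div, ← hA] at this
            have e : 1 / (d:ℝ) ^ 2 * (A / 8 * P + 2 * (A * E))
              = A / (d:ℝ) ^ 2 / 8 * P + 2 * (A / (d:ℝ) ^ 2 * E) := by ring
            rw [e]
            linarith
        _ ≤ ∑ d ∈ Icc 2 ⌊D⌋₊, 1 / (d:ℝ) ^ 2 * (A / 8 * P + 2 * (A * E)) :=
            sum_le_sum_of_subset_of_nonneg (filter_subset _ _) fun _ _ _ => by positivity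
        _ = (∑ d ∈ Icc 2 ⌊D⌋₊, 1 / (d:ℝ) ^ 2) * (A / 8 * P + 2 * (A * E)) := by
            rw [sum_mul]
        _ ≤ _ := by
            gcongr
            exact sum_Icc_two_inv_sq_le _
    have ht := htail H α X D n0 n1 hH hn0 hn1
      (le_trans (Real.rpow_le_rpow_of_exponent_le hH1 (by norm_num)) hαlow) hα1 hαH
      (by
        rw [hX, add_sub_cancel_left, abs_of_nonneg (mul_nonneg hα0.le (by linarith))]
        nlinarith) hD1
      (Real.rpow_le_rpow_of_exponent_le hH1 (by norm_num))
    have hpp := sum_vonMangoldt_not_prime_le hH1 hn1 hJs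
    have hlog : 0 ≤ Real.log H := Real.log_nonneg hH1
    set Q := α * H ^ (1 - 6 / 100000 : ℝ) with hQ
    have hQ0 : 0 < Q := by positivity
    set G := H ^ (1 - 4 / 100000 : ℝ) with hGdef
    have q0 : Q ≤ 2 * (A * G) := by
      have : (r : ℝ) * H ^ (1 - 6 / 100000 : ℝ) ≤ 2 * G := by
        calc _ ≤ 2 * H ^ (2 / 100000 : ℝ) * H ^ (1 - 6 / 100000 : ℝ) := by gcongr
          _ = _ := by
            rw [hGdef, mul_assoc, ← Real.rpow_add hH0]; norm_num
      have e : Q = A * ((r : ℝ) * H ^ (1 - 6 / 100000 : ℝ)) := by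
        rw [hQ, hA]; field_simp
      rw [e]
      nlinarith
    have q1 : A * E ≤ A * G / 10000 := by
      rw [mul_div_assoc]
      refine mul_le_mul_of_nonneg_left ?_ hA0.le
      rw [le_div_iff₀ (by norm_num), hE, hGdef]
      calc _ ≤ H ^ (9997 / 10000 : ℝ) * H ^ (26 / 100000 : ℝ) := by gcongr
        _ = _ := by rw [← Real.rpow_add hH0]; norm_num
    have q2 : 2 * Real.log H * #(near c α X n0 n1 fun m => ∃ d : ℕ, D < d ∧ d ^ 2 ∣ m)
        ≤ Q / 10000 := by
      calc _ ≤ 2 * Real.log H * (Ct * (α * H / D)) := by gcongr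
        _ = (2 * Ct * 10000 * Real.log H) * (α * H / D) / 10000 := by ring
        _ ≤ H ^ (1 / 100000 : ℝ) * (α * H / D) / 10000 := by gcongr
        _ = _ := by
          rw [hQ, hD, mul_div_assoc α]
          nth_rewrite 2 [← Real.rpow_one H]
          rw [← Real.rpow_sub hH0, mul_left_comm, ← Real.rpow_add hH0]
          norm_num
    have q3 : 2 * ∑ n ∈ J.filter fun n => ¬ n.Prime, Λ n ≤ Q / 10000 := by
      have : √H * H ^ (2 / 5 : ℝ) ≤ Q := by
        calc √H * H ^ (2 / 5 : ℝ) = H ^ (9 / 10 : ℝ) := by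
              rw [Real.sqrt_eq_rpow, ← Real.rpow_add hH0]; norm_num
          _ ≤ H ^ (-153 / 2000 + (1 - 6 / 100000) : ℝ) :=
            Real.rpow_le_rpow_of_exponent_le hH1 (by norm_num)
          _ = H ^ (-153 / 2000 : ℝ) * H ^ (1 - 6 / 100000 : ℝ) := by rw [Real.rpow_add hH0]
          _ ≤ _ := mul_le_mul_of_nonneg_right hαlow (by positivity)
      calc _ ≤ 2 * (2 * √H * Real.log H) := by gcongr
        _ = √H * (40000 * Real.log H) / 10000 := by ring
        _ ≤ √H * H ^ (2 / 5 : ℝ) / 10000 := by gcongr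
        _ ≤ _ := by gcongr
    have hPA : 3 / 10 * (A * G) ≤ A * P := by nlinarith
    linarith

lemma eventually_exists_prime_squarefree {c : ℝ} (hc : 1 < c) (hc2 : c < 82 / 79) :
    ∀ᶠ H : ℝ in atTop, ∀ N : ℤ, H ^ (2 * c) = N →
      ∃ p m : ℕ, p.Prime ∧ Squarefree m ∧ ⌊(p : ℝ) ^ c⌋ + ⌊(m : ℝ) ^ c⌋ = N := by
  filter_upwards [eventually_exists_of_nonresonant hc hc2, eventually_exists_of_resonant hc hc2,
    eventually_ge_atTop 64] with H hminor hmajor hH N hN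
  have hH0 : 0 < H := by linarith
  by_contra hcon
  refine hcon (hminor N hN fun h hh d hd hdH k => ?_)
  by_contra hlt
  rw [not_le] at hlt
  have hd1 : (1 : ℝ) ≤ d := by exact_mod_cast hd
  obtain ⟨h', rfl, hh1, hh2⟩ : ∃ h' : ℕ, h = h' ∧ 1 ≤ h' ∧ h' ≤ 2 := by
    rcases hh with rfl | rfl
    · exact ⟨1, by norm_num, le_rfl, by norm_num⟩
    · exact ⟨2, by norm_num, by norm_num, le_rfl⟩
  have hd2 : (d : ℝ) ^ 2 ≤ H ^ (2 / 100000 : ℝ) := by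
    calc (d : ℝ) ^ 2 ≤ (H ^ (1 / 100000 : ℝ)) ^ 2 := by gcongr
      _ = _ := by rw [← Real.rpow_natCast, ← Real.rpow_mul hH0.le]; norm_num
  refine hcon (hmajor N hN (h' * d ^ 2) (Nat.mul_pos hh1 (pow_pos hd 2)) ?_ (-k) ?_)
  · push_cast
    gcongr
    exact_mod_cast hh2
  · have e : ((h' * d ^ 2 : ℕ) : ℝ) - ((-k : ℤ) : ℝ) * (H ^ (2 - 2 * c) / c) =
        (d : ℝ) ^ 2 * (h' + k * (H ^ (2 - 2 * c) / c / (d : ℝ) ^ 2)) := by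
      push_cast
      field_simp
      ring
    rw [e, abs_mul, abs_of_pos (by positivity)]
    calc _ ≤ H ^ (2 / 100000 : ℝ) * H ^ (1 / 100000 - c) := by gcongr
      _ = _ := by rw [← Real.rpow_add hH0]; congr 1; ring

end PrimeSquarefree

/-- Suppose that `1 < c < 82/79`. Then for every sufficiently large positive integer `N`
the equation `N = [p^c] + [m^c]` has a solution in a prime `p` and a square-free
positive integer `m`. -/
theorem binary_prime_squarefree (c : ℝ) (hc1 : 1 < c) (hc2 : c < 82 / 79) :
    ∃ N₀ : ℕ, ∀ N : ℕ, N₀ ≤ N →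
      ∃ p m : ℕ, p.Prime ∧ Squarefree m ∧
        ⌊(p : ℝ) ^ c⌋ + ⌊(m : ℝ) ^ c⌋ = (N : ℤ) := by
  have htend : Filter.Tendsto (fun N : ℕ => (N : ℝ) ^ (1 / (2 * c))) Filter.atTop Filter.atTop :=
    (tendsto_rpow_atTop (by positivity)).comp tendsto_natCast_atTop_atTop
  obtain ⟨N₀, h⟩ := Filter.eventually_atTop.1
    (htend.eventually (PrimeSquarefree.eventually_exists_prime_squarefree hc1 hc2))
  refine ⟨N₀, fun N hN => h N hN N ?_⟩
  rw [← Real.rpow_mul (Nat.cast_nonneg N), one_div_mul_cancel (by positivity), Real.rpow_one,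
    Int.cast_natCast]
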